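/- POTL is expressively equivalent to first-order logic with one free variable on finite OP words: for every POTL formula φ there is a FO formula ν_φ(x) over the signature (<, χ, monadic predicates for AP) such that for all finite OP words w and positions i, (w,i) ⊨ φ iff w ⊨ ν_φ(i); and conversely, for every FO formula ψ(x) with one free variable over this signature there is a POTL formula ψ' such that for all finite OP words w and positions i, w ⊨ ψ(i) iff (w,i) ⊨ ψ'. -/

import Mathlib

noncomputable section

namespace OPLTheory

attribute [local instance] Classical.propDecidable

inductive Prec : Type where
  | lt : Prec
  | eq : Prec
  | gt : Prec

abbrev OPM (α : Type) : Type := Option α → Option α → Option Prec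

mutual
    inductive Chain (prec : ℕ → ℕ → Option Prec) : ℕ → ℕ → Prop where
    | mk {i k j : ℕ} : i < k → prec i k = some Prec.lt →
        Gap prec i k → Body prec k j → Chain prec i j
    inductive Body (prec : ℕ → ℕ → Option Prec) : ℕ → ℕ → Prop where
    | last {k j : ℕ} : k < j → prec k j = some Prec.gt → Gap prec k j → Body prec k j
    | step {k k' j : ℕ} : k < k' → prec k k' = some Prec.eq → Gap prec k k' →
        Body prec k' j → Body prec k j
    inductive Gap (prec : ℕ → ℕ → Option Prec) : ℕ → ℕ → Prop where
    | empty {a b : ℕ} : b = a + 1 → Gap prec a b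
    | chain {a b : ℕ} : Chain prec a b → Gap prec a b
end

structure OPWord (AP : Type) : Type where
  n : ℕ
  P : AP → Set ℕ

namespace OPWord

variable {AP : Type}

def lab (w : OPWord AP) (i : ℕ) : Option (Set AP) :=
  if i = 0 ∨ w.n + 1 ≤ i then none else some {a | i ∈ w.P a}

def prec (w : OPWord AP) (M : OPM (Set AP)) (i j : ℕ) : Option Prec := M (w.lab i) (w.lab j)

def ltp (w : OPWord AP) (M : OPM (Set AP)) (i j : ℕ) : Prop := w.prec M i j = some Prec.lt
def eqp (w : OPWord AP) (M : OPM (Set AP)) (i j : ℕ) : Prop := w.prec M i j = some Prec.eq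
def gtp (w : OPWord AP) (M : OPM (Set AP)) (i j : ℕ) : Prop := w.prec M i j = some Prec.gt

def chi (w : OPWord AP) (M : OPM (Set AP)) (i j : ℕ) : Prop :=
  i + 1 < j ∧ j ≤ w.n + 1 ∧ Chain (w.prec M) i j

def Compatible (w : OPWord AP) (M : OPM (Set AP)) : Prop :=
  (∀ i, i ≤ w.n → (w.prec M i (i + 1)).isSome) ∧
  (∀ i j, j ≤ w.n + 1 → Chain (w.prec M) i j → (w.prec M i j).isSome)

end OPWord

structure OPWordW (AP : Type) : Type where
  P : AP → Set ℕ

namespace OPWordW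

variable {AP : Type}

def lab (w : OPWordW AP) (i : ℕ) : Option (Set AP) :=
  if i = 0 then none else some {a | i ∈ w.P a}

def prec (w : OPWordW AP) (M : OPM (Set AP)) (i j : ℕ) : Option Prec := M (w.lab i) (w.lab j)

def ltp (w : OPWordW AP) (M : OPM (Set AP)) (i j : ℕ) : Prop := w.prec M i j = some Prec.lt
def eqp (w : OPWordW AP) (M : OPM (Set AP)) (i j : ℕ) : Prop := w.prec M i j = some Prec.eq
def gtp (w : OPWordW AP) (M : OPM (Set AP)) (i j : ℕ) : Prop := w.prec M i j = some Prec.gt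

def chi (w : OPWordW AP) (M : OPM (Set AP)) (i j : ℕ) : Prop :=
  i + 1 < j ∧ Chain (w.prec M) i j

def Compatible (w : OPWordW AP) (M : OPM (Set AP)) : Prop :=
  (∀ i, (w.prec M i (i + 1)).isSome) ∧
  (∀ i j, Chain (w.prec M) i j → (w.prec M i j).isSome)

end OPWordW

structure PFrame (AP : Type) : Type where
  atomSat : AP → ℕ → Prop
  chi : ℕ → ℕ → Prop
  pr : ℕ → ℕ → Option Prec
  valid : ℕ → Prop

namespace PFrame

variable {AP : Type} (F : PFrame AP)

def ltp (i j : ℕ) : Prop := F.pr i j = some Prec.lt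
def eqp (i j : ℕ) : Prop := F.pr i j = some Prec.eq
def gtp (i j : ℕ) : Prop := F.pr i j = some Prec.gt

def deq (i j : ℕ) : Prop := F.ltp i j ∨ F.eqp i j
def ueq (i j : ℕ) : Prop := F.gtp i j ∨ F.eqp i j

def dspSet (bnd a : ℕ) : Set ℕ := {h | h ≤ bnd ∧ F.chi a h ∧ F.deq a h}

def dspStep (bnd a b : ℕ) : Prop :=
  ((F.dspSet bnd a).Nonempty ∧ b = sSup (F.dspSet bnd a)) ∨
  (¬ (F.dspSet bnd a).Nonempty ∧ b = a + 1 ∧ F.deq a b)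

def uspSet (bnd a : ℕ) : Set ℕ := {h | h ≤ bnd ∧ F.chi a h ∧ F.ueq a h}

def uspStep (bnd a b : ℕ) : Prop :=
  ((F.uspSet bnd a).Nonempty ∧ b = sSup (F.uspSet bnd a)) ∨
  (¬ (F.uspSet bnd a).Nonempty ∧ b = a + 1 ∧ F.ueq a b)

def IsUHP (h : ℕ) (l : List ℕ) : Prop :=
  l ≠ [] ∧ l.Chain' (· < ·) ∧ (∀ p ∈ l, F.chi h p ∧ F.ltp h p) ∧
  l.Chain' (fun a b => ¬ ∃ k, a < k ∧ k < b ∧ F.chi h k)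

def IsDHP (h : ℕ) (l : List ℕ) : Prop :=
  l ≠ [] ∧ l.Chain' (· < ·) ∧ (∀ p ∈ l, F.chi p h ∧ F.gtp p h) ∧
  l.Chain' (fun a b => ¬ ∃ k, a < k ∧ k < b ∧ F.chi k h)

end PFrame

def IsPath (step : ℕ → ℕ → Prop) (l : List ℕ) (i j : ℕ) : Prop :=
  l.head? = some i ∧ l.getLast? = some j ∧ l.Chain' step

def OPWord.frame {AP : Type} (w : OPWord AP) (M : OPM (Set AP)) : PFrame AP where
  atomSat a i := i ∈ w.P a
  chi := w.chi M
  pr := w.prec M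
  valid i := i ≤ w.n + 1

def OPWordW.frame {AP : Type} (w : OPWordW AP) (M : OPM (Set AP)) : PFrame AP where
  atomSat a i := i ∈ w.P a
  chi := w.chi M
  pr := w.prec M
  valid _ := True

inductive POTL (AP : Type) : Type where
  | tt : POTL AP
  | atom (a : AP) : POTL AP
  | neg (φ : POTL AP) : POTL AP
  | orf (φ ψ : POTL AP) : POTL AP
  | nextD (φ : POTL AP) : POTL AP
  | nextU (φ : POTL AP) : POTL AP
  | backD (φ : POTL AP) : POTL AP
  | backU (φ : POTL AP) : POTL AP
  | chiFD (φ : POTL AP) : POTL AP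
  | chiFU (φ : POTL AP) : POTL AP
  | chiPD (φ : POTL AP) : POTL AP
  | chiPU (φ : POTL AP) : POTL AP
  | untilD (φ ψ : POTL AP) : POTL AP
  | untilU (φ ψ : POTL AP) : POTL AP
  | sinceD (φ ψ : POTL AP) : POTL AP
  | sinceU (φ ψ : POTL AP) : POTL AP
  | hnextD (φ : POTL AP) : POTL AP
  | hnextU (φ : POTL AP) : POTL AP
  | hbackD (φ : POTL AP) : POTL AP
  | hbackU (φ : POTL AP) : POTL AP
  | huntilD (φ ψ : POTL AP) : POTL AP
  | huntilU (φ ψ : POTL AP) : POTL AP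
  | hsinceD (φ ψ : POTL AP) : POTL AP
  | hsinceU (φ ψ : POTL AP) : POTL AP

def POTL.Sat {AP : Type} (F : PFrame AP) : POTL AP → ℕ → Prop
  | .tt, _ => True
  | .atom a, i => F.atomSat a i
  | .neg φ, i => ¬ POTL.Sat F φ i
  | .orf φ ψ, i => POTL.Sat F φ i ∨ POTL.Sat F ψ i
  | .nextD φ, i => F.valid (i + 1) ∧ F.deq i (i + 1) ∧ POTL.Sat F φ (i + 1)
  | .nextU φ, i => F.valid (i + 1) ∧ F.ueq i (i + 1) ∧ POTL.Sat F φ (i + 1)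
  | .backD φ, i => 1 ≤ i ∧ F.deq (i - 1) i ∧ POTL.Sat F φ (i - 1)
  | .backU φ, i => 1 ≤ i ∧ F.ueq (i - 1) i ∧ POTL.Sat F φ (i - 1)
  | .chiFD φ, i => ∃ j, F.chi i j ∧ F.deq i j ∧ POTL.Sat F φ j
  | .chiFU φ, i => ∃ j, F.chi i j ∧ F.ueq i j ∧ POTL.Sat F φ j
  | .chiPD φ, i => ∃ j, F.chi j i ∧ F.deq j i ∧ POTL.Sat F φ j
  | .chiPU φ, i => ∃ j, F.chi j i ∧ F.ueq j i ∧ POTL.Sat F φ j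
  | .untilD φ ψ, i => ∃ j, i ≤ j ∧ F.valid j ∧ ∃ l, IsPath (F.dspStep j) l i j ∧
      POTL.Sat F ψ j ∧ ∀ p ∈ l.dropLast, POTL.Sat F φ p
  | .untilU φ ψ, i => ∃ j, i ≤ j ∧ F.valid j ∧ ∃ l, IsPath (F.uspStep j) l i j ∧
      POTL.Sat F ψ j ∧ ∀ p ∈ l.dropLast, POTL.Sat F φ p
  | .sinceD φ ψ, i => ∃ j, j ≤ i ∧ ∃ l, IsPath (F.dspStep i) l j i ∧
      POTL.Sat F ψ j ∧ ∀ p ∈ l.tail, POTL.Sat F φ p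
  | .sinceU φ ψ, i => ∃ j, j ≤ i ∧ ∃ l, IsPath (F.uspStep i) l j i ∧
      POTL.Sat F ψ j ∧ ∀ p ∈ l.tail, POTL.Sat F φ p
  | .hnextU φ, i => ∃ h, h < i ∧ F.chi h i ∧ F.ltp h i ∧
      (∃ k, i < k ∧ F.chi h k ∧ F.ltp h k) ∧
      POTL.Sat F φ (sInf {k | i < k ∧ F.chi h k ∧ F.ltp h k})
  | .hbackU φ, i => ∃ h, h < i ∧ F.chi h i ∧ F.ltp h i ∧
      (∃ k, k < i ∧ F.chi h k ∧ F.ltp h k) ∧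
      POTL.Sat F φ (sSup {k | k < i ∧ F.chi h k ∧ F.ltp h k})
  | .hnextD φ, i => ∃ h, i < h ∧ F.chi i h ∧ F.gtp i h ∧
      (∃ k, i < k ∧ F.chi k h ∧ F.gtp k h) ∧
      POTL.Sat F φ (sInf {k | i < k ∧ F.chi k h ∧ F.gtp k h})
  | .hbackD φ, i => ∃ h, i < h ∧ F.chi i h ∧ F.gtp i h ∧
      (∃ k, k < i ∧ F.chi k h ∧ F.gtp k h) ∧
      POTL.Sat F φ (sSup {k | k < i ∧ F.chi k h ∧ F.gtp k h})
  | .huntilU φ ψ, i => ∃ h l j, h < i ∧ F.IsUHP h l ∧ l.head? = some i ∧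
      l.getLast? = some j ∧ POTL.Sat F ψ j ∧ ∀ p ∈ l.dropLast, POTL.Sat F φ p
  | .hsinceU φ ψ, i => ∃ h l j, h < j ∧ F.IsUHP h l ∧ l.getLast? = some i ∧
      l.head? = some j ∧ POTL.Sat F ψ j ∧ ∀ p ∈ l.tail, POTL.Sat F φ p
  | .huntilD φ ψ, i => ∃ h l j, j < h ∧ F.IsDHP h l ∧ l.head? = some i ∧
      l.getLast? = some j ∧ POTL.Sat F ψ j ∧ ∀ p ∈ l.dropLast, POTL.Sat F φ p
  | .hsinceD φ ψ, i => ∃ h l j, i < h ∧ F.IsDHP h l ∧ l.getLast? = some i ∧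
      l.head? = some j ∧ POTL.Sat F ψ j ∧ ∀ p ∈ l.tail, POTL.Sat F φ p

def POTL.andf {AP : Type} (φ ψ : POTL AP) : POTL AP := .neg (.orf (.neg φ) (.neg ψ))

inductive OPTL (AP : Type) : Type where
  | tt : OPTL AP
  | atom (a : AP) : OPTL AP
  | neg (φ : OPTL AP) : OPTL AP
  | orf (φ ψ : OPTL AP) : OPTL AP
  | next (φ : OPTL AP) : OPTL AP
  | back (φ : OPTL AP) : OPTL AP
  | luntil (φ ψ : OPTL AP) : OPTL AP
  | lsince (φ ψ : OPTL AP) : OPTL AP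
  | cnext (φ : OPTL AP) : OPTL AP
  | cback (φ : OPTL AP) : OPTL AP
  | suntil (pi : Set Prec) (φ ψ : OPTL AP) : OPTL AP
  | ssince (pi : Set Prec) (φ ψ : OPTL AP) : OPTL AP
  | hyuntil (φ ψ : OPTL AP) : OPTL AP
  | hysince (φ ψ : OPTL AP) : OPTL AP
  | htuntil (φ ψ : OPTL AP) : OPTL AP
  | htsince (φ ψ : OPTL AP) : OPTL AP

def optlUStep {AP : Type} (F : PFrame AP) (pi : Set Prec) (bnd a b : ℕ) : Prop :=
  (b ≤ bnd ∧ F.chi a b ∧ F.ueq a b) ∨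
  ((¬ ∃ h, h ≤ bnd ∧ F.chi a h ∧ F.ueq a h) ∧ b = a + 1 ∧ ∃ π ∈ pi, F.pr a b = some π)

def optlSStep {AP : Type} (F : PFrame AP) (pi : Set Prec) (bnd a b : ℕ) : Prop :=
  (bnd ≤ a ∧ F.chi a b ∧ F.deq a b) ∨
  ((¬ ∃ h, bnd ≤ h ∧ F.chi h b ∧ F.deq h b) ∧ b = a + 1 ∧ ∃ π ∈ pi, F.pr a b = some π)

def OPTL.Sat {AP : Type} (F : PFrame AP) : OPTL AP → ℕ → Prop
  | .tt, _ => True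
  | .atom a, i => F.atomSat a i
  | .neg φ, i => ¬ OPTL.Sat F φ i
  | .orf φ ψ, i => OPTL.Sat F φ i ∨ OPTL.Sat F ψ i
  | .next φ, i => F.valid (i + 1) ∧ OPTL.Sat F φ (i + 1)
  | .back φ, i => 1 ≤ i ∧ OPTL.Sat F φ (i - 1)
  | .luntil φ ψ, i => ∃ j, i ≤ j ∧ F.valid j ∧ OPTL.Sat F ψ j ∧
      ∀ p, i ≤ p → p < j → OPTL.Sat F φ p
  | .lsince φ ψ, i => ∃ j, j ≤ i ∧ OPTL.Sat F ψ j ∧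
      ∀ p, j < p → p ≤ i → OPTL.Sat F φ p
  | .cnext φ, i => ∃ j, F.chi i j ∧ F.ueq i j ∧ OPTL.Sat F φ j
  | .cback φ, i => ∃ j, F.chi j i ∧ F.deq j i ∧ OPTL.Sat F φ j
  | .suntil pi φ ψ, i => ∃ j, i ≤ j ∧ F.valid j ∧
      ∃ l, IsPath (optlUStep F pi j) l i j ∧ OPTL.Sat F ψ j ∧
        ∀ p ∈ l.dropLast, OPTL.Sat F φ p
  | .ssince pi φ ψ, i => ∃ j, j ≤ i ∧
      ∃ l, IsPath (optlSStep F pi j) l j i ∧ OPTL.Sat F ψ j ∧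
        ∀ p ∈ l.tail, OPTL.Sat F φ p
  | .hyuntil φ ψ, i => ∃ l : List ℕ, l ≠ [] ∧ l.Chain' (· < ·) ∧
      (∀ p ∈ l, i < p ∧ F.chi i p ∧ F.ltp i p) ∧
      (∀ j1, l.head? = some j1 → ∀ k, k < j1 → ¬ F.chi i k) ∧
      (∀ jn, l.getLast? = some jn → OPTL.Sat F ψ jn) ∧
      (∀ p ∈ l.dropLast, OPTL.Sat F φ p)
  | .hysince φ ψ, i => ∃ l : List ℕ, l ≠ [] ∧ l.Chain' (· < ·) ∧
      (∀ p ∈ l, i < p ∧ F.chi i p ∧ F.ltp i p) ∧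
      (∀ jn, l.getLast? = some jn → ∀ k, jn < k → ¬ F.chi i k) ∧
      (∀ j1, l.head? = some j1 → OPTL.Sat F ψ j1) ∧
      (∀ p ∈ l.tail, OPTL.Sat F φ p)
  | .htuntil φ ψ, i => ∃ l : List ℕ, l ≠ [] ∧ l.Chain' (· < ·) ∧
      (∀ p ∈ l, p < i ∧ F.chi p i ∧ F.gtp p i) ∧
      (∀ jn, l.getLast? = some jn → ∀ k, jn < k → k < i → ¬ F.chi k i) ∧
      (∀ jn, l.getLast? = some jn → OPTL.Sat F ψ jn) ∧
      (∀ p ∈ l.dropLast, OPTL.Sat F φ p)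
  | .htsince φ ψ, i => ∃ l : List ℕ, l ≠ [] ∧ l.Chain' (· < ·) ∧
      (∀ p ∈ l, p < i ∧ F.chi p i ∧ F.gtp p i) ∧
      (∀ j1, l.head? = some j1 → ∀ k, k < j1 → ¬ F.chi k i) ∧
      (∀ j1, l.head? = some j1 → OPTL.Sat F ψ j1) ∧
      (∀ p ∈ l.tail, OPTL.Sat F φ p)

def listWord {AP : Type} (w : List (Set AP)) : OPWord AP :=
  ⟨w.length, fun a => {i | 1 ≤ i ∧ i ≤ w.length ∧ a ∈ w.getD (i - 1) ∅}⟩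

def ListCompatible {AP : Type} (M : OPM (Set AP)) (w : List (Set AP)) : Prop :=
  (listWord w).Compatible M

def POTL.SatL {AP : Type} (M : OPM (Set AP)) (w : List (Set AP)) (i : ℕ) (φ : POTL AP) :
    Prop :=
  POTL.Sat ((listWord w).frame M) φ (i + 1)

def OPTL.SatL {AP : Type} (M : OPM (Set AP)) (w : List (Set AP)) (i : ℕ) (φ : OPTL AP) :
    Prop :=
  OPTL.Sat ((listWord w).frame M) φ (i + 1)

structure OPA (Sig Q : Type) (M : OPM Sig) : Type where
  I : Set Q
  F : Set Q
  push : Q → Sig → Q → Prop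
  shift : Q → Sig → Q → Prop
  pop : Q → Q → Q → Prop

def OPA.step {Sig Q : Type} {M : OPM Sig} (A : OPA Sig Q M) :
    List Sig × Q × List (Sig × Q) → List Sig × Q × List (Sig × Q) → Prop := fun c c' =>
  (∃ a x p q γ, c = (a :: x, p, γ) ∧ M (γ.head?.map Prod.fst) (some a) = some Prec.lt ∧
     A.push p a q ∧ c' = (x, q, (a, p) :: γ)) ∨
  (∃ b x q r a p γ, c = (b :: x, q, (a, p) :: γ) ∧ M (some a) (some b) = some Prec.eq ∧
     A.shift q b r ∧ c' = (x, r, (b, p) :: γ)) ∨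
  (∃ x q r a p γ, c = (x, q, (a, p) :: γ) ∧ M (some a) x.head? = some Prec.gt ∧
     A.pop q p r ∧ c' = (x, r, γ))

def OPA.lang {Sig Q : Type} {M : OPM Sig} (A : OPA Sig Q M) : Set (List Sig) :=
  {x | ∃ qI ∈ A.I, ∃ qF ∈ A.F, Relation.ReflTransGen A.step (x, qI, []) ([], qF, [])}

def IsOPL {Sig : Type} (M : OPM Sig) (L : Set (List Sig)) : Prop :=
  ∃ (n : ℕ) (A : OPA Sig (Fin n) M), L = A.lang

def listPow {α : Type} (v : List α) : ℕ → List α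
  | 0 => []
  | k + 1 => v ++ listPow v k

inductive CallAP : Type where
  | call : CallAP
  | ret : CallAP
  | han : CallAP
  | exc : CallAP
  | pA : CallAP
deriving DecidableEq

def callPrec : CallAP → CallAP → Option Prec
  | .call, .call => some Prec.lt
  | .call, .ret => some Prec.eq
  | .call, .han => some Prec.lt
  | .call, .exc => some Prec.gt
  | .ret, .call => some Prec.gt
  | .ret, .ret => some Prec.gt
  | .ret, .han => some Prec.gt
  | .ret, .exc => some Prec.gt
  | .han, .call => some Prec.lt
  | .han, .ret => some Prec.gt
  | .han, .han => some Prec.lt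
  | .han, .exc => some Prec.eq
  | .exc, .call => some Prec.gt
  | .exc, .ret => some Prec.gt
  | .exc, .han => some Prec.gt
  | .exc, .exc => some Prec.gt
  | _, _ => none

def theStruct (s : Set CallAP) : Option CallAP :=
  if h : ∃! x : CallAP, x ∈ s ∧ x ≠ CallAP.pA then some h.choose else none

def Mcall : OPM (Set CallAP) := fun a b =>
  match a, b with
  | none, none => none
  | none, some t => (theStruct t).bind fun _ => some Prec.lt
  | some s, none => (theStruct s).bind fun _ => some Prec.gt
  | some s, some t => (theStruct s).bind fun x => (theStruct t).bind fun y => callPrec x y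

def Lcall : Set (List (Set CallAP)) := {w | ListCompatible Mcall w}

inductive FOV (R U V : Type) : Type where
  | fal : FOV R U V
  | rel (r : R) (x y : V) : FOV R U V
  | un (u : U) (x : V) : FOV R U V
  | eqv (x y : V) : FOV R U V
  | imp (f g : FOV R U V) : FOV R U V
  | all (x : V) (f : FOV R U V) : FOV R U V

namespace FOV

variable {R U V D : Type}

def Realize [DecidableEq V] (relI : R → D → D → Prop) (unI : U → D → Prop) :
    FOV R U V → (V → D) → Prop
  | .fal, _ => False
  | .rel r x y, v => relI r (v x) (v y)
  | .un u x, v => unI u (v x)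
  | .eqv x y, v => v x = v y
  | .imp f g, v => Realize relI unI f v → Realize relI unI g v
  | .all x f, v => ∀ d : D, Realize relI unI f (Function.update v x d)

def qr : FOV R U V → ℕ
  | .fal => 0
  | .rel _ _ _ => 0
  | .un _ _ => 0
  | .eqv _ _ => 0
  | .imp f g => max f.qr g.qr
  | .all _ f => f.qr + 1

def free : FOV R U V → Set V
  | .fal => ∅
  | .rel _ x y => {x, y}
  | .un _ x => {x}
  | .eqv x y => {x, y}
  | .imp f g => f.free ∪ g.free
  | .all x f => f.free \ {x}

end FOV

inductive OPRel : Type where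
  | ord : OPRel
  | chain : OPRel

def wordRelI {AP : Type} (M : OPM (Set AP)) (w : OPWord AP) :
    OPRel → Fin (w.n + 2) → Fin (w.n + 2) → Prop
  | .ord => fun a b => (a : ℕ) < (b : ℕ)
  | .chain => fun a b => w.chi M a b

def wordUnI {AP : Type} (w : OPWord AP) : AP → Fin (w.n + 2) → Prop :=
  fun a p => (p : ℕ) ∈ w.P a

def wordRelIW {AP : Type} (M : OPM (Set AP)) (w : OPWordW AP) : OPRel → ℕ → ℕ → Prop
  | .ord => fun a b => a < b
  | .chain => fun a b => w.chi M a b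

def wordUnIW {AP : Type} (w : OPWordW AP) : AP → ℕ → Prop := fun a p => p ∈ w.P a

structure UOT (AP : Type) : Type where
  S : Set (List ℕ)
  hash : Set (List ℕ)
  L : AP → Set (List ℕ)

def rdown (s t : List ℕ) : Prop := ∃ k : ℕ, t = s ++ [k]

def rright (s t : List ℕ) : Prop := ∃ (r : List ℕ) (h : ℕ), s = r ++ [h] ∧ t = r ++ [h + 1]

namespace UOT

variable {AP : Type}

def nodeLab (T : UOT AP) (s : List ℕ) : Option (Set AP) :=
  if s ∈ T.hash then none else some {a | s ∈ T.L a}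

def prec (T : UOT AP) (M : OPM (Set AP)) (s t : List ℕ) : Option Prec :=
  M (T.nodeLab s) (T.nodeLab t)

end UOT

def RightmostChild {AP : Type} (T : UOT AP) (s t : List ℕ) : Prop :=
  t ∈ T.S ∧ rdown s t ∧ ¬ ∃ u ∈ T.S, rright t u

inductive RcRel {AP : Type} (M : OPM (Set AP)) (T : UOT AP) : List ℕ → List ℕ → Prop where
  | sib {r : List ℕ} {h : ℕ} :
      (¬ ∃ c, rdown (r ++ [h]) c ∧ c ∈ T.S ∧ T.prec M (r ++ [h]) c = some Prec.eq) →
      r ++ [h + 1] ∈ T.S →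
      RcRel M T (r ++ [h]) (r ++ [h + 1])
  | up {r : List ℕ} {h : ℕ} {x : List ℕ} :
      (¬ ∃ c, rdown (r ++ [h]) c ∧ c ∈ T.S ∧ T.prec M (r ++ [h]) c = some Prec.eq) →
      r ++ [h + 1] ∉ T.S →
      RcRel M T r x →
      RcRel M T (r ++ [h]) x

def UOT.CompatibleM {AP : Type} (T : UOT AP) (M : OPM (Set AP)) : Prop :=
  (∀ s ∈ T.S, (s ∈ T.hash ↔ s = [] ∨ RightmostChild T [] s)) ∧
  (∀ s c, s ∈ T.S → RightmostChild T s c →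
    (T.prec M s c = some Prec.lt ∨ T.prec M s c = some Prec.eq)) ∧
  (∀ s c, s ∈ T.S → c ∈ T.S → rdown s c → ¬ RightmostChild T s c →
    T.prec M s c = some Prec.lt) ∧
  (∀ s r, s ∈ T.S → RcRel M T s r → T.prec M s r = some Prec.gt)

def chiDeq {AP : Type} (w : OPWord AP) (M : OPM (Set AP)) (i j : ℕ) : Prop :=
  w.chi M i j ∧ (w.ltp M i j ∨ w.eqp M i j)

def IsTauMap {AP : Type} (M : OPM (Set AP)) (w : OPWord AP) (T : UOT AP)
    (tau : ℕ → List ℕ) : Prop :=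
  tau 0 = [] ∧
  T.S = {s | ∃ i, i ≤ w.n + 1 ∧ tau i = s} ∧
  T.hash = {s | tau 0 = s ∨ tau (w.n + 1) = s} ∧
  (∀ a, T.L a = {s | ∃ i, i ≤ w.n + 1 ∧ tau i = s ∧ i ∈ w.P a}) ∧
  ∀ i, i ≤ w.n →
    ((w.eqp M i (i + 1) ∨ w.ltp M i (i + 1)) → tau (i + 1) = tau i ++ [0]) ∧
    (w.eqp M i (i + 1) → ∀ j, j ≤ w.n + 1 → rdown (tau i) (tau j) → tau j = tau (i + 1)) ∧
    (w.gtp M i (i + 1) → ∀ j, j ≤ w.n + 1 → ¬ rdown (tau i) (tau j)) ∧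
    (∀ j, chiDeq w M i j →
      tau j = tau i ++ [{j' | chiDeq w M i j' ∧ j' < j}.ncard + 1])

def chiDeqW {AP : Type} (w : OPWordW AP) (M : OPM (Set AP)) (i j : ℕ) : Prop :=
  w.chi M i j ∧ (w.ltp M i j ∨ w.eqp M i j)

def IsTauMapW {AP : Type} (M : OPM (Set AP)) (w : OPWordW AP) (T : UOT AP)
    (tau : ℕ → List ℕ) : Prop :=
  tau 0 = [] ∧
  T.S = Set.range tau ∧
  T.hash = {s | tau 0 = s} ∧
  (∀ a, T.L a = {s | ∃ i, tau i = s ∧ i ∈ w.P a}) ∧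
  ∀ i,
    ((w.eqp M i (i + 1) ∨ w.ltp M i (i + 1)) → tau (i + 1) = tau i ++ [0]) ∧
    (w.eqp M i (i + 1) → ∀ j, rdown (tau i) (tau j) → tau j = tau (i + 1)) ∧
    (w.gtp M i (i + 1) → ∀ j, ¬ rdown (tau i) (tau j)) ∧
    (∀ j, chiDeqW w M i j →
      tau j = tau i ++ [{j' | chiDeqW w M i j' ∧ j' < j}.ncard + 1])

def IsRR {AP : Type} (T : UOT AP) (f : ℕ → List ℕ) : Prop :=
  f 0 = [] ∧ ∀ p, RightmostChild T (f p) (f (p + 1))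

def IsLR {AP : Type} (T : UOT AP) (g : List ℕ) : Prop :=
  (∃ (m : ℕ) (br : ℕ → List ℕ), br 0 = [] ∧ br m = g ∧
    ∀ p, p < m → RightmostChild T (br p) (br (p + 1))) ∧
  (∀ k : ℕ, g ++ [k] ∈ T.S)

def rrSubtree {AP : Type} (T : UOT AP) (f : ℕ → List ℕ) (p : ℕ) : Set (List ℕ) :=
  {t | t ∈ T.S ∧ f p <+: t ∧ ¬ f (p + 1) <+: t}

def lrSubtree {AP : Type} (T : UOT AP) (g : List ℕ) (p : ℕ) : Set (List ℕ) :=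
  {t | t ∈ T.S ∧ (g ++ [p]) <+: t}

def lrTf {AP : Type} (T : UOT AP) (g : List ℕ) : Set (List ℕ) :=
  {t | t ∈ T.S ∧ ¬ ∃ k : ℕ, (g ++ [k]) <+: t}

inductive TreeRel : Type where
  | down : TreeRel
  | right : TreeRel

def treeRelI (A : Set (List ℕ)) : TreeRel → ↥A → ↥A → Prop
  | .down => fun s t => rdown s.val t.val
  | .right => fun s t => rright s.val t.val

def treeUnI {AP : Type} (T : UOT AP) (A : Set (List ℕ)) : AP → ↥A → Prop :=
  fun a s => s.val ∈ T.L a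

def EquivKSent (R U : Type) {D1 D2 : Type}
    (rel1 : R → D1 → D1 → Prop) (un1 : U → D1 → Prop)
    (rel2 : R → D2 → D2 → Prop) (un2 : U → D2 → Prop) (k : ℕ) : Prop :=
  ∀ φ : FOV R U ℕ, φ.free = ∅ → φ.qr ≤ k →
    ((∀ v, φ.Realize rel1 un1 v) ↔ (∀ v, φ.Realize rel2 un2 v))

def EquivKPt (R U : Type) {D1 D2 : Type}
    (rel1 : R → D1 → D1 → Prop) (un1 : U → D1 → Prop) (a : D1)
    (rel2 : R → D2 → D2 → Prop) (un2 : U → D2 → Prop) (b : D2) (k : ℕ) : Prop :=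
  ∀ φ : FOV R U ℕ, φ.free ⊆ {0} → φ.qr ≤ k →
    (φ.Realize rel1 un1 (fun _ => a) ↔ φ.Realize rel2 un2 (fun _ => b))

def rankType (AP : Type) (k : ℕ) (T : UOT AP) (A : Set (List ℕ)) :
    Set (FOV TreeRel AP ℕ) :=
  {φ | φ.free = ∅ ∧ φ.qr ≤ k ∧ ∀ v, φ.Realize (treeRelI A) (treeUnI T A) v}

inductive Xuntil (AP : Type) : Type where
  | tt : Xuntil AP
  | atom (a : AP) : Xuntil AP
  | neg (φ : Xuntil AP) : Xuntil AP
  | andf (φ ψ : Xuntil AP) : Xuntil AP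
  | down (φ ψ : Xuntil AP) : Xuntil AP
  | up (φ ψ : Xuntil AP) : Xuntil AP
  | right (φ ψ : Xuntil AP) : Xuntil AP
  | left (φ ψ : Xuntil AP) : Xuntil AP

def XSat {AP : Type} (T : UOT AP) : Xuntil AP → List ℕ → Prop
  | .tt, _ => True
  | .atom a, s => s ∈ T.L a
  | .neg φ, s => ¬ XSat T φ s
  | .andf φ ψ, s => XSat T φ s ∧ XSat T ψ s
  | .down φ ψ, s => ∃ t ∈ T.S, s <+: t ∧ s ≠ t ∧ XSat T ψ t ∧
      ∀ r ∈ T.S, s <+: r → s ≠ r → r <+: t → r ≠ t → XSat T φ r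
  | .up φ ψ, s => ∃ t ∈ T.S, t <+: s ∧ t ≠ s ∧ XSat T ψ t ∧
      ∀ r ∈ T.S, t <+: r → t ≠ r → r <+: s → r ≠ s → XSat T φ r
  | .right φ ψ, s => ∃ (r : List ℕ) (h h' : ℕ), s = r ++ [h] ∧ h < h' ∧
      r ++ [h'] ∈ T.S ∧ XSat T ψ (r ++ [h']) ∧
      ∀ h'', h < h'' → h'' < h' → XSat T φ (r ++ [h''])
  | .left φ ψ, s => ∃ (r : List ℕ) (h h' : ℕ), s = r ++ [h] ∧ h' < h ∧
      r ++ [h'] ∈ T.S ∧ XSat T ψ (r ++ [h']) ∧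
      ∀ h'', h' < h'' → h'' < h → XSat T φ (r ++ [h''])

def prunedSubtree {AP : Type} (T : UOT AP) (α : Xuntil AP) (r : List ℕ) :
    Set (List ℕ) :=
  {t | t ∈ T.S ∧ r <+: t ∧ ¬ ∃ c, RightmostChild T r c ∧ XSat T α c ∧ c <+: t}

section Derived

variable {AP : Type} [Fintype AP]

def bigOr (l : List (POTL AP)) : POTL AP := l.foldr POTL.orf (POTL.neg POTL.tt)
def bigAnd (l : List (POTL AP)) : POTL AP := l.foldr POTL.andf POTL.tt

def sigmaF (a : Set AP) : POTL AP :=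
  POTL.andf (bigAnd ((Finset.univ.filter (· ∈ a)).toList.map POTL.atom))
    (bigAnd ((Finset.univ.filter (· ∉ a)).toList.map fun p => POTL.neg (POTL.atom p)))

def pairsWith (M : OPM (Set AP)) (π : Prec) : List (Set AP × Set AP) :=
  (Finset.univ.filter
    (fun ab : Set AP × Set AP => M (some ab.1) (some ab.2) = some π)).toList

def chiFpi (M : OPM (Set AP)) (π : Prec) (γ : POTL AP) : POTL AP :=
  bigOr ((pairsWith M π).map fun ab =>
    POTL.andf (sigmaF ab.1) (POTL.chiFD (POTL.andf (sigmaF ab.2) γ)))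

def chiPpi (M : OPM (Set AP)) (π : Prec) (γ : POTL AP) : POTL AP :=
  bigOr ((pairsWith M π).map fun ab =>
    POTL.andf (sigmaF ab.2) (POTL.chiPD (POTL.andf (sigmaF ab.1) γ)))

def nextLt (M : OPM (Set AP)) (γ : POTL AP) : POTL AP :=
  bigOr ((pairsWith M Prec.lt).map fun ab =>
    POTL.andf (sigmaF ab.1) (POTL.nextD (POTL.andf (sigmaF ab.2) γ)))

def backLt (M : OPM (Set AP)) (γ : POTL AP) : POTL AP :=
  bigOr ((pairsWith M Prec.lt).map fun ab =>
    POTL.andf (sigmaF ab.2) (POTL.backD (POTL.andf (sigmaF ab.1) γ)))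

end Derived

end OPLTheory

namespace OPLTheory
universe u

def LocDiv {M : Type u} [Monoid M] (c : M) : Type u :=
  {x : M // (∃ a, x = c * a) ∧ (∃ b, x = b * c)}

noncomputable def LocDiv.mul {M : Type u} [Monoid M] {c : M} (x y : LocDiv c) : LocDiv c :=
  ⟨x.1 * y.2.1.choose, by
    obtain ⟨⟨a, ha⟩, b, hb⟩ := x.2
    have hy := y.2.1.choose_spec
    obtain ⟨b', hb'⟩ := y.2.2
    refine ⟨⟨a * y.2.1.choose, by rw [ha, mul_assoc]⟩, b * b', ?_⟩
    rw [hb, mul_assoc, ← hy, hb', mul_assoc]⟩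

theorem LocDiv.mul_val {M : Type u} [Monoid M] {c : M} (x y : LocDiv c) (n : M)
    (h : y.1 = c * n) : (LocDiv.mul x y).1 = x.1 * n := by
  obtain ⟨b, hb⟩ := x.2.2
  change x.1 * y.2.1.choose = _
  have hy := y.2.1.choose_spec
  rw [hb, mul_assoc, ← hy, h, mul_assoc]

noncomputable instance LocDiv.instMonoid {M : Type u} [Monoid M] (c : M) : Monoid (LocDiv c) where
  mul := LocDiv.mul
  one := ⟨c, ⟨1, by simp⟩, ⟨1, by simp⟩⟩
  one_mul y := by
    obtain ⟨n, hn⟩ := y.2.1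
    exact Subtype.ext ((LocDiv.mul_val _ y n hn).trans hn.symm)
  mul_one x := Subtype.ext ((LocDiv.mul_val x _ 1 (by exact (mul_one c).symm)).trans (mul_one _))
  mul_assoc x y z := by
    obtain ⟨n, hn⟩ := z.2.1
    obtain ⟨p, hp⟩ := y.2.1
    apply Subtype.ext
    have h1 : (LocDiv.mul y z).1 = c * (p * n) := by
      rw [LocDiv.mul_val y z n hn, hp, mul_assoc]
    exact (LocDiv.mul_val _ z n hn).trans
      (((congrArg (· * n) (LocDiv.mul_val x y p hp)).trans (mul_assoc _ _ _)).trans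
        (LocDiv.mul_val x _ _ h1).symm)

theorem LocDiv.one_val {M : Type u} [Monoid M] (c : M) : (1 : LocDiv c).1 = c := rfl

theorem LocDiv.mul_val' {M : Type u} [Monoid M] {c : M} (x y : LocDiv c) (n : M)
    (h : y.1 = c * n) : (x * y).1 = x.1 * n := LocDiv.mul_val x y n h

def Aper (M : Type u) [Monoid M] : Prop := ∀ x : M, ∃ N : ℕ, x ^ (N + 1) = x ^ N

theorem LocDiv.aper {M : Type u} [Monoid M] (hM : Aper M) (c : M) : Aper (LocDiv c) := by
  intro x
  obtain ⟨a, ha⟩ := x.2.1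
  obtain ⟨N, hN⟩ := hM a
  have key : ∀ n, (x ^ n).1 = c * a ^ n := by
    intro n
    induction n with
    | zero => simp [LocDiv.one_val]
    | succ n ih => rw [pow_succ, LocDiv.mul_val' _ _ a ha, ih, pow_succ, mul_assoc]
  exact ⟨N, Subtype.ext (by rw [key, key, hN])⟩

theorem LocDiv.card_lt {M : Type u} [Monoid M] [Finite M] (c : M) (hc : ¬ IsUnit c) :
    Nat.card (LocDiv c) < Nat.card M := by
  apply Finite.card_subtype_lt (x := (1 : M))
  rintro ⟨⟨a, ha⟩, b, hb⟩
  apply hc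
  have : a = b := by
    calc a = (b * c) * a := by rw [← hb, one_mul]
      _ = b := by rw [mul_assoc, ← ha, mul_one]
  exact ⟨⟨c, a, ha.symm, by rw [this]; exact hb.symm⟩, rfl⟩

theorem aper_unit {M : Type u} [Monoid M] (hM : Aper M) (x : M) (hx : IsUnit x) : x = 1 := by
  obtain ⟨N, hN⟩ := hM x
  have : x ^ N * x = x ^ N * 1 := by rw [← pow_succ, hN, mul_one]
  exact (hx.pow N).mul_left_cancel this

structure BoolCl {W : Type} (Def : (W → ℕ → Prop) → Prop) : Prop where
  tt : Def fun _ _ => True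
  neg : ∀ P, Def P → Def fun w z => ¬ P w z
  and : ∀ P Q, Def P → Def Q → Def fun w z => P w z ∧ Q w z

theorem defCongr {W : Type} {Def : (W → ℕ → Prop) → Prop} {P Q : W → ℕ → Prop} (h : Def P)
    (e : ∀ w z, P w z ↔ Q w z) : Def Q := by
  have : P = Q := by funext w z; exact propext (e w z)
  rwa [← this]

namespace BoolCl
variable {W : Type} {Def : (W → ℕ → Prop) → Prop} (H : BoolCl Def)
include H

theorem or {P Q : W → ℕ → Prop} (hP : Def P) (hQ : Def Q) : Def fun w z => P w z ∨ Q w z :=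
  defCongr (H.neg _ (H.and _ _ (H.neg _ hP) (H.neg _ hQ))) (by intros; tauto)

theorem imp {P Q : W → ℕ → Prop} (hP : Def P) (hQ : Def Q) : Def fun w z => P w z → Q w z :=
  defCongr (H.or (H.neg _ hP) hQ) (by intros; tauto)

theorem ff : Def fun _ _ => False := defCongr (H.neg _ H.tt) (by simp)

theorem const (p : Prop) : Def fun _ _ => p := by
  by_cases h : p
  · exact defCongr H.tt (by simp [h])
  · exact defCongr H.ff (by simp [h])

theorem ex {A : Type*} [Finite A] {P : A → W → ℕ → Prop} (h : ∀ a, Def (P a)) :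
    Def fun w z => ∃ a, P a w z := by
  have := Fintype.ofFinite A
  have key : ∀ s : Finset A, Def fun w z => ∃ a ∈ s, P a w z := by
    classical
    intro s
    induction s using Finset.induction_on with
    | empty => exact defCongr H.ff (by simp)
    | insert a s _ ih => exact defCongr (H.or (h a) ih) (by simp)
  exact defCongr (key Finset.univ) (by simp)

theorem all {A : Type*} [Finite A] {P : A → W → ℕ → Prop} (h : ∀ a, Def (P a)) :
    Def fun w z => ∀ a, P a w z :=
  defCongr (H.neg _ (H.ex fun a => H.neg _ (h a))) (by simp)

theorem mem {A : Type*} [Finite A] {l : W → ℕ → A} (h : ∀ a, Def fun w z => l w z = a)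
    (B : Set A) : Def fun w z => l w z ∈ B :=
  defCongr (H.ex (A := B) fun a => h a) (by
    intro w z
    exact ⟨fun ⟨a, ha⟩ => ha ▸ a.2, fun h => ⟨⟨_, h⟩, rfl⟩⟩)

theorem inv {A : Type*} [Finite A] {l : W → ℕ → A} (h : ∀ a, Def fun w z => l w z = a)
    {P : W → ℕ → Prop} (hP : ∀ w z w' z', l w z = l w' z' → (P w z → P w' z')) : Def P := by
  refine defCongr (H.mem h {a | ∃ w z, l w z = a ∧ P w z}) ?_
  intro w z
  constructor
  · rintro ⟨w', z', e, hp⟩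
    exact hP _ _ _ _ e hp
  · intro hp
    exact ⟨w, z, rfl, hp⟩

theorem inv2 {A : Type*} [Finite A] {l : W → ℕ → A} {V : W → ℕ → Prop} (hV : Def V)
    (h : ∀ a, Def fun w z => V w z ∧ l w z = a)
    {P : W → ℕ → Prop} (hP : ∀ w z w' z', V w z → V w' z' → l w z = l w' z' → (P w z → P w' z')) :
    Def fun w z => V w z ∧ P w z := by
  refine defCongr (H.ex (A := {a | ∃ w z, V w z ∧ l w z = a ∧ P w z}) fun a => h a) ?_
  intro w z
  constructor
  · rintro ⟨⟨a, w', z', v', e, hp⟩, v, e'⟩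
    exact ⟨v, hP _ _ _ _ v' v (e.trans e'.symm) hp⟩
  · intro hp
    exact ⟨⟨_, w, z, hp.1, rfl, hp.2⟩, hp.1, rfl⟩

end BoolCl

open Relation

def StrU (R : ℕ → ℕ → Prop) (φ : ℕ → Prop) (z t : ℕ) : Prop :=
  ∃ y, R z y ∧ ReflTransGen (fun a b => φ a ∧ R a b) y t

inductive LP {A M : Type u} [Monoid M] (R : ℕ → ℕ → Prop) (l : ℕ → A) (h : A → M) (B : Set A)
    (z : ℕ) : M → ℕ → Prop where
  | refl : LP R l h B z 1 z
  | step {m y t} : LP R l h B z m y → R y t → l t ∈ B → LP R l h B z (m * h (l t)) t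

namespace LP
variable {A M : Type u} [Monoid M] {R : ℕ → ℕ → Prop} {l : ℕ → A} {h : A → M} {B : Set A}

theorem trans {m n z y t} (h1 : LP R l h B z m y) (h2 : LP R l h B y n t) :
    LP R l h B z (m * n) t := by
  induction h2 with
  | refl => simpa using h1
  | step _ hr hl ih => rw [← mul_assoc]; exact ih.step hr hl

theorem mono {B' : Set A} (hB : B ⊆ B') {m z t} (h1 : LP R l h B z m t) : LP R l h B' z m t := by
  induction h1 with
  | refl => exact LP.refl
  | step _ hr hl ih => exact ih.step hr (hB hl)

theorem one {z t} (hr : R z t) (hl : l t ∈ B) : LP R l h B z (h (l t)) t := by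
  simpa using (LP.refl (z := z)).step hr hl

theorem eq_of_not {m v y} (h1 : LP R l h B v m y) (hy : l y ∉ B) : v = y ∧ m = 1 := by
  cases h1 with
  | refl => exact ⟨rfl, rfl⟩
  | step _ _ hl => exact absurd hl hy

theorem unique (hR : ∀ a b c, R a c → R b c → a = b) {m m' v v' y}
    (h1 : LP R l h B v m y) (h2 : LP R l h B v' m' y) (hv : l v ∉ B) (hv' : l v' ∉ B) :
    v = v' ∧ m = m' := by
  induction h1 generalizing m' with
  | refl =>
    obtain ⟨a, b⟩ := h2.eq_of_not hv
    exact ⟨a.symm, b.symm⟩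
  | @step m0 y' t _ hr hl ih =>
    cases h2 with
    | refl => exact absurd hl hv'
    | step h2 hr2 hl2 =>
      cases hR _ _ _ hr hr2
      obtain ⟨rfl, rfl⟩ := ih h2
      exact ⟨rfl, rfl⟩

theorem split {c : A} {m z t} (h1 : LP R l h B z m t) :
    LP R l h (B \ {c}) z m t ∨ ∃ y u v m0 m1 m2, LP R l h (B \ {c}) z m0 y ∧ R y u ∧ l u = c ∧
      LP R l h B u m1 v ∧ l v = c ∧ LP R l h (B \ {c}) v m2 t ∧ m = m0 * (h c * m1) * m2 ∧
      c ∈ B := by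
  induction h1 with
  | refl => exact Or.inl (LP.refl)
  | @step m y t h1 hr hl ih =>
    by_cases hc : l t = c
    · right
      rcases ih with ih | ⟨y', u, v, m0, m1, m2, a1, a2, a3, a4, a5, a6, a7, a8⟩
      · exact ⟨y, t, t, m, 1, 1, ih, hr, hc, LP.refl, hc, LP.refl, by simp [hc], hc ▸ hl⟩
      · refine ⟨y', u, t, m0, m1 * m2 * h (l t), 1, a1, a2, a3,
          (a4.trans (a6.mono Set.sdiff_subset)).step hr hl, hc, LP.refl, ?_, a8⟩
        rw [a7]; simp [mul_assoc]
    · rcases ih with ih | ⟨y', u, v, m0, m1, m2, a1, a2, a3, a4, a5, a6, a7, a8⟩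
      · exact Or.inl (ih.step hr ⟨hl, hc⟩)
      · right
        refine ⟨y', u, v, m0, m1, m2 * h (l t), a1, a2, a3, a4, a5, a6.step hr ⟨hl, hc⟩, ?_, a8⟩
        rw [a7]; simp [mul_assoc]

theorem of_split {c : A} {y z u v t m0 m1 m2} (hc : c ∈ B) (a1 : LP R l h (B \ {c}) z m0 y)
    (a2 : R y u) (a3 : l u = c) (a4 : LP R l h B u m1 v) (a6 : LP R l h (B \ {c}) v m2 t) :
    LP R l h B z (m0 * (h c * m1) * m2) t := by
  subst a3
  exact (((a1.mono Set.sdiff_subset).trans ((LP.one a2 hc).trans a4))).trans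
    (a6.mono Set.sdiff_subset)

end LP

section newlab
variable {A M : Type u} [Monoid M] (R : ℕ → ℕ → Prop) (l : ℕ → A) (h : A → M) (B : Set A) (c : A)

def SegVal (t : ℕ) (m : M) : Prop :=
  l t = c ∧ ∃ y, R y t ∧ ∃ v, LP R l h (B \ {c}) v m y ∧ l v = c

open Classical in
noncomputable def newLab (t : ℕ) : Option (Option M) :=
  if l t ∈ B \ {c} then some none
  else if hm : ∃ m, SegVal R l h B c t m then some (some hm.choose) else none

noncomputable def newHom (d : M) : Option (Option M) → LocDiv d
  | some (some m) => ⟨d * m * d, ⟨m * d, mul_assoc _ _ _⟩, ⟨d * m, rfl⟩⟩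
  | _ => 1

theorem newHom_neutral (d : M) : newHom d (some none) = 1 := rfl

theorem newHom_val (d m : M) : (newHom d (some (some m))).1 = d * (m * d) := mul_assoc _ _ _

theorem SegVal.unique (hR : ∀ a b c, R a c → R b c → a = b) {t m m'}
    (h1 : SegVal R l h B c t m) (h2 : SegVal R l h B c t m') : m = m' := by
  obtain ⟨_, y, hy, v, p, hv⟩ := h1
  obtain ⟨_, y', hy', v', p', hv'⟩ := h2
  cases hR _ _ _ hy hy'
  exact (LP.unique hR p p' (by simp [hv]) (by simp [hv'])).2

theorem newLab_neutral (t) : newLab R l h B c t = some none ↔ l t ∈ B \ {c} := by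
  unfold newLab
  split_ifs with h1 h2
  · exact iff_of_true rfl h1
  · exact iff_of_false (by simp) h1
  · exact iff_of_false (by simp) h1

theorem newLab_val (hR : ∀ a b c, R a c → R b c → a = b) (t m) :
    newLab R l h B c t = some (some m) ↔ SegVal R l h B c t m := by
  unfold newLab
  split_ifs with h1 h2
  · simp only [Option.some.injEq, reduceCtorEq, false_iff]
    intro hs
    exact h1.2 hs.1
  · simp only [Option.some.injEq]
    constructor
    · rintro rfl; exact h2.choose_spec
    · intro hs; exact h2.choose_spec.unique R l h B c hR hs
  · simp only [reduceCtorEq, false_iff]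
    exact fun hs => h2 ⟨m, hs⟩

variable {R l h B c}

theorem new_fwd (hR : ∀ a b c, R a c → R b c → a = b) (hc : c ∈ B) {u v x} (hu : l u = c)
    (p : LP R (newLab R l h B c) (newHom (h c)) {none}ᶜ u x v) :
    ∃ v' m1 m2, l v' = c ∧ LP R l h B u m1 v' ∧ LP R l h (B \ {c}) v' m2 v ∧ x.1 = h c * m1 := by
  induction p with
  | refl => exact ⟨u, 1, 1, hu, LP.refl, LP.refl, by rw [mul_one]; rfl⟩
  | @step x y t p hr hl ih =>
    obtain ⟨v', m1, m2, e, q1, q2, ex⟩ := ih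
    rcases hn : newLab R l h B c t with _ | _ | m
    · simp [hn] at hl
    · have := (newLab_neutral R l h B c t).1 hn
      refine ⟨v', m1, m2 * h (l t), e, q1, q2.step hr this, ?_⟩
      rw [newHom_neutral, mul_one, ex]
    · have hs := (newLab_val R l h B c hR t m).1 hn
      obtain ⟨ht, y', hy', v'', p', hv''⟩ := hs
      cases hR _ _ _ hr hy'
      obtain ⟨rfl, rfl⟩ := LP.unique hR q2 p' (by simp [e]) (by simp [hv''])
      refine ⟨t, m1 * m2 * h (l t), 1, ht,
        (q1.trans (q2.mono Set.sdiff_subset)).step hr (ht ▸ hc), LP.refl, ?_⟩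
      rw [LocDiv.mul_val' x (newHom (h c) (some (some m2))) (m2 * h c)
        (newHom_val _ _), ex, ht]
      simp [mul_assoc]

theorem new_bwd (hR : ∀ a b c, R a c → R b c → a = b) {u v m} (hu : l u = c)
    (p : LP R l h B u m v) :
    ∃ v' m1 m2 x, l v' = c ∧ LP R l h (B \ {c}) v' m2 v ∧ m = m1 * m2 ∧ x.1 = h c * m1 ∧
      LP R (newLab R l h B c) (newHom (h c)) {none}ᶜ u x v := by
  induction p with
  | refl => exact ⟨u, 1, 1, 1, hu, LP.refl, by simp, by rw [mul_one]; rfl, LP.refl⟩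
  | @step m y t p hr hl ih =>
    obtain ⟨v', m1, m2, x, e, q2, em, ex, q⟩ := ih
    by_cases ht : l t = c
    · have hs : newLab R l h B c t = some (some m2) :=
        (newLab_val R l h B c hR t m2).2 ⟨ht, y, hr, v', q2, e⟩
      refine ⟨t, m1 * m2 * h (l t), 1, _, ht, LP.refl, by simp [em], ?_,
        q.step hr (by simp [hs])⟩
      rw [hs, LocDiv.mul_val' x (newHom (h c) (some (some m2))) (m2 * h c)
        (newHom_val _ _), ex, ht]
      simp [mul_assoc]
    · have hs := (newLab_neutral R l h B c t).2 ⟨hl, ht⟩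
      refine ⟨v', m1, m2 * h (l t), _, e, q2.step hr ⟨hl, ht⟩, by simp [em, mul_assoc], ?_,
        q.step hr (by simp [hs])⟩
      rw [hs, newHom_neutral, mul_one, ex]

theorem new_iff (hR : ∀ a b c, R a c → R b c → a = b) (hc : c ∈ B) {u v} (hu : l u = c)
    (hv : l v = c) (n : M) :
    (∃ m, LP R l h B u m v ∧ h c * m = n) ↔
    (∃ x : LocDiv (h c), LP R (newLab R l h B c) (newHom (h c)) {none}ᶜ u x v ∧ x.1 = n) := by
  constructor
  · rintro ⟨m, p, rfl⟩
    obtain ⟨v', m1, m2, x, e, q2, em, ex, q⟩ := new_bwd hR hu p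
    obtain ⟨rfl, rfl⟩ := q2.eq_of_not (by simp [hv])
    exact ⟨x, q, by rw [ex, em, mul_one]⟩
  · rintro ⟨x, p, rfl⟩
    obtain ⟨v', m1, m2, e, q1, q2, ex⟩ := new_fwd hR hc hu p
    obtain ⟨rfl, rfl⟩ := q2.eq_of_not (by simp [hv])
    exact ⟨m1, q1, ex.symm⟩
end newlab

theorem StrU.snoc {R : ℕ → ℕ → Prop} {φ : ℕ → Prop} {z y t} (h : StrU R φ z y) (hy : φ y)
    (hr : R y t) : StrU R φ z t := by
  obtain ⟨x, hx, p⟩ := h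
  exact ⟨x, hx, p.tail ⟨hy, hr⟩⟩

theorem StrU.ff {R : ℕ → ℕ → Prop} {z t} : StrU R (fun _ => False) z t ↔ R z t := by
  constructor
  · rintro ⟨y, hy, p⟩
    cases p using ReflTransGen.head_induction_on with
    | refl => exact hy
    | head h _ => exact h.1.elim
  · intro h; exact ⟨t, h, .refl⟩

theorem LP.base {A M : Type u} [Monoid M] {R : ℕ → ℕ → Prop} {l : ℕ → A} {h : A → M} {B : Set A}
    (hB : ∀ b ∈ B, h b = 1) {z m t} :
    LP R l h B z m t ↔ m = 1 ∧ (z = t ∨ (StrU R (fun x => l x ∈ B) z t ∧ l t ∈ B)) := by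
  constructor
  · intro p
    induction p with
    | refl => simp
    | @step m y t p hr hl ih =>
      refine ⟨by rw [ih.1, hB _ hl, one_mul], Or.inr ⟨?_, hl⟩⟩
      rcases ih.2 with rfl | ⟨hs, hy⟩
      · exact ⟨t, hr, .refl⟩
      · exact hs.snoc hy hr
  · rintro ⟨rfl, rfl | ⟨⟨y, hy, p⟩, ht⟩⟩
    · exact LP.refl
    · induction p with
      | refl => rw [← hB _ ht]; exact LP.one hy ht
      | @tail b c p hr ih => simpa [hB _ ht] using (ih hr.1).step hr.2 ht

structure StepCl {W : Type} (Def : (W → ℕ → Prop) → Prop) (R : W → ℕ → ℕ → Prop) : Prop where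
  su : ∀ φ ψ, Def φ → Def ψ → Def fun w z => ∃ t, StrU (R w) (φ w) z t ∧ ψ w t
  ss : ∀ φ ψ, Def φ → Def ψ → Def fun w z => ∃ t, StrU (R w) (φ w) t z ∧ ψ w t
  uniq : ∀ w a b c, R w a c → R w b c → a = b

theorem StepCl.succ {W : Type} {Def : (W → ℕ → Prop) → Prop} {R : W → ℕ → ℕ → Prop}
    (H : BoolCl Def) (S : StepCl Def R) {ψ} (h : Def ψ) : Def fun w z => ∃ t, R w z t ∧ ψ w t :=
  defCongr (S.su _ _ H.ff h) (by simp [StrU.ff])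

theorem StepCl.pred {W : Type} {Def : (W → ℕ → Prop) → Prop} {R : W → ℕ → ℕ → Prop}
    (H : BoolCl Def) (S : StepCl Def R) {ψ} (h : Def ψ) : Def fun w z => ∃ t, R w t z ∧ ψ w t :=
  defCongr (S.ss _ _ H.ff h) (by simp [StrU.ff])

def EngP {W : Type} (Def : (W → ℕ → Prop) → Prop) (R : W → ℕ → ℕ → Prop) {A M : Type u}
    [Monoid M] (l : W → ℕ → A) (h : A → M) (B : Set A) : Prop :=
  ∀ m X, Def X → (Def fun w z => ∃ t, LP (R w) (l w) h B z m t ∧ X w t) ∧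
    (Def fun w z => ∃ t, LP (R w) (l w) h B t m z ∧ X w t)

theorem engine_step {W : Type} {Def : (W → ℕ → Prop) → Prop} (H : BoolCl Def)
    {R : W → ℕ → ℕ → Prop} (S : StepCl Def R) {A M : Type u} [Monoid M] [Finite M] [Finite A]
    (l : W → ℕ → A) (hl : ∀ a, Def fun w z => l w z = a) (h : A → M) (B : Set A) (c : A)
    (hc : c ∈ B) (h1 : EngP Def R l h (B \ {c}))
    (h2 : (∀ a, Def fun w z => newLab (R w) (l w) h B c z = a) →
      EngP Def R (fun w => newLab (R w) (l w) h B c) (newHom (h c)) {none}ᶜ) :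
    EngP Def R l h B := by
  have hval : ∀ m, Def fun w z => newLab (R w) (l w) h B c z = some (some m) := by
    intro m
    refine defCongr (H.and _ _ (hl c) (S.pred H ((h1 m _ (hl c)).2))) ?_
    intro w z
    rw [newLab_val _ _ _ _ _ (S.uniq w)]
    rfl
  have hneu : Def fun w z => newLab (R w) (l w) h B c z = some none :=
    defCongr (H.mem hl (B \ {c})) fun w z => (newLab_neutral _ _ _ _ _ _).symm
  have h2 := h2 (by
    rintro (_ | _ | m)
    · refine defCongr (H.and _ _ (H.neg _ hneu) (H.neg _ (H.ex hval))) ?_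
      intro w z
      rcases newLab (R w) (l w) h B c z with _ | _ | m <;> simp
    · exact hneu
    · exact hval m)
  have : Finite (LocDiv (h c)) := Subtype.finite
  intro m X hX
  constructor
  · refine defCongr (H.or (h1 m X hX).1 (H.ex (A := {q : M × LocDiv (h c) × M // q.1 * q.2.1.1 * q.2.2 = m})
      fun q => (h1 q.1.1 _ (S.succ H (H.and _ _ (hl c) (h2 q.1.2.1 _
        (H.and _ _ (hl c) (h1 q.1.2.2 X hX).1)).1))).1)) ?_
    intro w z
    constructor
    · rintro (⟨t, p, x⟩ | ⟨⟨⟨m0, x, m2⟩, rfl⟩, y, p, u, hr, hu, v, q, hv, t, r, ht⟩)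
      · exact ⟨t, p.mono Set.sdiff_subset, x⟩
      · obtain ⟨m1, q', e⟩ := (new_iff (S.uniq w) hc hu hv x.1).2 ⟨x, q, rfl⟩
        refine ⟨t, ?_, ht⟩
        simp only [← e]
        exact LP.of_split hc p hr hu q' r
    · rintro ⟨t, p, ht⟩
      rcases p.split (c := c) with p | ⟨y, u, v, m0, m1, m2, a1, a2, a3, a4, a5, a6, a7, a8⟩
      · exact Or.inl ⟨t, p, ht⟩
      · right
        obtain ⟨x, q, e⟩ := (new_iff (S.uniq w) hc a3 a5 (h c * m1)).1 ⟨m1, a4, rfl⟩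
        exact ⟨⟨⟨m0, x, m2⟩, by simp only [e, a7]⟩, y, a1, u, a2, a3, v, q, a5, t, a6, ht⟩
  · refine defCongr (H.or (h1 m X hX).2 (H.ex (A := {q : M × LocDiv (h c) × M // q.1 * q.2.1.1 * q.2.2 = m})
      fun q => (h1 q.1.2.2 _ (H.and _ _ (hl c) (h2 q.1.2.1 _
        (H.and _ _ (hl c) (S.pred H (h1 q.1.1 X hX).2))).2)).2)) ?_
    intro w z
    constructor
    · rintro (⟨t, p, x⟩ | ⟨⟨⟨m0, x, m2⟩, rfl⟩, v, r, hv, u, q, hu, y, hr, t, p, ht⟩)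
      · exact ⟨t, p.mono Set.sdiff_subset, x⟩
      · obtain ⟨m1, q', e⟩ := (new_iff (S.uniq w) hc hu hv x.1).2 ⟨x, q, rfl⟩
        refine ⟨t, ?_, ht⟩
        simp only [← e]
        exact LP.of_split hc p hr hu q' r
    · rintro ⟨t, p, ht⟩
      rcases p.split (c := c) with p | ⟨y, u, v, m0, m1, m2, a1, a2, a3, a4, a5, a6, a7, a8⟩
      · exact Or.inl ⟨t, p, ht⟩
      · right
        obtain ⟨x, q, e⟩ := (new_iff (S.uniq w) hc a3 a5 (h c * m1)).1 ⟨m1, a4, rfl⟩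
        exact ⟨⟨⟨m0, x, m2⟩, by simp only [e, a7]⟩, v, a6, a5, u, q, a3, y, a2, t, a1, ht⟩

theorem engine_base {W : Type} {Def : (W → ℕ → Prop) → Prop} (H : BoolCl Def)
    {R : W → ℕ → ℕ → Prop} (S : StepCl Def R) {A M : Type u} [Monoid M] [Finite A]
    (l : W → ℕ → A) (hl : ∀ a, Def fun w z => l w z = a) (h : A → M) (B : Set A)
    (hB : ∀ b ∈ B, h b = 1) : EngP Def R l h B := by
  intro m X hX
  constructor
  · refine defCongr (H.and _ _ (H.const (m = 1)) (H.or hX (S.su _ _ (H.mem hl B)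
      (H.and _ _ (H.mem hl B) hX)))) ?_
    intro w z
    constructor
    · rintro ⟨hm, hx | ⟨t, hs, ht, hx⟩⟩
      · exact ⟨z, (LP.base hB).2 ⟨hm, Or.inl rfl⟩, hx⟩
      · exact ⟨t, (LP.base hB).2 ⟨hm, Or.inr ⟨hs, ht⟩⟩, hx⟩
    · rintro ⟨t, p, hx⟩
      obtain ⟨hm, rfl | ⟨hs, ht⟩⟩ := (LP.base hB).1 p
      · exact ⟨hm, Or.inl hx⟩
      · exact ⟨hm, Or.inr ⟨t, hs, ht, hx⟩⟩
  · refine defCongr (H.and _ _ (H.const (m = 1)) (H.or hX (H.and _ _ (H.mem hl B)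
      (S.ss _ _ (H.mem hl B) hX)))) ?_
    intro w z
    constructor
    · rintro ⟨hm, hx | ⟨ht, t, hs, hx⟩⟩
      · exact ⟨z, (LP.base hB).2 ⟨hm, Or.inl rfl⟩, hx⟩
      · exact ⟨t, (LP.base hB).2 ⟨hm, Or.inr ⟨hs, ht⟩⟩, hx⟩
    · rintro ⟨t, p, hx⟩
      obtain ⟨hm, rfl | ⟨hs, ht⟩⟩ := (LP.base hB).1 p
      · exact ⟨hm, Or.inl hx⟩
      · exact ⟨hm, Or.inr ⟨ht, t, hs, hx⟩⟩

theorem engine_aux {W : Type} {Def : (W → ℕ → Prop) → Prop} (H : BoolCl Def)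
    {R : W → ℕ → ℕ → Prop} (S : StepCl Def R) (n : ℕ) : ∀ (M : Type u) [Monoid M] [Finite M],
    Nat.card M = n → Aper M → ∀ (k : ℕ) (A : Type u) [Finite A] (l : W → ℕ → A)
      (_ : ∀ a, Def fun w z => l w z = a) (h : A → M) (B : Set A), B.ncard = k →
      EngP Def R l h B := by
  induction n using Nat.strong_induction_on with
  | _ n ihn =>
  intro M _ _ hM hap k
  induction k with
  | zero =>
    intro A _ l hl h B hB
    exact engine_base H S l hl h B (by rw [(Set.ncard_eq_zero).1 hB]; simp)
  | succ k ihk =>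
    intro A _ l hl h B hB
    by_cases hu : ∀ b ∈ B, IsUnit (h b)
    · exact engine_base H S l hl h B fun b hb => aper_unit hap _ (hu b hb)
    · push Not at hu
      obtain ⟨c, hc, hcu⟩ := hu
      refine engine_step H S l hl h B c hc (ihk A l hl h _ ?_) ?_
      · rw [Set.ncard_diff_singleton_of_mem hc, hB]; rfl
      · intro h'
        have : Finite (LocDiv (h c)) := Subtype.finite
        exact ihn _ (hM ▸ LocDiv.card_lt _ hcu) _ rfl (LocDiv.aper hap _) _ _ _ h' _ _ rfl

theorem engine {W : Type} {Def : (W → ℕ → Prop) → Prop} (H : BoolCl Def)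
    {R : W → ℕ → ℕ → Prop} (S : StepCl Def R) {M : Type u} [Monoid M] [Finite M]
    (hM : Aper M) {A : Type u} [Finite A] (l : W → ℕ → A)
    (hl : ∀ a, Def fun w z => l w z = a) (h : A → M) (B : Set A) : EngP Def R l h B :=
  engine_aux H S _ M rfl hM _ A l hl h B rfl
end OPLTheory

namespace OPLTheory

inductive Knd : Type where
  | anc : Knd
  | left : Knd
  | right : Knd
deriving DecidableEq

instance : Finite Knd :=
  Finite.of_injective (fun k : Knd => match k with | .anc => (0 : Fin 3) | .left => 1 | .right => 2)
    (by intro a b; cases a <;> cases b <;> simp)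

structure Str (L : Type) : Type 1 where
  D : Type
  dom : Set D
  lt : D → D → Prop
  anc : D → D → Prop
  lab : D → L
  kd : D → Knd

section EF
variable {L : Type}

def AtP (S T : Str L) (p : S.D × T.D) : Prop :=
  p.1 ∈ S.dom ∧ p.2 ∈ T.dom ∧ S.lab p.1 = T.lab p.2 ∧ S.kd p.1 = T.kd p.2

def Agree (S T : Str L) (p q : S.D × T.D) : Prop :=
  (p.1 = q.1 ↔ p.2 = q.2) ∧ (S.lt p.1 q.1 ↔ T.lt p.2 q.2) ∧ (S.anc p.1 q.1 ↔ T.anc p.2 q.2)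

def At (S T : Str L) (l : List (S.D × T.D)) : Prop :=
  (∀ p ∈ l, AtP S T p) ∧ ∀ p ∈ l, ∀ q ∈ l, Agree S T p q

def EqK : ℕ → (S T : Str L) → List (S.D × T.D) → Prop
  | 0, S, T, l => At S T l
  | k + 1, S, T, l => At S T l ∧ (∀ d ∈ S.dom, ∃ e ∈ T.dom, EqK k S T ((d, e) :: l)) ∧
      (∀ e ∈ T.dom, ∃ d ∈ S.dom, EqK k S T ((d, e) :: l))

theorem EqK.at {k : ℕ} {S T : Str L} {l} (h : EqK k S T l) : At S T l := by
  cases k with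
  | zero => exact h
  | succ k => exact h.1

theorem EqK.refl (k : ℕ) (S : Str L) : ∀ l : List (S.D × S.D),
    (∀ p ∈ l, p.1 ∈ S.dom ∧ p.2 = p.1) → EqK k S S l := by
  induction k with
  | zero =>
    intro l h
    refine ⟨fun p hp => ?_, fun p hp q hq => ?_⟩
    · obtain ⟨a, b⟩ := h p hp
      exact ⟨a, b ▸ a, by rw [b], by rw [b]⟩
    · obtain ⟨_, b⟩ := h p hp
      obtain ⟨_, b'⟩ := h q hq
      exact ⟨by rw [b, b'], by rw [b, b'], by rw [b, b']⟩
  | succ k ih =>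
    intro l h
    have h' : ∀ d ∈ S.dom, ∀ p ∈ (d, d) :: l, p.1 ∈ S.dom ∧ p.2 = p.1 := by
      intro d hd p hp
      rcases List.mem_cons.1 hp with rfl | hp
      · exact ⟨hd, rfl⟩
      · exact h p hp
    exact ⟨(ih l h).at, fun d hd => ⟨d, hd, ih _ (h' d hd)⟩, fun d hd => ⟨d, hd, ih _ (h' d hd)⟩⟩

theorem EqK.symm {k : ℕ} {S T : Str L} : ∀ {l} {l' : List (T.D × S.D)}, EqK k S T l →
    (∀ p ∈ l', (p.2, p.1) ∈ l) → EqK k T S l' := by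
  have h0 : ∀ {l} {l' : List (T.D × S.D)}, At S T l → (∀ p ∈ l', (p.2, p.1) ∈ l) → At T S l' := by
    intro l l' h hl
    refine ⟨fun p hp => ?_, fun p hp q hq => ?_⟩
    · obtain ⟨a, b, c, d⟩ := h.1 _ (hl p hp)
      exact ⟨b, a, c.symm, d.symm⟩
    · obtain ⟨a, b, c⟩ := h.2 _ (hl p hp) _ (hl q hq)
      exact ⟨a.symm, b.symm, c.symm⟩
  induction k with
  | zero => exact h0
  | succ k ih =>
    intro l l' h hl
    refine ⟨h0 h.at hl, fun d hd => ?_, fun d hd => ?_⟩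
    · obtain ⟨e, he, h'⟩ := h.2.2 d hd
      exact ⟨e, he, ih h' (by simpa using fun a b hp => Or.inr (hl (a, b) hp))⟩
    · obtain ⟨e, he, h'⟩ := h.2.1 d hd
      exact ⟨e, he, ih h' (by simpa using fun a b hp => Or.inr (hl (a, b) hp))⟩

theorem EqK.trans {k : ℕ} {S T U : Str L} : ∀ {l1 l2} {l : List (S.D × U.D)}, EqK k S T l1 →
    EqK k T U l2 → (∀ p ∈ l, ∃ b, (p.1, b) ∈ l1 ∧ (b, p.2) ∈ l2) → EqK k S U l := by
  have h0 : ∀ {l1 l2} {l : List (S.D × U.D)}, At S T l1 →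
    At T U l2 → (∀ p ∈ l, ∃ b, (p.1, b) ∈ l1 ∧ (b, p.2) ∈ l2) → At S U l := by
    intro l1 l2 l h1 h2 hl
    refine ⟨fun p hp => ?_, fun p hp q hq => ?_⟩
    · obtain ⟨b, hb1, hb2⟩ := hl p hp
      obtain ⟨x1, x2, x3, x4⟩ := h1.1 _ hb1
      obtain ⟨y1, y2, y3, y4⟩ := h2.1 _ hb2
      exact ⟨x1, y2, x3.trans y3, x4.trans y4⟩
    · obtain ⟨b, hb1, hb2⟩ := hl p hp
      obtain ⟨c, hc1, hc2⟩ := hl q hq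
      obtain ⟨x1, x2, x3⟩ := h1.2 _ hb1 _ hc1
      obtain ⟨y1, y2, y3⟩ := h2.2 _ hb2 _ hc2
      exact ⟨x1.trans y1, x2.trans y2, x3.trans y3⟩
  have hc : ∀ {l1 l2} {l : List (S.D × U.D)} d e f,
      (∀ p ∈ l, ∃ b, (p.1, b) ∈ l1 ∧ (b, p.2) ∈ l2) →
      (∀ p ∈ (d, f) :: l, ∃ b, (p.1, b) ∈ (d, e) :: l1 ∧ ((b : T.D), p.2) ∈ (e, f) :: l2) := by
    intro l1 l2 l d e f h p hp
    rcases List.mem_cons.1 hp with rfl | hp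
    · exact ⟨e, by simp, by simp⟩
    · obtain ⟨b, x, y⟩ := h p hp
      exact ⟨b, List.mem_cons_of_mem _ x, List.mem_cons_of_mem _ y⟩
  induction k with
  | zero => exact h0
  | succ k ih =>
    intro l1 l2 l h1 h2 hl
    refine ⟨h0 h1.at h2.at hl, fun d hd => ?_, fun f hf => ?_⟩
    · obtain ⟨e, he, h'⟩ := h1.2.1 d hd
      obtain ⟨f, hf, h''⟩ := h2.2.1 e he
      exact ⟨f, hf, ih h' h'' (hc d e f hl)⟩
    · obtain ⟨e, he, h'⟩ := h2.2.2 f hf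
      obtain ⟨d, hd, h''⟩ := h1.2.2 e he
      exact ⟨d, hd, ih h'' h' (hc d e f hl)⟩

theorem EqK.mono {k : ℕ} {S T : Str L} {l} (h : EqK (k + 1) S T l) : EqK k S T l := by
  induction k generalizing l with
  | zero => exact h.at
  | succ k ih =>
    refine ⟨h.at, fun d hd => ?_, fun d hd => ?_⟩
    · obtain ⟨e, he, h'⟩ := h.2.1 d hd
      exact ⟨e, he, ih h'⟩
    · obtain ⟨e, he, h'⟩ := h.2.2 d hd
      exact ⟨e, he, ih h'⟩

def Str.close (S : Str L) (κ : Knd) : Str L := { S with kd := fun _ => κ }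

theorem EqK.close {k : ℕ} {S T : Str L} (κ : Knd) : ∀ {l}, EqK k S T l →
    EqK k (S.close κ) (T.close κ) l := by
  have h0 : ∀ {l}, At S T l → At (S.close κ) (T.close κ) l := by
    intro l h
    exact ⟨fun p hp => ⟨(h.1 p hp).1, (h.1 p hp).2.1, (h.1 p hp).2.2.1, rfl⟩, h.2⟩
  induction k with
  | zero => exact h0
  | succ k ih =>
    intro l h
    refine ⟨h0 h.at, fun d hd => ?_, fun d hd => ?_⟩
    · obtain ⟨e, he, h'⟩ := h.2.1 d hd
      exact ⟨e, he, ih h'⟩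
    · obtain ⟨e, he, h'⟩ := h.2.2 d hd
      exact ⟨e, he, ih h'⟩

structure IsComp (S S1 S2 : Str L) (f1 : S1.D → S.D) (f2 : S2.D → S.D) : Prop where
  m1 : ∀ a ∈ S1.dom, f1 a ∈ S.dom
  m2 : ∀ a ∈ S2.dom, f2 a ∈ S.dom
  cov : ∀ d ∈ S.dom, (∃ a ∈ S1.dom, f1 a = d) ∨ (∃ a ∈ S2.dom, f2 a = d)
  i1 : ∀ a ∈ S1.dom, ∀ b ∈ S1.dom, (f1 a = f1 b ↔ a = b) ∧ (S.lt (f1 a) (f1 b) ↔ S1.lt a b) ∧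
    (S.anc (f1 a) (f1 b) ↔ S1.anc a b)
  i2 : ∀ a ∈ S2.dom, ∀ b ∈ S2.dom, (f2 a = f2 b ↔ a = b) ∧ (S.lt (f2 a) (f2 b) ↔ S2.lt a b) ∧
    (S.anc (f2 a) (f2 b) ↔ S2.anc a b)
  l1 : ∀ a ∈ S1.dom, S.lab (f1 a) = S1.lab a ∧ S.kd (f1 a) = S1.kd a
  l2 : ∀ a ∈ S2.dom, S.lab (f2 a) = S2.lab a ∧ S.kd (f2 a) = S2.kd a
  x : ∀ a ∈ S1.dom, ∀ b ∈ S2.dom, f1 a ≠ f2 b ∧ (S.lt (f1 a) (f2 b) ↔ S1.kd a ≠ .right) ∧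
    (S.lt (f2 b) (f1 a) ↔ S1.kd a = .right) ∧ (S.anc (f1 a) (f2 b) ↔ S1.kd a = .anc) ∧
    ¬ S.anc (f2 b) (f1 a)

theorem EqK.comp {k : ℕ} {S S1 S2 T T1 T2 : Str L} {f1 : S1.D → S.D} {f2 : S2.D → S.D}
    {g1 : T1.D → T.D} {g2 : T2.D → T.D} (hS : IsComp S S1 S2 f1 f2) (hT : IsComp T T1 T2 g1 g2) :
    ∀ {l1 l2 l}, EqK k S1 T1 l1 → EqK k S2 T2 l2 →
    (∀ p ∈ l, (∃ q ∈ l1, p = (f1 q.1, g1 q.2)) ∨ (∃ q ∈ l2, p = (f2 q.1, g2 q.2))) →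
    EqK k S T l := by
  have h0 : ∀ {l1 l2 l}, At S1 T1 l1 → At S2 T2 l2 →
    (∀ p ∈ l, (∃ q ∈ l1, p = (f1 q.1, g1 q.2)) ∨ (∃ q ∈ l2, p = (f2 q.1, g2 q.2))) →
    At S T l := by
    intro l1 l2 l h1 h2 hl
    refine ⟨fun p hp => ?_, fun p hp q hq => ?_⟩
    · rcases hl p hp with ⟨q, hq, rfl⟩ | ⟨q, hq, rfl⟩
      · obtain ⟨a, b, c, d⟩ := h1.1 q hq
        exact ⟨hS.m1 _ a, hT.m1 _ b, by simp only [(hS.l1 _ a).1, (hT.l1 _ b).1, c],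
          by simp only [(hS.l1 _ a).2, (hT.l1 _ b).2, d]⟩
      · obtain ⟨a, b, c, d⟩ := h2.1 q hq
        exact ⟨hS.m2 _ a, hT.m2 _ b, by simp only [(hS.l2 _ a).1, (hT.l2 _ b).1, c],
          by simp only [(hS.l2 _ a).2, (hT.l2 _ b).2, d]⟩
    · replace hp := hl p hp
      replace hq := hl q hq
      rcases hp with ⟨p, hp, rfl⟩ | ⟨p, hp, rfl⟩ <;>
        rcases hq with ⟨q, hq, rfl⟩ | ⟨q, hq, rfl⟩
      · have ap := h1.1 p hp
        have aq := h1.1 q hq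
        have a := h1.2 p hp q hq
        have e1 := hS.i1 _ ap.1 _ aq.1
        have e2 := hT.i1 _ ap.2.1 _ aq.2.1
        exact ⟨e1.1.trans (a.1.trans e2.1.symm), e1.2.1.trans (a.2.1.trans e2.2.1.symm),
          e1.2.2.trans (a.2.2.trans e2.2.2.symm)⟩
      · have ap := h1.1 p hp
        have aq := h2.1 q hq
        have e1 := hS.x _ ap.1 _ aq.1
        have e2 := hT.x _ ap.2.1 _ aq.2.1
        have e3 := ap.2.2.2
        simp only [Agree, e1, e2, e3, and_self]
      · have ap := h2.1 p hp
        have aq := h1.1 q hq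
        have e1 := hS.x _ aq.1 _ ap.1
        have e2 := hT.x _ aq.2.1 _ ap.2.1
        have e3 := aq.2.2.2
        simp only [Agree, e1, e2, e3, e1.1.symm, e2.1.symm, and_self]
      · have ap := h2.1 p hp
        have aq := h2.1 q hq
        have a := h2.2 p hp q hq
        have e1 := hS.i2 _ ap.1 _ aq.1
        have e2 := hT.i2 _ ap.2.1 _ aq.2.1
        exact ⟨e1.1.trans (a.1.trans e2.1.symm), e1.2.1.trans (a.2.1.trans e2.2.1.symm),
          e1.2.2.trans (a.2.2.trans e2.2.2.symm)⟩
  have c1 : ∀ {l1 : List (S1.D × T1.D)} {l2 : List (S2.D × T2.D)} {l : List (S.D × T.D)} a b,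
      (∀ p ∈ l, (∃ q ∈ l1, p = (f1 q.1, g1 q.2)) ∨ (∃ q ∈ l2, p = (f2 q.1, g2 q.2))) →
      (∀ p ∈ (f1 a, g1 b) :: l, (∃ q ∈ (a, b) :: l1, p = (f1 q.1, g1 q.2)) ∨
        (∃ q ∈ l2, p = (f2 q.1, g2 q.2))) := by
    intro l1 l2 l a b h p hp
    rcases List.mem_cons.1 hp with rfl | hp
    · exact Or.inl ⟨_, List.mem_cons_self, rfl⟩
    · rcases h p hp with ⟨q, hq, e⟩ | h
      · exact Or.inl ⟨q, List.mem_cons_of_mem _ hq, e⟩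
      · exact Or.inr h
  have c2 : ∀ {l1 : List (S1.D × T1.D)} {l2 : List (S2.D × T2.D)} {l : List (S.D × T.D)} a b,
      (∀ p ∈ l, (∃ q ∈ l1, p = (f1 q.1, g1 q.2)) ∨ (∃ q ∈ l2, p = (f2 q.1, g2 q.2))) →
      (∀ p ∈ (f2 a, g2 b) :: l, (∃ q ∈ l1, p = (f1 q.1, g1 q.2)) ∨
        (∃ q ∈ (a, b) :: l2, p = (f2 q.1, g2 q.2))) := by
    intro l1 l2 l a b h p hp
    rcases List.mem_cons.1 hp with rfl | hp
    · exact Or.inr ⟨_, List.mem_cons_self, rfl⟩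
    · rcases h p hp with h | ⟨q, hq, e⟩
      · exact Or.inl h
      · exact Or.inr ⟨q, List.mem_cons_of_mem _ hq, e⟩
  induction k with
  | zero => exact h0
  | succ k ih =>
    intro l1 l2 l h1 h2 hl
    refine ⟨h0 h1.at h2.at hl, fun d hd => ?_, fun d hd => ?_⟩
    · rcases hS.cov d hd with ⟨a, ha, rfl⟩ | ⟨a, ha, rfl⟩
      · obtain ⟨b, hb, h'⟩ := h1.2.1 a ha
        exact ⟨_, hT.m1 b hb, ih h' h2.mono (c1 a b hl)⟩
      · obtain ⟨b, hb, h'⟩ := h2.2.1 a ha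
        exact ⟨_, hT.m2 b hb, ih h1.mono h' (c2 a b hl)⟩
    · rcases hT.cov d hd with ⟨a, ha, rfl⟩ | ⟨a, ha, rfl⟩
      · obtain ⟨b, hb, h'⟩ := h1.2.2 a ha
        exact ⟨_, hS.m1 b hb, ih h' h2.mono (c1 b a hl)⟩
      · obtain ⟨b, hb, h'⟩ := h2.2.2 a ha
        exact ⟨_, hS.m2 b hb, ih h1.mono h' (c2 b a hl)⟩

def Str.comp (S T : Str L) : Str L where
  D := S.D ⊕ T.D
  dom := {x | Sum.elim (· ∈ S.dom) (· ∈ T.dom) x}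
  lt := fun x y => match x, y with
    | .inl a, .inl b => S.lt a b
    | .inr a, .inr b => T.lt a b
    | .inl a, .inr _ => S.kd a ≠ .right
    | .inr _, .inl a => S.kd a = .right
  anc := fun x y => match x, y with
    | .inl a, .inl b => S.anc a b
    | .inr a, .inr b => T.anc a b
    | .inl a, .inr _ => S.kd a = .anc
    | .inr _, .inl _ => False
  lab := Sum.elim S.lab T.lab
  kd := Sum.elim S.kd T.kd

theorem Str.isComp (S T : Str L) : IsComp (S.comp T) S T Sum.inl Sum.inr where
  m1 := fun _ h => h
  m2 := fun _ h => h
  cov := by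
    rintro (d | d) hd
    · exact Or.inl ⟨d, hd, rfl⟩
    · exact Or.inr ⟨d, hd, rfl⟩
  i1 := fun a _ b _ => ⟨Sum.inl.inj_iff, Iff.rfl, Iff.rfl⟩
  i2 := fun a _ b _ => ⟨Sum.inr.inj_iff, Iff.rfl, Iff.rfl⟩
  l1 := fun a _ => ⟨rfl, rfl⟩
  l2 := fun a _ => ⟨rfl, rfl⟩
  x := fun a _ b _ => ⟨Sum.inl_ne_inr, Iff.rfl, Iff.rfl, Iff.rfl, fun h => h⟩

variable (L) in
def Str.emp : Str L where
  D := Empty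
  dom := ∅
  lt := fun x => x.elim
  anc := fun x => x.elim
  lab := fun x => x.elim
  kd := fun x => x.elim

theorem Str.isComp_emp (S : Str L) : IsComp S S (Str.emp L) id Empty.elim where
  m1 := fun _ h => h
  m2 := fun a => a.elim
  cov := fun d hd => Or.inl ⟨d, hd, rfl⟩
  i1 := fun a _ b _ => ⟨Iff.rfl, Iff.rfl, Iff.rfl⟩
  i2 := fun a => a.elim
  l1 := fun a _ => ⟨rfl, rfl⟩
  l2 := fun a => a.elim
  x := fun a _ b => b.elim

theorem Str.emp_isComp (S : Str L) : IsComp S (Str.emp L) S Empty.elim id where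
  m1 := fun a => a.elim
  m2 := fun _ h => h
  cov := fun d hd => Or.inr ⟨d, hd, rfl⟩
  i1 := fun a => a.elim
  i2 := fun a _ b _ => ⟨Iff.rfl, Iff.rfl, Iff.rfl⟩
  l1 := fun a => a.elim
  l2 := fun a _ => ⟨rfl, rfl⟩
  x := fun a => a.elim

theorem IsComp.assoc {P A B : Str L} {f g} (h : IsComp P A B f g) (C : Str L) :
    IsComp (P.comp C) A (B.comp C) (Sum.inl ∘ f) (Sum.elim (Sum.inl ∘ g) Sum.inr) where
  m1 := h.m1
  m2 := by
    rintro (a | a) ha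
    · exact h.m2 a ha
    · exact ha
  cov := by
    rintro (d | d) hd
    · rcases h.cov d hd with ⟨a, ha, rfl⟩ | ⟨a, ha, rfl⟩
      · exact Or.inl ⟨a, ha, rfl⟩
      · exact Or.inr ⟨.inl a, ha, rfl⟩
    · exact Or.inr ⟨.inr d, hd, rfl⟩
  i1 := fun a ha b hb => ⟨Sum.inl.inj_iff.trans (h.i1 a ha b hb).1, (h.i1 a ha b hb).2⟩
  i2 := by
    rintro (a | a) ha (b | b) hb
    · exact ⟨Sum.inl.inj_iff.trans ((h.i2 a ha b hb).1.trans Sum.inl.inj_iff.symm),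
        (h.i2 a ha b hb).2⟩
    · exact ⟨iff_of_false Sum.inl_ne_inr Sum.inl_ne_inr,
        iff_of_eq (congrArg (· ≠ Knd.right) (h.l2 a ha).2),
        iff_of_eq (congrArg (· = Knd.anc) (h.l2 a ha).2)⟩
    · exact ⟨iff_of_false Sum.inr_ne_inl Sum.inr_ne_inl,
        iff_of_eq (congrArg (· = Knd.right) (h.l2 b hb).2), Iff.rfl⟩
    · exact ⟨Sum.inr.inj_iff.trans Sum.inr.inj_iff.symm, Iff.rfl, Iff.rfl⟩
  l1 := h.l1
  l2 := by
    rintro (a | a) ha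
    · exact h.l2 a ha
    · exact ⟨rfl, rfl⟩
  x := by
    rintro a ha (b | b) hb
    · exact ⟨fun e => (h.x a ha b hb).1 (Sum.inl.inj_iff.1 e), (h.x a ha b hb).2⟩
    · exact ⟨Sum.inl_ne_inr, iff_of_eq (congrArg (· ≠ Knd.right) (h.l1 a ha).2),
        iff_of_eq (congrArg (· = Knd.right) (h.l1 a ha).2),
        iff_of_eq (congrArg (· = Knd.anc) (h.l1 a ha).2), fun h => h⟩

def strSetoid (L : Type) (k : ℕ) : Setoid (Str L) where
  r := fun S T => EqK k S T []
  iseqv := ⟨fun S => EqK.refl k S [] (by simp), fun h => h.symm (by simp),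
    fun h h' => h.trans h' (by simp)⟩

def VK (L : Type) (k : ℕ) : Type 1 := Quotient (strSetoid L k)

def vk (k : ℕ) (S : Str L) : VK L k := Quotient.mk (strSetoid L k) S

theorem vk_eq {k : ℕ} {S T : Str L} : vk k S = vk k T ↔ EqK k S T [] :=
  Quotient.eq (r := strSetoid L k)

def VK.mul {k : ℕ} (a b : VK L k) : VK L k :=
  Quotient.map₂ Str.comp (fun S S' h T T' h' =>
    EqK.comp (S.isComp T) (S'.isComp T') h h' (by simp)) a b

theorem vk_comp {k : ℕ} {S S1 S2 : Str L} {f1 f2} (h : IsComp S S1 S2 f1 f2) :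
    vk k S = VK.mul (vk k S1) (vk k S2) :=
  vk_eq.2 (EqK.comp h (S1.isComp S2) (EqK.refl k S1 [] (by simp)) (EqK.refl k S2 [] (by simp))
    (by simp))

instance VK.instMonoid (k : ℕ) : Monoid (VK L k) where
  mul := VK.mul
  one := vk k (Str.emp L)
  one_mul := by
    intro a
    induction a using Quotient.inductionOn with
    | h S => exact (vk_comp S.emp_isComp).symm
  mul_one := by
    intro a
    induction a using Quotient.inductionOn with
    | h S => exact (vk_comp S.isComp_emp).symm
  mul_assoc := by
    intro a b c
    induction a using Quotient.inductionOn with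
    | h A =>
    induction b using Quotient.inductionOn with
    | h B =>
    induction c using Quotient.inductionOn with
    | h C => exact vk_comp ((A.isComp B).assoc C)

theorem vk_mul {k : ℕ} {S S1 S2 : Str L} {f1 f2} (h : IsComp S S1 S2 f1 f2) :
    vk k S = vk k S1 * vk k S2 := vk_comp h

def VK.close {k : ℕ} (κ : Knd) (a : VK L k) : VK L k :=
  Quotient.map (fun S => S.close κ) (fun _ _ h => EqK.close κ h) a

theorem vk_close {k : ℕ} (S : Str L) (κ : Knd) : vk k (S.close κ) = VK.close κ (vk k S) := rfl

def Str.pw (S : Str L) : ℕ → Str L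
  | 0 => Str.emp L
  | n + 1 => (S.pw n).comp S

theorem vk_pw (k : ℕ) (S : Str L) (n : ℕ) : vk k (S.pw n) = vk k S ^ n := by
  induction n with
  | zero => rfl
  | succ n ih => rw [pow_succ, ← ih]; rfl

def Occ (S P A B : Str L) (d : P.D → Prop) : Prop :=
  ∃ (Q : Str L) (f1 : A.D → P.D) (f2 : Q.D → P.D) (g1 : S.D → Q.D) (g2 : B.D → Q.D),
    IsComp P A Q f1 f2 ∧ IsComp Q S B g1 g2 ∧ ∀ s ∈ S.dom, d (f2 (g1 s))

theorem Occ.ext {S P A B C : Str L} {d} (h : Occ S P A B d) :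
    Occ S (P.comp C) A (B.comp C) (Sum.elim d fun _ => False) := by
  obtain ⟨Q, f1, f2, g1, g2, a, b, c⟩ := h
  exact ⟨Q.comp C, _, _, _, _, a.assoc C, b.assoc C, fun s hs => c s hs⟩

theorem occ_pw (S : Str L) (i r : ℕ) :
    Occ S (S.pw (i + 1 + r)) (S.pw i) (S.pw r) fun _ => True := by
  induction r with
  | zero => exact ⟨S, _, _, _, _, Str.isComp _ S, S.isComp_emp, fun _ _ => trivial⟩
  | succ r ih =>
    obtain ⟨Q, f1, f2, g1, g2, a, b, c⟩ := ih.ext (C := S)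
    exact ⟨Q, f1, f2, g1, g2, a, b, fun _ _ => trivial⟩

theorem occ_mem (S : Str L) (n : ℕ) (d) (hd : d ∈ (S.pw n).dom) :
    ∃ i r, n = i + 1 + r ∧ ∃ (Q : Str L) (f1 : (S.pw i).D → (S.pw n).D) (f2 : Q.D → (S.pw n).D)
      (g1 : S.D → Q.D) (g2 : (S.pw r).D → Q.D),
    IsComp (S.pw n) (S.pw i) Q f1 f2 ∧ IsComp Q S (S.pw r) g1 g2 ∧ ∃ s ∈ S.dom, f2 (g1 s) = d := by
  induction n with
  | zero => exact d.elim
  | succ n ih =>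
    rcases d with d | d
    · obtain ⟨i, r, e, Q, f1, f2, g1, g2, a, b, s, hs, c⟩ := ih d hd
      exact ⟨i, r + 1, by omega, Q.comp S, _, _, _, _, a.assoc S, b.assoc S, s, hs,
        congrArg Sum.inl c⟩
    · exact ⟨n, 0, rfl, S, _, _, _, _, Str.isComp _ S, S.isComp_emp, d, hd, rfl⟩

theorem pw_eq (S : Str L) (k : ℕ) : ∃ N, ∀ n m, N ≤ n → N ≤ m → EqK k (S.pw n) (S.pw m) [] := by
  induction k with
  | zero => exact ⟨0, fun n m _ _ => ⟨by simp, by simp⟩⟩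
  | succ k ih =>
    obtain ⟨N, hN⟩ := ih
    have key : ∀ n m, 2 * N + 1 ≤ n → 2 * N + 1 ≤ m → ∀ d ∈ (S.pw n).dom, ∃ e ∈ (S.pw m).dom,
        EqK k (S.pw n) (S.pw m) [(d, e)] := by
      intro n m hn hm d hd
      obtain ⟨i, r, e, Q, f1, f2, g1, g2, a, b, s, hs, c⟩ := occ_mem S n d hd
      obtain ⟨i', r', rfl, hi, hr⟩ : ∃ i' r', m = i' + 1 + r' ∧
          (i = i' ∨ (N ≤ i ∧ N ≤ i')) ∧ (r = r' ∨ (N ≤ r ∧ N ≤ r')) := by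
        by_cases h1 : i < N
        · exact ⟨i, m - 1 - i, by omega, Or.inl rfl, Or.inr (by omega)⟩
        · by_cases h2 : r < N
          · exact ⟨m - 1 - r, r, by omega, Or.inr (by omega), Or.inl rfl⟩
          · exact ⟨N, m - 1 - N, by omega, Or.inr (by omega), Or.inr (by omega)⟩
      have ei : EqK k (S.pw i) (S.pw i') [] := by
        rcases hi with rfl | h
        · exact EqK.refl _ _ _ (by simp)
        · exact hN _ _ h.1 h.2
      have er : EqK k (S.pw r) (S.pw r') [] := by
        rcases hr with rfl | h
        · exact EqK.refl _ _ _ (by simp)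
        · exact hN _ _ h.1 h.2
      obtain ⟨Q', f1', f2', g1', g2', a', b', -⟩ := occ_pw S i' r'
      have es : EqK k S S [(s, s)] := EqK.refl _ _ _ (by simpa using hs)
      have eq : EqK k Q Q' [(g1 s, g1' s)] := EqK.comp b b' es er (by simp)
      have ep : EqK k _ _ [(f2 (g1 s), f2' (g1' s))] := EqK.comp a a' ei eq (by simp)
      exact ⟨f2' (g1' s), a'.m2 _ (b'.m1 _ hs), c ▸ ep⟩
    refine ⟨2 * N + 1, fun n m hn hm => ⟨⟨by simp, by simp⟩, key n m hn hm, fun e he => ?_⟩⟩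
    obtain ⟨d, hd, h⟩ := key m n hm hn e he
    exact ⟨d, hd, h.symm (by simp)⟩

theorem VK.aper (k : ℕ) : Aper (VK L k) := by
  intro a
  induction a using Quotient.inductionOn with
  | h S =>
    obtain ⟨N, hN⟩ := pw_eq S k
    exact ⟨N, ((vk_pw k S (N + 1)).symm.trans (vk_eq.2 (hN _ _ (by omega) le_rfl))).trans
      (vk_pw k S N)⟩

def Ty0 (L : Type) (n : ℕ) : Type :=
  (Fin n → L × Knd) × (Fin n → Fin n → Prop × Prop × Prop)

def TyK (L : Type) : ℕ → ℕ → Type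
  | 0, n => Ty0 L n
  | k + 1, n => Ty0 L n × Set (TyK L k (n + 1))

instance TyK.fin [Finite L] (k : ℕ) : ∀ n, Finite (TyK L k n) := by
  induction k with
  | zero => intro n; unfold TyK Ty0; infer_instance
  | succ k ih =>
    intro n
    have := ih (n + 1)
    unfold TyK Ty0
    infer_instance

def ty0 (S : Str L) {n : ℕ} (a : Fin n → S.D) : Ty0 L n :=
  (fun i => (S.lab (a i), S.kd (a i)), fun i j => (a i = a j, S.lt (a i) (a j), S.anc (a i) (a j)))

def tyK (S : Str L) : (k : ℕ) → {n : ℕ} → (Fin n → S.D) → TyK L k n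
  | 0, _, a => ty0 S a
  | k + 1, _, a => (ty0 S a, {t | ∃ d ∈ S.dom, tyK S k (Fin.cons d a : Fin _ → S.D) = t})

theorem tyK_at {S T : Str L} {n} {a : Fin n → S.D} {b : Fin n → T.D} (ha : ∀ i, a i ∈ S.dom)
    (hb : ∀ i, b i ∈ T.dom) (h : ty0 S a = ty0 T b) :
    At S T (List.ofFn fun i => (a i, b i)) := by
  have h1 := fun i => congrFun (congrArg Prod.fst h) i
  have h2 := fun i j => congrFun (congrFun (congrArg Prod.snd h) i) j
  simp only [ty0, Prod.mk.injEq, eq_iff_iff] at h1 h2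
  refine ⟨?_, ?_⟩
  · intro p hp
    obtain ⟨i, rfl⟩ := (List.mem_ofFn' _ _).1 hp
    exact ⟨ha i, hb i, (h1 i).1, (h1 i).2⟩
  · intro p hp q hq
    obtain ⟨i, rfl⟩ := (List.mem_ofFn' _ _).1 hp
    obtain ⟨j, rfl⟩ := (List.mem_ofFn' _ _).1 hq
    exact h2 i j

theorem tyK_eq {S T : Str L} (k : ℕ) : ∀ {n} {a : Fin n → S.D} {b : Fin n → T.D},
    (∀ i, a i ∈ S.dom) → (∀ i, b i ∈ T.dom) → tyK S k a = tyK T k b →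
    EqK k S T (List.ofFn fun i => (a i, b i)) := by
  induction k with
  | zero => intro n a b ha hb h; exact tyK_at ha hb h
  | succ k ih =>
    intro n a b ha hb h
    have h1 := congrArg Prod.fst h
    have h2 := congrArg Prod.snd h
    have hc : ∀ d ∈ S.dom, ∀ e ∈ T.dom, tyK S k (Fin.cons d a : Fin _ → S.D) =
        tyK T k (Fin.cons e b : Fin _ → T.D) →
        EqK k S T ((d, e) :: List.ofFn fun i => (a i, b i)) := by
      intro d hd e he h
      have := ih (a := (Fin.cons d a : Fin (n + 1) → S.D))
        (b := (Fin.cons e b : Fin (n + 1) → T.D))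
        (fun i => by refine Fin.cases hd (fun i => ?_) i; simpa using ha i)
        (fun i => by refine Fin.cases he (fun i => ?_) i; simpa using hb i) h
      simpa [List.ofFn_succ] using this
    refine ⟨tyK_at ha hb h1, fun d hd => ?_, fun e he => ?_⟩
    · have : tyK S k (Fin.cons d a : Fin _ → S.D) ∈ (tyK T (k + 1) b).2 := h2 ▸ ⟨d, hd, rfl⟩
      obtain ⟨e, he, h'⟩ := this
      exact ⟨e, he, hc d hd e he h'.symm⟩
    · have : tyK T k (Fin.cons e b : Fin _ → T.D) ∈ (tyK S (k + 1) a).2 := h2 ▸ ⟨e, he, rfl⟩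
      obtain ⟨d, hd, h'⟩ := this
      exact ⟨d, hd, hc d hd e he h'⟩

instance VK.fin [Finite L] (k : ℕ) : Finite (VK L k) := by
  refine Finite.of_injective (β := TyK L k 0)
    (fun q => tyK q.out k (fun i => i.elim0 : Fin 0 → _)) ?_
  intro a b h
  have := tyK_eq k (by simp) (by simp) h
  have h' : vk k a.out = vk k b.out := vk_eq.2 (by simpa using this)
  rw [← Quotient.out_eq a, ← Quotient.out_eq b]
  exact h'

end EF
end OPLTheory

namespace OPLTheory
open Relation

structure Fst (Λ : Type) : Type where
  N : ℕ
  Par : ℕ → ℕ → Prop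
  lab : ℕ → Λ
  lt : ∀ {i j}, Par i j → i < j
  le : ∀ {i j}, Par i j → j ≤ N
  uniq : ∀ {a b c}, Par a c → Par b c → a = b
  tr : ∀ {i j c}, Par i j → i < c → c < j → ReflTransGen Par i c

namespace Fst
variable {Λ : Type} (F : Fst Λ)

abbrev Desc (a b : ℕ) : Prop := ReflTransGen F.Par a b

def SD (a b : ℕ) : Prop := F.Desc a b ∧ a ≠ b

def Sib (a b : ℕ) : Prop := a ≤ F.N ∧ b ≤ F.N ∧ ∀ p, F.Par p a ↔ F.Par p b

def NS (a b : ℕ) : Prop := F.Sib a b ∧ a < b ∧ ∀ c, a < c → c < b → ¬ F.Sib a c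

variable {F}

theorem Desc.le' {a b} (h : F.Desc a b) : a ≤ b := by
  induction h with
  | refl => exact le_rfl
  | tail _ h ih => exact ih.trans (F.lt h).le

theorem Desc.leN {a b} (h : F.Desc a b) (ha : a ≤ F.N) : b ≤ F.N := by
  cases h with
  | refl => exact ha
  | tail _ h => exact F.le h

theorem Desc.antisymm {a b} (h : F.Desc a b) (h' : F.Desc b a) : a = b :=
  le_antisymm h.le' h'.le'

theorem Desc.int {a b} (h : F.Desc a b) : ∀ {c}, a ≤ c → c ≤ b → F.Desc a c := by
  induction h with
  | refl => intro c h1 h2; rw [le_antisymm h2 h1]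
  | @tail b d hab hbd ih =>
    intro c h1 h2
    rcases le_or_gt c b with h | h
    · exact ih h1 h
    · rcases h2.eq_or_lt with rfl | h2
      · exact hab.tail hbd
      · exact hab.trans (F.tr hbd h h2)

theorem Desc.total {a b c} (h : F.Desc a c) (h' : F.Desc b c) : F.Desc a b ∨ F.Desc b a := by
  induction h with
  | refl => exact Or.inr h'
  | @tail d c had hdc ih =>
    cases h' with
    | refl => exact Or.inl (had.tail hdc)
    | tail h1 h2 =>
      cases F.uniq hdc h2
      exact ih h1

theorem SD.lt {a b} (h : F.SD a b) : a < b := lt_of_le_of_ne h.1.le' h.2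

theorem SD.par {a b} (h : F.SD a b) : ∃ p, F.Par p b ∧ F.Desc a p := by
  cases h.1 with
  | refl => exact absurd rfl h.2
  | tail h1 h2 => exact ⟨_, h2, h1⟩

theorem SD.child {a b} (h : F.SD a b) : ∃ p, F.Par a p ∧ F.Desc p b := by
  rcases ReflTransGen.cases_head h.1 with e | ⟨c, h1, h2⟩
  · exact absurd e h.2
  · exact ⟨c, h1, h2⟩

theorem par_sd {a b} (h : F.Par a b) : F.SD a b := ⟨.single h, (F.lt h).ne⟩

theorem Sib.symm {a b} (h : F.Sib a b) : F.Sib b a := ⟨h.2.1, h.1, fun p => (h.2.2 p).symm⟩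
theorem Sib.trans {a b c} (h : F.Sib a b) (h' : F.Sib b c) : F.Sib a c :=
  ⟨h.1, h'.2.1, fun p => (h.2.2 p).trans (h'.2.2 p)⟩

theorem Sib.eq {a b} (h : F.Sib a b) (hd : F.Desc a b) : a = b := by
  by_contra hne
  obtain ⟨p, h1, h2⟩ := SD.par ⟨hd, hne⟩
  exact absurd h2.le' (not_le.2 (F.lt ((h.2.2 p).2 h1)))

theorem Sib.lt {a b x y} (h : F.Sib a b) (hab : a < b) (hx : F.Desc a x) (hy : F.Desc b y) :
    x < y := by
  by_contra hn
  exact hab.ne (h.eq (hx.int hab.le (hy.le'.trans (not_lt.1 hn))))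

theorem Sib.ndesc {a b x y} (h : F.Sib a b) (hab : a ≠ b) (hx : F.Desc a x) (hy : F.Desc b y) :
    ¬ F.Desc x y := by
  intro hd
  rcases Desc.total (hx.trans hd) hy with h1 | h1
  · exact hab (h.eq h1)
  · exact hab (h.symm.eq h1).symm

theorem NS.uniq {a b c} (h : F.NS a c) (h' : F.NS b c) : a = b := by
  have hs : F.Sib a b := h.1.trans h'.1.symm
  rcases lt_trichotomy a b with hl | e | hl
  · exact absurd hs (h.2.2 b hl h'.2.1)
  · exact e
  · exact absurd hs.symm (h'.2.2 a hl h.2.1)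

theorem exists_pred {a b} (h : F.Sib a b) (hab : a < b) : ∃ p, F.NS p b ∧ a ≤ p := by
  classical
  let P := fun c => F.Sib c b ∧ c < b
  have h0 : P a := ⟨h, hab⟩
  have hsp : P (Nat.findGreatest P b) := Nat.findGreatest_spec hab.le h0
  refine ⟨Nat.findGreatest P b, ⟨hsp.1, hsp.2, fun c h1 h2 hc => ?_⟩,
    Nat.le_findGreatest hab.le h0⟩
  exact Nat.findGreatest_is_greatest h1 h2.le ⟨hc.symm.trans hsp.1, h2⟩

theorem exists_first {a} (h : a ≤ F.N) : ∃ f, F.Sib f a ∧ f ≤ a ∧ ∀ d, F.Sib f d → f ≤ d := by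
  classical
  have hex : ∃ f, F.Sib f a := ⟨a, h, h, fun _ => Iff.rfl⟩
  refine ⟨Nat.find hex, Nat.find_spec hex, Nat.find_min' hex ⟨h, h, fun _ => Iff.rfl⟩, ?_⟩
  intro d hd
  exact Nat.find_min' hex (hd.symm.trans (Nat.find_spec hex))

theorem exists_last {a} (h : a ≤ F.N) : ∃ f, F.Sib a f ∧ a ≤ f ∧ ∀ d, F.Sib f d → d ≤ f := by
  classical
  let P := fun c => F.Sib a c
  have h0 : P a := ⟨h, h, fun _ => Iff.rfl⟩
  have hsp : P (Nat.findGreatest P F.N) := Nat.findGreatest_spec h h0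
  refine ⟨_, hsp, Nat.le_findGreatest h h0, fun d hd => Nat.le_findGreatest hd.2.1 (hsp.trans hd)⟩

theorem first_iff {a} (h : a ≤ F.N) : (¬ ∃ t, F.NS t a) ↔ ∀ d, F.Sib a d → a ≤ d := by
  constructor
  · intro h1 d hd
    by_contra hl
    obtain ⟨p, hp, _⟩ := exists_pred hd.symm (not_le.1 hl)
    exact h1 ⟨p, hp⟩
  · rintro h1 ⟨t, ht⟩
    exact absurd (h1 t ht.1.symm) (not_le.2 ht.2.1)

theorem exists_succ {a b} (h : F.Sib a b) (hab : a < b) : ∃ p, F.NS a p := by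
  classical
  have hex : ∃ f, F.Sib a f ∧ a < f := ⟨b, h, hab⟩
  exact ⟨Nat.find hex, (Nat.find_spec hex).1, (Nat.find_spec hex).2,
    fun c h1 h2 h3 => Nat.find_min hex h2 ⟨h3, h1⟩⟩

theorem last_iff {a} : (¬ ∃ t, F.NS a t) ↔ ∀ d, F.Sib a d → d ≤ a := by
  constructor
  · intro h1 d hd
    by_contra hl
    exact h1 (exists_succ hd (not_le.1 hl))
  · rintro h1 ⟨t, ht⟩
    exact absurd (h1 t ht.1) (not_le.2 ht.2.1)

universe u
theorem ns_path {A M : Type u} [Monoid M] (l : ℕ → A) (h : A → M) {a : ℕ} (b : ℕ) :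
    F.Sib a b → a ≤ b → ∃ m, LP F.NS l h Set.univ a m b := by
  induction b using Nat.strong_induction_on with
  | _ b ih =>
  intro hs hab
  rcases hab.eq_or_lt with rfl | hab
  · exact ⟨1, LP.refl⟩
  · obtain ⟨p, hp, hap⟩ := exists_pred hs hab
    obtain ⟨m, hm⟩ := ih p hp.2.1 (hs.trans hp.1.symm) hap
    exact ⟨_, hm.step hp trivial⟩

theorem par_path {A M : Type u} [Monoid M] (l : ℕ → A) (h : A → M) {a b : ℕ}
    (hd : F.Desc a b) : ∃ m, LP F.Par l h Set.univ a m b := by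
  induction hd with
  | refl => exact ⟨1, LP.refl⟩
  | tail _ h1 ih =>
    obtain ⟨m, hm⟩ := ih
    exact ⟨_, hm.step h1 trivial⟩

theorem LP.desc {A M : Type u} [Monoid M] {l : ℕ → A} {h : A → M} {a m b B}
    (hd : LP F.Par l h B a m b) : F.Desc a b := by
  induction hd with
  | refl => exact .refl
  | step _ h1 _ ih => exact ih.tail h1

theorem LP.sib {A M : Type u} [Monoid M] {l : ℕ → A} {h : A → M} {a m b B} (ha : a ≤ F.N)
    (hd : LP F.NS l h B a m b) : F.Sib a b ∧ a ≤ b := by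
  induction hd with
  | refl => exact ⟨⟨ha, ha, fun _ => Iff.rfl⟩, le_rfl⟩
  | step _ h1 _ ih => exact ⟨ih.1.trans h1.1, ih.2.trans h1.2.1.le⟩

variable (F) in
def str (X : Set ℕ) (κ : ℕ → Knd) : Str Λ where
  D := ℕ
  dom := X
  lt := fun a b => a < b
  anc := F.SD
  lab := F.lab
  kd := κ

variable (F) in
def ty (k : ℕ) (X : Set ℕ) (κ : ℕ → Knd) : VK Λ k := vk k (F.str X κ)

theorem ty_congr {k X X' κ κ'} (hX : X = X') (h : ∀ x ∈ X, κ x = κ' x) :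
    F.ty k X κ = F.ty k X' κ' := by
  subst hX
  have hc : IsComp (F.str X κ) (F.str X κ') (Str.emp Λ) id Empty.elim := {
    m1 := fun _ h => h
    m2 := fun a => a.elim
    cov := fun d hd => Or.inl ⟨d, hd, rfl⟩
    i1 := fun a _ b _ => ⟨Iff.rfl, Iff.rfl, Iff.rfl⟩
    i2 := fun a => a.elim
    l1 := fun a ha => ⟨rfl, h a ha⟩
    l2 := fun a => a.elim
    x := fun a _ b => b.elim }
  exact (vk_mul hc).trans (mul_one _)

theorem ty_empty {k κ} : F.ty k ∅ κ = 1 := by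
  have hc : IsComp (F.str ∅ κ) (Str.emp Λ) (Str.emp Λ) Empty.elim Empty.elim := {
    m1 := fun a => a.elim
    m2 := fun a => a.elim
    cov := fun d hd => hd.elim
    i1 := fun a => a.elim
    i2 := fun a => a.elim
    l1 := fun a => a.elim
    l2 := fun a => a.elim
    x := fun a => a.elim }
  exact (vk_mul hc).trans (mul_one _)

variable (F) in
def RelK (κ : ℕ → Knd) (x y : ℕ) : Prop := match κ x with
  | .anc => F.SD x y
  | .left => x < y ∧ ¬ F.SD x y
  | .right => y < x ∧ ¬ F.SD y x

theorem isComp_union {X Y : Set ℕ} {κ : ℕ → Knd} (h : ∀ x ∈ X, ∀ y ∈ Y, F.RelK κ x y) :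
    IsComp (F.str (X ∪ Y) κ) (F.str X κ) (F.str Y κ) id id where
  m1 := fun _ h => Or.inl h
  m2 := fun _ h => Or.inr h
  cov := by
    rintro d (hd | hd)
    · exact Or.inl ⟨d, hd, rfl⟩
    · exact Or.inr ⟨d, hd, rfl⟩
  i1 := fun a _ b _ => ⟨Iff.rfl, Iff.rfl, Iff.rfl⟩
  i2 := fun a _ b _ => ⟨Iff.rfl, Iff.rfl, Iff.rfl⟩
  l1 := fun a _ => ⟨rfl, rfl⟩
  l2 := fun a _ => ⟨rfl, rfl⟩
  x := by
    intro (a : ℕ) ha (b : ℕ) hb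
    have := h a ha b hb
    unfold RelK at this
    change a ≠ b ∧ (a < b ↔ κ a ≠ .right) ∧ (b < a ↔ κ a = .right) ∧ (F.SD a b ↔ κ a = .anc) ∧
      ¬ F.SD b a
    cases hk : κ a <;> rw [hk] at this <;> simp only at this
    · have hl := this.lt
      exact ⟨hl.ne, by simp [hl], by simp [hl.le], by simp [this], fun h => hl.not_gt h.lt⟩
    · have hl := this.1
      exact ⟨hl.ne, by simp [hl], by simp [hl.le], by simp [this], fun h => hl.not_gt h.lt⟩
    · have hl := this.1
      exact ⟨hl.ne', by simp [hl.le], by simp [hl], by simpa using fun h => hl.not_gt h.lt, this.2⟩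

theorem ty_union {k} {X Y : Set ℕ} {κ : ℕ → Knd} (h : ∀ x ∈ X, ∀ y ∈ Y, F.RelK κ x y) :
    F.ty k (X ∪ Y) κ = F.ty k X κ * F.ty k Y κ := vk_mul (isComp_union h)

variable (F) in
def sub (z : ℕ) : Set ℕ := {x | F.Desc z x}

variable (F) in
def sds (z : ℕ) : Set ℕ := {x | F.SD z x}

open Classical in
variable (F) in
noncomputable def kap (h x : ℕ) : Knd :=
  if F.SD x h then .anc else if x < h then .left else .right

def lef : ℕ → Knd := fun _ => .left

variable (F) in
def unr (a b : ℕ) : Set ℕ := {x | ∃ d, F.Sib a d ∧ a < d ∧ d ≤ b ∧ F.Desc d x}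

variable (F) in
def lsb (z : ℕ) : Set ℕ := {x | ∃ d, F.Sib d z ∧ d < z ∧ F.Desc d x}

variable (F) in
def rsb (z : ℕ) : Set ℕ := {x | ∃ d, F.Sib z d ∧ z < d ∧ F.Desc d x}

variable (F) in
def top (z : ℕ) : Set ℕ := {x | x ≤ F.N ∧ ∀ p, F.Par p z → F.Desc p x}

variable (F) in
noncomputable def s (k z : ℕ) : VK Λ k := F.ty k (F.sub z) lef

variable (F) in
noncomputable def cf (k z : ℕ) : VK Λ k := F.ty k (F.sds z) lef

variable (F) in
noncomputable def e (k z : ℕ) : VK Λ k := F.ty k (F.top z \ F.sub z) (F.kap z)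

theorem relK_lef {x y} (h : x < y) (h' : ¬ F.SD x y) : F.RelK lef x y := ⟨h, h'⟩

theorem ns_prod {k a m b} (ha : a ≤ F.N) (p : LP F.NS (F.s k) id Set.univ a m b) :
    m = F.ty k (F.unr a b) lef := by
  induction p with
  | refl =>
    rw [← ty_empty (κ := lef)]
    refine ty_congr ?_ (fun _ _ => rfl)
    ext x
    simp only [unr, Set.mem_empty_iff_false, Set.mem_ofPred_eq, false_iff]
    rintro ⟨d, _, h1, h2, _⟩
    omega
  | @step m y t p hr _ ih =>
    have hs := LP.sib ha p
    have hu : F.unr a t = F.unr a y ∪ F.sub t := by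
      ext x
      constructor
      · rintro ⟨d, h1, h2, h3, h4⟩
        rcases h3.eq_or_lt with rfl | h3
        · exact Or.inr h4
        · refine Or.inl ⟨d, h1, h2, ?_, h4⟩
          by_contra hn
          exact hr.2.2 d (not_le.1 hn) h3 (hs.1.symm.trans h1)
      · rintro (⟨d, h1, h2, h3, h4⟩ | h)
        · exact ⟨d, h1, h2, h3.trans hr.2.1.le, h4⟩
        · exact ⟨t, hs.1.trans hr.1, hs.2.trans_lt hr.2.1, le_rfl, h⟩
    rw [hu, ty_union, ← ih]
    · rfl
    · rintro x ⟨d, h1, h2, h3, h4⟩ y' hy'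
      have hdt : F.Sib d t := h1.symm.trans (hs.1.trans hr.1)
      have hlt := h3.trans_lt hr.2.1
      exact relK_lef (hdt.lt hlt h4 hy') fun h => hdt.ndesc hlt.ne h4 hy' h.1

theorem ns_prod2 {k a m b} (ha : a ≤ F.N) (p : LP F.NS (F.s k) id Set.univ a m b) :
    F.s k a * m = F.ty k (F.sub a ∪ F.unr a b) lef := by
  rw [ty_union, ← ns_prod ha p]
  · rfl
  · rintro x hx y ⟨d, h1, h2, h3, h4⟩
    exact relK_lef (h1.lt h2 hx h4) fun h => h1.ndesc h2.ne hx h4 h.1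

theorem cf_leaf {k y} (h : ¬ ∃ c, F.Par y c) : F.cf k y = 1 := by
  rw [← ty_empty (κ := lef)]
  refine ty_congr ?_ (fun _ _ => rfl)
  ext x
  simp only [sds, Set.mem_empty_iff_false, Set.mem_ofPred_eq, iff_false]
  intro hx
  obtain ⟨c, hc, _⟩ := hx.child
  exact h ⟨c, hc⟩

theorem cf_eq {k y c m t} (hc : F.Par y c) (hf : ∀ d, F.Sib c d → c ≤ d)
    (p : LP F.NS (F.s k) id Set.univ c m t) (ht : ∀ d, F.Sib t d → d ≤ t) :
    F.cf k y = F.s k c * m := by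
  have hs := LP.sib (F.le hc) p
  rw [ns_prod2 (F.le hc) p]
  refine ty_congr ?_ (fun _ _ => rfl)
  ext x
  constructor
  · intro hx
    obtain ⟨d, hd, hdx⟩ := hx.child
    have hcd : F.Sib c d := ⟨F.le hc, F.le hd, fun p =>
      ⟨fun h => F.uniq hc h ▸ hd, fun h => F.uniq hd h ▸ hc⟩⟩
    rcases (hf d hcd).eq_or_lt with rfl | hl
    · exact Or.inl hdx
    · exact Or.inr ⟨d, hcd, hl, ht d (hs.1.symm.trans hcd), hdx⟩
  · have : ∀ d, F.Par y d → F.Desc d x → F.SD y x := fun d hd hx =>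
      ⟨hx.head hd, ((F.lt hd).trans_le hx.le').ne⟩
    rintro (h | ⟨d, h1, h2, h3, h4⟩)
    · exact this c hc h
    · exact this d ((h1.2.2 y).1 hc) h4

theorem lsb_eq {k z f m p} (hn : F.NS p z) (hp : LP F.NS (F.s k) id Set.univ f m p)
    (hf : f ≤ F.N) (hf' : ∀ d, F.Sib f d → f ≤ d) :
    F.ty k (F.lsb z) lef = F.s k f * m := by
  have hs := LP.sib hf hp
  rw [ns_prod2 hf hp]
  refine ty_congr ?_ (fun _ _ => rfl)
  have hfz := hs.1.trans hn.1
  ext x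
  constructor
  · rintro ⟨d, h1, h2, h3⟩
    have hfd := hfz.trans h1.symm
    rcases (hf' d hfd).eq_or_lt with rfl | hl
    · exact Or.inl h3
    · refine Or.inr ⟨d, hfd, hl, ?_, h3⟩
      by_contra hn'
      exact hn.2.2 d (not_le.1 hn') h2 (hn.1.trans h1.symm)
  · rintro (h | ⟨d, h1, h2, h3, h4⟩)
    · exact ⟨f, hfz, hs.2.trans_lt hn.2.1, h⟩
    · exact ⟨d, h1.symm.trans hfz, h3.trans_lt hn.2.1, h4⟩

theorem lsb_first {k z} (h : ∀ d, F.Sib z d → z ≤ d) : F.ty k (F.lsb z) lef = 1 := by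
  rw [← ty_empty (κ := lef)]
  refine ty_congr ?_ (fun _ _ => rfl)
  ext x
  simp only [lsb, Set.mem_empty_iff_false, Set.mem_ofPred_eq, iff_false]
  rintro ⟨d, h1, h2, _⟩
  exact absurd (h d h1.symm) (not_le.2 h2)

theorem rsb_eq {k z m t} (hz : z ≤ F.N) (p : LP F.NS (F.s k) id Set.univ z m t)
    (ht : ∀ d, F.Sib t d → d ≤ t) : F.ty k (F.rsb z) lef = m := by
  have hs := LP.sib hz p
  rw [ns_prod hz p]
  refine ty_congr ?_ (fun _ _ => rfl)
  ext x
  exact ⟨fun ⟨d, h1, h2, h3⟩ => ⟨d, h1, h2, ht d (hs.1.symm.trans h1), h3⟩,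
    fun ⟨d, h1, h2, _, h3⟩ => ⟨d, h1, h2, h3⟩⟩

theorem rel_out {y x y2} (hx : ¬ F.Desc y x) (hy : F.Desc y y2) : F.RelK (F.kap y) x y2 := by
  unfold RelK kap
  split_ifs with h1 h2
  · exact ⟨h1.1.trans hy, (h1.lt.trans_le hy.le').ne⟩
  · refine ⟨h2.trans_le hy.le', fun h => ?_⟩
    rcases h.1.total hy with h3 | h3
    · exact h1 ⟨h3, h2.ne⟩
    · exact hx h3
  · refine ⟨?_, fun h => hx (hy.trans h.1)⟩
    by_contra hn
    exact hx (hy.int (not_lt.1 h2) (not_lt.1 hn))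

theorem exists_root {x} : x ≤ F.N → ∃ d, d ≤ F.N ∧ (¬ ∃ p, F.Par p d) ∧ F.Desc d x := by
  induction x using Nat.strong_induction_on with
  | _ x ih =>
  intro hx
  by_cases hq : ∃ p, F.Par p x
  · obtain ⟨q, hq⟩ := hq
    obtain ⟨d, h4, h5, h6⟩ := ih q (F.lt hq) ((F.lt hq).le.trans hx)
    exact ⟨d, h4, h5, h6.tail hq⟩
  · exact ⟨x, hx, hq, .refl⟩

theorem top_eq {z} (hz : z ≤ F.N) :
    F.top z \ F.sub z = ({x | F.Par x z} ∪ F.lsb z) ∪ F.rsb z := by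
  have key : ∀ d x, F.Sib z d → F.Desc d x → x ∉ F.sub z →
      x ∈ ({x | F.Par x z} ∪ F.lsb z) ∪ F.rsb z := by
    intro d x h1 h2 h3
    rcases lt_trichotomy z d with h | rfl | h
    · exact Or.inr ⟨d, h1, h, h2⟩
    · exact absurd h2 h3
    · exact Or.inl (Or.inr ⟨d, h1.symm, h, h2⟩)
  have key2 : ∀ d x, F.Sib z d → z ≠ d → F.Desc d x → x ∈ F.top z \ F.sub z := by
    intro d x h1 h2 h3
    refine ⟨⟨h3.leN h1.2.1, fun p hp => h3.head ((h1.2.2 p).1 hp)⟩, fun h => ?_⟩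
    rcases Desc.total h3 h with h4 | h4
    · exact h2 (h1.symm.eq h4).symm
    · exact h2 (h1.eq h4)
  ext x
  constructor
  · rintro ⟨⟨h1, h2⟩, h3⟩
    by_cases hp : ∃ p, F.Par p z
    · obtain ⟨p, hp⟩ := hp
      by_cases hpx : p = x
      · exact Or.inl (Or.inl (hpx ▸ hp))
      · obtain ⟨d, hd, hdx⟩ := SD.child ⟨h2 p hp, hpx⟩
        exact key d x ⟨hz, F.le hd, fun q => ⟨fun h => F.uniq hp h ▸ hd,
          fun h => F.uniq hd h ▸ hp⟩⟩ hdx h3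
    · obtain ⟨d, h4, h5, h6⟩ := exists_root h1
      exact key d x ⟨hz, h4, fun q => ⟨fun h => (hp ⟨q, h⟩).elim, fun h => (h5 ⟨q, h⟩).elim⟩⟩ h6 h3
  · rintro ((hx | ⟨d, h1, h2, h3⟩) | ⟨d, h1, h2, h3⟩)
    · exact ⟨⟨(F.lt hx).le.trans hz, fun p hp => F.uniq hp hx ▸ .refl⟩,
        fun h => absurd h.le' (not_le.2 (F.lt hx))⟩
    · exact key2 d x h1.symm h2.ne' h3
    · exact key2 d x h1 h2.ne h3

theorem kap_par {x z} (h : F.Par x z) : F.kap z x = .anc := by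
  unfold kap; rw [if_pos (par_sd h)]

theorem kap_lsb {x z} (h : x ∈ F.lsb z) : F.kap z x = .left := by
  obtain ⟨d, h1, h2, h3⟩ := h
  unfold kap
  rw [if_neg fun h => h1.ndesc h2.ne h3 .refl h.1, if_pos (h1.lt h2 h3 .refl)]

theorem kap_rsb {x z} (h : x ∈ F.rsb z) : F.kap z x = .right := by
  obtain ⟨d, h1, h2, h3⟩ := h
  have := h1.lt h2 .refl h3
  unfold kap
  rw [if_neg fun h => this.not_gt h.lt, if_neg this.not_gt]

theorem e_eq {k z} (hz : z ≤ F.N) : F.e k z =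
    F.ty k {x | F.Par x z} (fun _ => .anc) * F.ty k (F.lsb z) lef *
      VK.close .right (F.ty k (F.rsb z) lef) := by
  unfold e
  rw [top_eq hz, ty_union, ty_union]
  · congr 1
    · congr 1
      · exact ty_congr rfl fun x hx => kap_par hx
      · exact ty_congr rfl fun x hx => kap_lsb hx
    · exact ty_congr rfl fun x hx => kap_rsb hx
  · rintro x hx y ⟨d, h1, h2, h3⟩
    unfold RelK
    rw [kap_par hx]
    exact ⟨h3.head ((h1.2.2 x).2 hx), ((F.lt ((h1.2.2 x).2 hx)).trans_le h3.le').ne⟩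
  · rintro x (hx | hx) y ⟨d', h1', h2', h3'⟩
    · unfold RelK
      rw [kap_par hx]
      exact ⟨h3'.head ((h1'.2.2 x).1 hx), ((F.lt ((h1'.2.2 x).1 hx)).trans_le h3'.le').ne⟩
    · unfold RelK
      rw [kap_lsb hx]
      obtain ⟨d, h1, h2, h3⟩ := hx
      have hs := h1.trans h1'
      exact ⟨hs.lt (h2.trans h2') h3 h3', fun h => hs.ndesc (h2.trans h2').ne h3 h3' h.1⟩

theorem par_prod {k y m y'} {Z : Set ℕ} (hZ : F.sub y ⊆ Z) (hN : y ≤ F.N)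
    (p : LP F.Par (F.e k) id Set.univ y m y') :
    F.ty k (Z \ F.sub y') (F.kap y') = F.ty k (Z \ F.sub y) (F.kap y) * m := by
  induction p with
  | refl => rw [mul_one]
  | @step m x t p hr _ ih =>
    rw [← mul_assoc, ← ih]
    have hxZ : F.sub x ⊆ Z := fun a ha => hZ ((LP.desc p).trans ha)
    have hxN : x ≤ F.N := (F.lt hr).le.trans (F.le hr)
    have hset : Z \ F.sub t = (Z \ F.sub x) ∪ (F.top t \ F.sub t) := by
      ext a
      constructor
      · rintro ⟨h1, h2⟩
        by_cases h : a ∈ F.sub x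
        · exact Or.inr ⟨⟨Desc.leN h hxN, fun p hp => F.uniq hr hp ▸ h⟩, h2⟩
        · exact Or.inl ⟨h1, h⟩
      · rintro (⟨h1, h2⟩ | ⟨h1, h2⟩)
        · exact ⟨h1, fun h => h2 (ReflTransGen.head hr h)⟩
        · exact ⟨hxZ (h1.2 x hr), h2⟩
    have hk : ∀ a, ¬ F.Desc x a → F.kap t a = F.kap x a := by
      intro a ha
      have h1 : F.SD a t ↔ F.SD a x := by
        constructor
        · intro h
          obtain ⟨q, hq, h'⟩ := h.par
          cases F.uniq hr hq
          exact ⟨h', fun h => ha (h ▸ .refl)⟩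
        · intro h
          exact ⟨h.1.tail hr, (h.lt.trans (F.lt hr)).ne⟩
      have h2 : a < t ↔ a < x := by
        constructor
        · intro h
          by_contra hn
          exact ha (Desc.int (.single hr) (not_lt.1 hn) h.le)
        · intro h; exact h.trans (F.lt hr)
      unfold kap
      by_cases q1 : F.SD a x
      · rw [if_pos q1, if_pos (h1.2 q1)]
      · rw [if_neg q1, if_neg (fun h => q1 (h1.1 h))]
        simp only [h2]
    rw [hset, ty_union]
    · congr 1
      exact ty_congr rfl fun a ha => hk a ha.2
    · rintro a ⟨_, ha⟩ b ⟨⟨_, hb⟩, _⟩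
      have := rel_out ha (hb x hr)
      unfold RelK at this ⊢
      rw [hk a ha]
      exact this

theorem par_prod' {k y m y'} (hN : y ≤ F.N) (p : LP F.Par (F.e k) id Set.univ y m y') :
    F.ty k (F.sub y \ F.sub y') (F.kap y') = m := by
  rw [par_prod (Set.Subset.refl _) hN p]
  simp [ty_empty]

theorem eq_single {F' : Fst Λ} {k y y' κ} (h : F.lab y = F'.lab y') :
    EqK k (F.str {y} fun _ => κ) (F'.str {y'} fun _ => κ) [(y, y')] := by
  have h0 : ∀ l : List (ℕ × ℕ), (∀ p ∈ l, p = (y, y')) →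
      At (F.str {y} fun _ => κ) (F'.str {y'} fun _ => κ) l := by
    intro l hl
    refine ⟨fun p hp => ?_, fun p hp q hq => ?_⟩
    · cases hl p hp
      exact ⟨rfl, rfl, h, rfl⟩
    · cases hl p hp
      cases hl q hq
      exact ⟨iff_of_true rfl rfl, iff_of_false (lt_irrefl _) (lt_irrefl _),
        iff_of_false (fun h => h.2 rfl) (fun h => h.2 rfl)⟩
  have : ∀ l : List (ℕ × ℕ), (∀ p ∈ l, p = (y, y')) →
      EqK k (F.str {y} fun _ => κ) (F'.str {y'} fun _ => κ) l := by
    induction k with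
    | zero => exact h0
    | succ k ih =>
      intro l hl
      refine ⟨h0 l hl, ?_, ?_⟩
      · intro d hd
        cases (hd : d = y)
        exact ⟨y', rfl, ih _ (fun p hp => (List.mem_cons.1 hp).elim id (hl p))⟩
      · intro d hd
        cases (hd : d = y')
        exact ⟨y, rfl, ih _ (fun p hp => (List.mem_cons.1 hp).elim id (hl p))⟩
  exact this _ (fun p hp => List.mem_singleton.1 hp)

theorem isComp_pt {Z : Set ℕ} {y : ℕ} (hZ : F.sub y ⊆ Z) : ∃ κ1 κ2 : ℕ → Knd,
    IsComp (F.str Z κ1) (F.str (Z \ F.sub y) (F.kap y)) (F.str (F.sub y) κ2) id id ∧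
    IsComp (F.str (F.sub y) κ2) (F.str {y} fun _ => .anc) (F.str (F.sds y) lef) id id := by
  classical
  let κ2 : ℕ → Knd := fun x => if x = y then .anc else .left
  let κ1 : ℕ → Knd := fun x => if F.Desc y x then κ2 x else F.kap y x
  have h1 : ∀ x, F.Desc y x → κ1 x = κ2 x := fun x h => if_pos h
  have h2 : ∀ x, ¬ F.Desc y x → κ1 x = F.kap y x := fun x h => if_neg h
  have e1 : Z = (Z \ F.sub y) ∪ F.sub y := by
    rw [Set.sdiff_union_of_subset hZ]
  have e2 : F.sub y = {y} ∪ F.sds y := by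
    ext x
    constructor
    · intro h
      by_cases hx : x = y
      · exact Or.inl hx
      · exact Or.inr ⟨h, Ne.symm hx⟩
    · rintro (rfl | h)
      · exact ReflTransGen.refl
      · exact h.1
  have c1 : IsComp (F.str ((Z \ F.sub y) ∪ F.sub y) κ1) (F.str (Z \ F.sub y) κ1)
      (F.str (F.sub y) κ1) id id := by
    refine isComp_union ?_
    rintro a ⟨_, ha⟩ b hb
    have := rel_out ha hb
    unfold RelK at this ⊢
    rw [h2 a ha]; exact this
  have c2 : IsComp (F.str ({y} ∪ F.sds y) κ2) (F.str {y} κ2) (F.str (F.sds y) κ2) id id := by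
    refine isComp_union ?_
    rintro a rfl b hb
    have e : κ2 a = .anc := if_pos rfl
    unfold RelK
    rw [e]; exact hb
  rw [← e1] at c1
  rw [← e2] at c2
  refine ⟨κ1, κ2, ⟨c1.m1, c1.m2, c1.cov, c1.i1, c1.i2, fun a ha => ⟨rfl, h2 a ha.2⟩,
    fun a ha => ⟨rfl, h1 a ha⟩, fun a ha b hb => ?_⟩, ⟨c2.m1, c2.m2, c2.cov, c2.i1, c2.i2,
    fun a ha => ⟨rfl, if_pos ha⟩, fun a ha => ⟨rfl, if_neg ha.2.symm⟩, fun a ha b hb => ?_⟩⟩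
  · have := c1.x a ha b hb
    have e : (F.str (Z \ F.sub y) κ1).kd a = (F.str (Z \ F.sub y) (F.kap y)).kd a := h2 a ha.2
    rw [e] at this
    exact this
  · have := c2.x a ha b hb
    have e : (F.str {y} κ2).kd a = (F.str {y} fun _ => Knd.anc).kd a := if_pos ha
    rw [e] at this
    exact this

theorem pt_eq {F' : Fst Λ} {k : ℕ} {Z Z' : Set ℕ} {y y' : ℕ} (hZ : F.sub y ⊆ Z)
    (hZ' : F'.sub y' ⊆ Z')
    (h1 : F.ty k (Z \ F.sub y) (F.kap y) = F'.ty k (Z' \ F'.sub y') (F'.kap y'))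
    (h2 : F.lab y = F'.lab y') (h3 : F.cf k y = F'.cf k y') :
    EqK k (F.str Z lef) (F'.str Z' lef) [(y, y')] := by
  obtain ⟨κ1, κ2, a, b⟩ := isComp_pt hZ
  obtain ⟨κ1', κ2', a', b'⟩ := isComp_pt hZ'
  have e1 : EqK k (F.str (F.sub y) κ2) (F'.str (F'.sub y') κ2') [(y, y')] :=
    EqK.comp b b' (eq_single h2) (vk_eq.1 h3) (by simp)
  have e2 : EqK k (F.str Z κ1) (F'.str Z' κ1') [(y, y')] :=
    EqK.comp a a' (vk_eq.1 h1) e1 (by simp)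
  exact e2.close .left

end Fst
end OPLTheory

namespace OPLTheory
open Relation

structure FD {W Λ : Type} (F : W → Fst Λ) (Def : (W → ℕ → Prop) → Prop) : Prop where
  H : BoolCl Def
  dom : ∀ P Q : W → ℕ → Prop, (∀ w z, z ≤ (F w).N → (P w z ↔ Q w z)) → Def P → Def Q
  SP : StepCl Def fun w => (F w).Par
  SN : StepCl Def fun w => (F w).NS
  HL : ∀ a, Def fun w z => (F w).lab z = a

namespace FD
variable {W Λ : Type} [Finite Λ] {F : W → Fst Λ} {Def : (W → ℕ → Prop) → Prop}

theorem invN (D : FD F Def) {A : Type*} [Finite A] {l : W → ℕ → A}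
    (h : ∀ a, Def fun w z => l w z = a) {P : W → ℕ → Prop}
    (hP : ∀ w z w' z', z ≤ (F w).N → z' ≤ (F w').N → l w z = l w' z' → (P w z → P w' z')) :
    Def P := by
  refine D.dom _ _ ?_ (D.H.mem h {a | ∃ w z, z ≤ (F w).N ∧ l w z = a ∧ P w z})
  intro w z hz
  constructor
  · rintro ⟨w', z', hz', e, hp⟩
    exact hP _ _ _ _ hz' hz e hp
  · intro hp
    exact ⟨w, z, hz, rfl, hp⟩

theorem pair (D : FD F Def) {A B : Type*} {l : W → ℕ → A} {l' : W → ℕ → B}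
    (h : ∀ a, Def fun w z => l w z = a) (h' : ∀ a, Def fun w z => l' w z = a) :
    ∀ a, Def fun w z => (l w z, l' w z) = a := by
  rintro ⟨a, b⟩
  exact defCongr (D.H.and _ _ (h a) (h' b)) (by simp)

theorem setd (D : FD F Def) {T : Type*} [Finite T] {P : T → W → ℕ → Prop} (h : ∀ t, Def (P t)) :
    ∀ a : Set T, Def fun w z => {t | P t w z} = a := by
  intro a
  refine defCongr (D.H.all (P := fun t w z => (P t w z → t ∈ a) ∧ (t ∈ a → P t w z)) fun t =>
    D.H.and _ _ (D.H.imp (h t) (D.H.const _)) (D.H.imp (D.H.const _) (h t))) ?_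
  intro w z
  simp only [Set.ext_iff]
  exact forall_congr' fun t => ⟨fun h => ⟨h.1, h.2⟩, fun h => ⟨h.1, h.2⟩⟩

variable {k : ℕ}

theorem E_def (D : FD F Def) (hs : ∀ v, Def fun w z => (F w).s k z = v) (m : VK Λ k) :
    Def fun w z => ∃ t, LP (F w).NS ((F w).s k) id Set.univ z m t ∧ ¬ ∃ u, (F w).NS t u ∧ True :=
  ((engine D.H D.SN (VK.aper k) (fun w => (F w).s k) hs id Set.univ) m _
    (D.H.neg _ (D.SN.succ D.H D.H.tt))).1

theorem rsb_def (D : FD F Def) (hs : ∀ v, Def fun w z => (F w).s k z = v) (v : VK Λ k) :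
    Def fun w z => (F w).ty k ((F w).rsb z) Fst.lef = v := by
  refine D.dom _ _ ?_ (E_def D hs v)
  intro w z hz
  simp only [and_true]
  constructor
  · rintro ⟨t, p, ht⟩
    exact Fst.rsb_eq hz p (Fst.last_iff.1 ht)
  · rintro rfl
    obtain ⟨t, h1, h2, h3⟩ := Fst.exists_last hz
    obtain ⟨m, hm⟩ := Fst.ns_path ((F w).s k) id t h1 h2
    exact ⟨t, (Fst.rsb_eq hz hm h3).symm ▸ hm, Fst.last_iff.2 h3⟩

theorem lsb_def (D : FD F Def) (hs : ∀ v, Def fun w z => (F w).s k z = v) (v : VK Λ k) :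
    Def fun w z => (F w).ty k ((F w).lsb z) Fst.lef = v := by
  have hf : Def fun w z => ¬ ∃ t, (F w).NS t z ∧ True := D.H.neg _ (D.SN.pred D.H D.H.tt)
  have h1 : ∀ m0 m : VK Λ k, Def fun w z => ∃ p, (F w).NS p z ∧
      ∃ f, LP (F w).NS ((F w).s k) id Set.univ f m p ∧
        ((¬ ∃ t, (F w).NS t f ∧ True) ∧ (F w).s k f = m0) := fun m0 m =>
    D.SN.pred D.H (((engine D.H D.SN (VK.aper k) (fun w => (F w).s k) hs id Set.univ) m _
      (D.H.and _ _ hf (hs m0))).2)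
  refine D.dom _ _ ?_ (D.H.or (D.H.and _ _ hf (D.H.const (1 = v)))
    (D.H.ex fun m0 => D.H.ex fun m => D.H.and _ _ (h1 m0 m) (D.H.const (m0 * m = v))))
  intro w z hz
  simp only [and_true]
  constructor
  · rintro (⟨h, rfl⟩ | ⟨m0, m, ⟨p, hp, f, hl, hf, rfl⟩, rfl⟩)
    · exact Fst.lsb_first ((Fst.first_iff hz).1 h)
    · have hfN : f ≤ (F w).N := by
        have : ∀ {m p}, LP (F w).NS ((F w).s k) id Set.univ f m p → f ≤ p := by
          intro m p h
          induction h with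
          | refl => exact le_rfl
          | step _ h1 _ ih => exact ih.trans h1.2.1.le
        exact (this hl).trans hp.1.1
      exact Fst.lsb_eq hp hl hfN ((Fst.first_iff hfN).1 hf)
  · rintro rfl
    by_cases h : ∃ t, (F w).NS t z
    · obtain ⟨p, hp⟩ := h
      obtain ⟨f, h1, h2, h3⟩ := Fst.exists_first hp.1.1
      obtain ⟨m, hm⟩ := Fst.ns_path ((F w).s k) id p h1 h2
      exact Or.inr ⟨_, m, ⟨p, hp, f, hm, (Fst.first_iff h1.1).2 h3, rfl⟩,
        (Fst.lsb_eq hp hm h1.1 h3).symm⟩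
    · exact Or.inl ⟨h, (Fst.lsb_first ((Fst.first_iff hz).1 h)).symm⟩

theorem cf_def (D : FD F Def) (hs : ∀ v, Def fun w z => (F w).s k z = v) (v : VK Λ k) :
    Def fun w z => (F w).cf k z = v := by
  have hf : Def fun w z => ¬ ∃ t, (F w).NS t z ∧ True := D.H.neg _ (D.SN.pred D.H D.H.tt)
  have h1 : ∀ m0 m : VK Λ k, Def fun w z => ∃ c, (F w).Par z c ∧
      ((¬ ∃ t, (F w).NS t c ∧ True) ∧ (F w).s k c = m0) ∧
      ∃ t, LP (F w).NS ((F w).s k) id Set.univ c m t ∧ ¬ ∃ u, (F w).NS t u ∧ True := fun m0 m =>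
    D.SP.succ D.H (D.H.and _ _ (D.H.and _ _ hf (hs m0)) (E_def D hs m))
  refine defCongr (D.H.or (D.H.and _ _ (D.H.neg _ (D.SP.succ D.H D.H.tt)) (D.H.const (1 = v)))
    (D.H.ex fun m0 => D.H.ex fun m => D.H.and _ _ (h1 m0 m) (D.H.const (m0 * m = v)))) ?_
  intro w z
  simp only [and_true]
  constructor
  · rintro (⟨h, rfl⟩ | ⟨m0, m, ⟨c, hc, ⟨hf, rfl⟩, t, p, ht⟩, rfl⟩)
    · exact Fst.cf_leaf h
    · exact Fst.cf_eq hc ((Fst.first_iff ((F w).le hc)).1 hf) p (Fst.last_iff.1 ht)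
  · rintro rfl
    by_cases h : ∃ t, (F w).Par z t
    · obtain ⟨c, hc⟩ := h
      obtain ⟨f, h1, h2, h3⟩ := Fst.exists_first ((F w).le hc)
      have hfz := (h1.2.2 z).2 hc
      obtain ⟨t, h4, h5, h6⟩ := Fst.exists_last h1.1
      obtain ⟨m, hm⟩ := Fst.ns_path ((F w).s k) id t h4 h5
      exact Or.inr ⟨_, m, ⟨f, hfz, ⟨(Fst.first_iff h1.1).2 h3, rfl⟩, t, hm, Fst.last_iff.2 h6⟩,
        (Fst.cf_eq hfz h3 hm h6).symm⟩
    · exact Or.inl ⟨h, (Fst.cf_leaf h).symm⟩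

theorem pt_def (D : FD F Def) (v : VK Λ k) :
    Def fun w z => (F w).ty k {x | (F w).Par x z} (fun _ => .anc) = v := by
  refine D.invN (l := fun w z => {a | ∃ p, (F w).Par p z ∧ (F w).lab p = a})
    (D.setd fun a => D.SP.pred D.H (D.HL a)) ?_
  rintro w z w' z' - - e rfl
  have hset : ∀ {w z p}, (F w).Par p z → {x | (F w).Par x z} = {p} := by
    intro w z p h
    ext x
    exact ⟨fun hx => (F w).uniq hx h, fun hx => hx ▸ h⟩
  by_cases h : ∃ p, (F w).Par p z
  · obtain ⟨p, hp⟩ := h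
    have : (F w).lab p ∈ {a | ∃ p, (F w').Par p z' ∧ (F w').lab p = a} := e ▸ ⟨p, hp, rfl⟩
    obtain ⟨p', hp', h⟩ := this
    rw [hset hp, hset hp']
    exact vk_eq.2 (EqK.symm (Fst.eq_single h.symm) (by simp))
  · have h' : ¬ ∃ p, (F w').Par p z' := by
      rintro ⟨p, hp⟩
      have : (F w').lab p ∈ {a | ∃ p, (F w).Par p z ∧ (F w).lab p = a} := e ▸ ⟨p, hp, rfl⟩
      obtain ⟨p', hp', _⟩ := this
      exact h ⟨p', hp'⟩
    have e1 : {x | (F w).Par x z} = ∅ := Set.eq_empty_of_forall_notMem fun x hx => h ⟨x, hx⟩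
    have e2 : {x | (F w').Par x z'} = ∅ := Set.eq_empty_of_forall_notMem fun x hx => h' ⟨x, hx⟩
    rw [e1, e2, Fst.ty_empty, Fst.ty_empty]

theorem e_def (D : FD F Def) (hs : ∀ v, Def fun w z => (F w).s k z = v) (v : VK Λ k) :
    Def fun w z => (F w).e k z = v := by
  refine D.invN (D.pair (pt_def (k := k) D) (D.pair (lsb_def D hs) (rsb_def D hs))) ?_
  rintro w z w' z' hz hz' e rfl
  simp only [Prod.mk.injEq] at e
  rw [Fst.e_eq hz, Fst.e_eq hz', e.1, e.2.1, e.2.2]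

theorem s_def (D : FD F Def) : ∀ (k : ℕ) (v : VK Λ k), Def fun w z => (F w).s k z = v := by
  intro k
  induction k with
  | zero =>
    intro v
    refine D.invN (A := Unit) (l := fun _ _ => ()) (fun a => defCongr D.H.tt (by simp)) ?_
    rintro w z w' z' - - - rfl
    exact vk_eq.2 ⟨by simp, by simp⟩
  | succ k hs =>
    intro v
    refine D.invN (l := fun w z => {a : VK Λ k × Λ × VK Λ k | ∃ y, LP (F w).Par ((F w).e k) id
      Set.univ z a.1 y ∧ ((F w).lab y = a.2.1 ∧ (F w).cf k y = a.2.2)}) (D.setd fun a =>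
      (engine D.H D.SP (VK.aper k) (fun w => (F w).e k) (e_def D hs) id Set.univ a.1 _
        (D.H.and _ _ (D.HL a.2.1) (cf_def D hs a.2.2))).1) ?_
    rintro w z w' z' hz hz' e rfl
    have key : ∀ w z w' z', z ≤ (F w).N → z' ≤ (F w').N →
        {a : VK Λ k × Λ × VK Λ k | ∃ y, LP (F w).Par ((F w).e k) id
          Set.univ z a.1 y ∧ ((F w).lab y = a.2.1 ∧ (F w).cf k y = a.2.2)} =
        {a : VK Λ k × Λ × VK Λ k | ∃ y, LP (F w').Par ((F w').e k) id
          Set.univ z' a.1 y ∧ ((F w').lab y = a.2.1 ∧ (F w').cf k y = a.2.2)} →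
        ∀ d ∈ (F w).sub z, ∃ d' ∈ (F w').sub z',
          EqK k ((F w).str ((F w).sub z) Fst.lef) ((F w').str ((F w').sub z') Fst.lef) [(d, d')] := by
      intro w z w' z' hz hz' e d hd
      obtain ⟨m, hm⟩ := Fst.par_path ((F w).e k) id hd
      have : (m, (F w).lab d, (F w).cf k d) ∈ {a : VK Λ k × Λ × VK Λ k | ∃ y, LP (F w').Par
        ((F w').e k) id Set.univ z' a.1 y ∧ ((F w').lab y = a.2.1 ∧ (F w').cf k y = a.2.2)} :=
        e ▸ ⟨d, hm, rfl, rfl⟩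
      obtain ⟨d', hm', h1, h2⟩ := this
      have hd' := Fst.LP.desc hm'
      refine ⟨d', hd', Fst.pt_eq (fun x hx => hd.trans hx) (fun x hx => hd'.trans hx) ?_ h1.symm
        h2.symm⟩
      rw [Fst.par_prod' hz hm, Fst.par_prod' hz' hm']
    refine vk_eq.2 ⟨⟨by simp, by simp⟩, key _ _ _ _ hz' hz e.symm, fun d hd => ?_⟩
    obtain ⟨d', hd', h⟩ := key _ _ _ _ hz hz' e d hd
    exact ⟨d', hd', h.symm (by simp)⟩

theorem forest_def (D : FD F Def) (k : ℕ) {P : W → ℕ → Prop}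
    (hP : ∀ w x w' x', x ≤ (F w).N → x' ≤ (F w').N →
      EqK k ((F w).str {x | x ≤ (F w).N} Fst.lef) ((F w').str {x | x ≤ (F w').N} Fst.lef)
        [(x, x')] → P w x → P w' x') : Def P := by
  have hs := s_def D k
  have hall : ∀ {w x}, x ≤ (F w).N → (F w).sub x ⊆ {x | x ≤ (F w).N} := fun hx y hy =>
    Fst.Desc.leN hy hx
  have hr : ∀ v, Def fun w z => (F w).ty k ({x | x ≤ (F w).N} \ (F w).sub z) ((F w).kap z) = v := by
    intro v
    refine D.dom _ _ ?_ (D.H.ex fun m0 => D.H.ex fun m => D.H.and _ _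
      (engine D.H D.SP (VK.aper k) (fun w => (F w).e k) (e_def D hs) id Set.univ m _
        (D.H.and _ _ (D.H.neg _ (D.SP.pred D.H D.H.tt)) (e_def D hs m0))).2
      (D.H.const (m0 * m = v)))
    intro w z hz
    simp only [and_true]
    have key : ∀ r m, LP (F w).Par ((F w).e k) id Set.univ r m z → (¬ ∃ p, (F w).Par p r) →
        (F w).ty k ({x | x ≤ (F w).N} \ (F w).sub z) ((F w).kap z) = (F w).e k r * m := by
      intro r m hm hr
      have hrN := (Fst.LP.desc hm).le'.trans hz
      rw [Fst.par_prod (hall hrN) hrN hm]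
      congr 1
      have : (F w).top r = {x | x ≤ (F w).N} := by
        ext x
        exact ⟨fun h => h.1, fun h => ⟨h, fun p hp => (hr ⟨p, hp⟩).elim⟩⟩
      rw [← this]; rfl
    constructor
    · rintro ⟨m0, m, ⟨r, hm, hr, rfl⟩, rfl⟩
      exact key r m hm hr
    · rintro rfl
      obtain ⟨r, h1, h2, h3⟩ := Fst.exists_root hz
      obtain ⟨m, hm⟩ := Fst.par_path ((F w).e k) id h3
      exact ⟨_, m, ⟨r, hm, h2, rfl⟩, (key r m hm h2).symm⟩
  refine D.invN (D.pair hr (D.pair D.HL (cf_def D hs))) ?_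
  intro w z w' z' hz hz' e
  simp only [Prod.mk.injEq] at e
  exact hP _ _ _ _ hz hz' (Fst.pt_eq (hall hz) (hall hz') e.1 e.2.1 e.2.2)

end FD
end OPLTheory

namespace OPLTheory
open Relation

theorem Body.lt' {pr : ℕ → ℕ → Option Prec} {k j : ℕ} (h : Body pr k j) : k < j :=
  Body.rec (motive_1 := fun _ _ _ => True) (motive_2 := fun k j _ => k < j)
    (motive_3 := fun _ _ _ => True) (fun _ _ _ _ _ _ => trivial) (fun h _ _ _ => h)
    (fun h _ _ _ _ h' => h.trans h') (fun _ => trivial) (fun _ _ => trivial) h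

section chains
variable (pr : ℕ → ℕ → Option Prec) (N : ℕ)

def Gp (i j : ℕ) : Prop := j ≤ N ∧ Gap pr i j

def LtL (i j : ℕ) : Prop := Gp pr N i j ∧ pr i j = some .lt
def EqL (i j : ℕ) : Prop := Gp pr N i j ∧ pr i j = some .eq
def PL (i j : ℕ) : Prop := Gp pr N i j ∧ (pr i j = some .lt ∨ pr i j = some .eq)
def UL (i j : ℕ) : Prop := Gp pr N i j ∧ (pr i j = some .gt ∨ pr i j = some .eq)
def Ctx (d i : ℕ) : Prop := ∃ k, LtL pr N i k ∧ ReflTransGen (EqL pr N) k d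
def StepG (j d i : ℕ) : Prop := d < j ∧ pr d j = some .gt ∧ Ctx pr N d i

variable {pr N}

theorem Body.iff {k j : ℕ} (hj : j ≤ N) : Body pr k j ↔
    ∃ d, ReflTransGen (EqL pr N) k d ∧ Gp pr N d j ∧ d < j ∧ pr d j = some .gt := by
  constructor
  · intro h
    refine Body.rec (motive_1 := fun _ _ _ => True) (motive_2 := fun k j _ => j ≤ N →
      ∃ d, ReflTransGen (EqL pr N) k d ∧ Gp pr N d j ∧ d < j ∧ pr d j = some .gt)
      (motive_3 := fun _ _ _ => True) (fun _ _ _ _ _ _ => trivial) ?_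
      ?_ (fun _ => trivial) (fun _ _ => trivial) h hj
    · intro k j h1 h2 h3 _ hj
      exact ⟨k, .refl, ⟨hj, h3⟩, h1, h2⟩
    · intro k k' j h1 h2 h3 h4 _ ih hj
      obtain ⟨d, h5, h6⟩ := ih hj
      exact ⟨d, .head ⟨⟨h4.lt'.le.trans hj, h3⟩, h2⟩ h5, h6⟩
  · rintro ⟨d, h1, h2, h3, h4⟩
    have glt : ∀ {a b}, Gp pr N a b → a < b := by
      intro a b h
      cases h.2 with
      | empty h => omega
      | chain h => cases h with | mk h1 _ _ h2 => exact h1.trans h2.lt'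
    induction h1 using ReflTransGen.head_induction_on with
    | refl => exact .last h3 h4 h2.2
    | head h _ ih => exact .step (glt h.1) h.2 h.1.2 ih

theorem Gp.lt {a b : ℕ} (h : Gp pr N a b) : a < b := by
  cases h.2 with
  | empty h => omega
  | chain h => cases h with | mk h1 _ _ h2 => exact h1.trans h2.lt'

theorem EqP.le {a b : ℕ} (h : ReflTransGen (EqL pr N) a b) : a ≤ b := by
  induction h with
  | refl => exact le_rfl
  | tail _ h ih => exact ih.trans h.1.lt.le

theorem Gp.dec {a b : ℕ} (h : Gp pr N a b) : b = a + 1 ∨ (Chain pr a b ∧ ∃ k d, LtL pr N a k ∧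
    ReflTransGen (EqL pr N) k d ∧ Gp pr N d b ∧ pr d b = some .gt) := by
  cases h.2 with
  | empty h => exact Or.inl h
  | chain h' =>
    refine Or.inr ⟨h', ?_⟩
    cases h' with
    | mk h1 h2 h3 h4 =>
      obtain ⟨d, h5, h6, _, h7⟩ := (Body.iff h.1).1 h4
      exact ⟨_, d, ⟨⟨h4.lt'.le.trans h.1, h3⟩, h2⟩, h5, h6, h7⟩

theorem Gp.mk' {a b k d : ℕ} (h1 : LtL pr N a k) (h2 : ReflTransGen (EqL pr N) k d)
    (h3 : Gp pr N d b) (h4 : pr d b = some .gt) : Gp pr N a b :=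
  ⟨h3.1, .chain (.mk h1.1.lt h1.2 h1.1.2 ((Body.iff h3.1).2 ⟨d, h2, h3, h3.lt, h4⟩))⟩

theorem PL.lt {a b : ℕ} (h : PL pr N a b) : a < b := h.1.lt
theorem LtL.pl {a b : ℕ} (h : LtL pr N a b) : PL pr N a b := ⟨h.1, Or.inl h.2⟩
theorem EqL.pl {a b : ℕ} (h : EqL pr N a b) : PL pr N a b := ⟨h.1, Or.inr h.2⟩

theorem Ctx.lt {d i : ℕ} (h : Ctx pr N d i) : i < d := by
  obtain ⟨k, h1, h2⟩ := h
  exact h1.1.lt.trans_le (EqP.le h2)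

theorem Gp.iff_step {j : ℕ} (hj : j + 1 ≤ N) {i : ℕ} :
    Gp pr N i (j + 1) ↔ ReflTransGen (StepG pr N (j + 1)) j i := by
  constructor
  · intro h
    have : ∀ n i, j + 1 - i ≤ n → Gp pr N i (j + 1) → ReflTransGen (StepG pr N (j + 1)) j i := by
      intro n
      induction n with
      | zero =>
        intro i hi h
        have := h.lt
        omega
      | succ n ih =>
        intro i hi h
        rcases h.dec with h | ⟨_, k, d, h1, h2, h3, h4⟩
        · cases h; exact .refl
        · have : Ctx pr N d i := ⟨k, h1, h2⟩
          have hl := this.lt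
          exact (ih d (by omega) h3).tail ⟨h3.lt, h4, this⟩
    exact this _ i le_rfl h
  · intro h
    induction h with
    | refl => exact ⟨hj, .empty rfl⟩
    | tail _ h ih =>
      obtain ⟨_, h1, k, h2, h3⟩ := h
      exact Gp.mk' h2 h3 ih h1

theorem Step.lt {j d i : ℕ} (h : StepG pr N j d i) : i < d := h.2.2.lt

theorem Steps.le {j d i : ℕ} (h : ReflTransGen (StepG pr N j) d i) : i ≤ d := by
  induction h with
  | refl => exact le_rfl
  | tail _ h ih => exact (Step.lt h).le.trans ih

theorem ctx_uniq {d : ℕ} (ih : ∀ c, c ≤ d → ∀ a b, PL pr N a c → PL pr N b c → a = b) {i i' : ℕ}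
    (h : Ctx pr N d i) (h' : Ctx pr N d i') : i = i' := by
  obtain ⟨k, h1, h2⟩ := h
  obtain ⟨k', h1', h2'⟩ := h'
  induction h2 with
  | refl =>
    cases h2' with
    | refl => exact ih _ le_rfl _ _ h1.pl h1'.pl
    | tail _ h3 =>
      cases ih _ le_rfl _ _ h1.pl h3.pl
      exact absurd (h1.2.symm.trans h3.2) (by simp)
  | tail h3 h4 ihh =>
    cases h2' with
    | refl =>
      cases ih _ le_rfl _ _ h1'.pl h4.pl
      exact absurd (h1'.2.symm.trans h4.2) (by simp)
    | tail h5 h6 =>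
      cases ih _ le_rfl _ _ h4.pl h6.pl
      exact ihh (fun c hc => ih c (hc.trans h4.1.lt.le)) h5

theorem gp_chain {b a p : ℕ} (ih : ∀ c, c < b → ∀ a b, PL pr N a c → PL pr N b c → a = b)
    (h : Gp pr N a b) (hp : PL pr N p b) : p ≤ a := by
  obtain ⟨j, rfl⟩ : ∃ j, b = j + 1 := ⟨b - 1, by have := h.lt; omega⟩
  have h1 := (Gp.iff_step h.1).1 h
  have h2 := (Gp.iff_step h.1).1 hp.1
  have hu : Relator.RightUnique (StepG pr N (j + 1)) := by
    intro d i i' h h'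
    exact ctx_uniq (fun c hc => ih c (lt_of_le_of_lt hc h.1)) h.2.2 h'.2.2
  rcases ReflTransGen.total_of_right_unique hu h1 h2 with h3 | h3
  · exact Steps.le h3
  · rcases ReflTransGen.cases_head h3 with rfl | ⟨c, hc, _⟩
    · exact le_rfl
    · rcases hp.2 with h4 | h4 <;> exact absurd (h4.symm.trans hc.2.1) (by simp)

theorem PL.uniq {c : ℕ} : ∀ {a b : ℕ}, PL pr N a c → PL pr N b c → a = b := by
  induction c using Nat.strong_induction_on with
  | _ c ih =>
  intro a b h1 h2
  have := fun c hc a b => ih c hc (a := a) (b := b)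
  exact le_antisymm (gp_chain this h2.1 h1) (gp_chain this h1.1 h2)

theorem Gp.par_le {a b p : ℕ} (h : Gp pr N a b) (hp : PL pr N p b) : p ≤ a :=
  gp_chain (fun _ _ _ _ => PL.uniq) h hp

theorem EqP.pl {a b : ℕ} (h : ReflTransGen (EqL pr N) a b) : ReflTransGen (PL pr N) a b :=
  ReflTransGen.mono (fun _ _ => EqL.pl) _ _ h

theorem eqp_int {n : ℕ} (ih : ∀ a b, b - a ≤ n → Gp pr N a b → ∀ c, a < c → c < b →
    ReflTransGen (PL pr N) a c) {k d : ℕ} (h : ReflTransGen (EqL pr N) k d) (hn : d - k ≤ n) :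
    ∀ c, k ≤ c → c ≤ d → ReflTransGen (PL pr N) k c := by
  induction h with
  | refl => intro c h1 h2; rw [le_antisymm h2 h1]
  | @tail e d h1 h2 ihh =>
    intro c h3 h4
    have := h2.1.lt
    have := EqP.le h1
    rcases le_or_gt c e with h | h
    · exact ihh (by omega) c h3 h
    · rcases h4.eq_or_lt with rfl | h4
      · exact (EqP.pl h1).tail h2.pl
      · exact (EqP.pl h1).trans (ih e d (by omega) h2.1 c h h4)

theorem Gp.int {a b c : ℕ} (h : Gp pr N a b) (h1 : a < c) (h2 : c < b) :
    ReflTransGen (PL pr N) a c := by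
  have : ∀ n a b, b - a ≤ n → Gp pr N a b → ∀ c, a < c → c < b → ReflTransGen (PL pr N) a c := by
    intro n
    induction n with
    | zero => intro a b h1 h2 c h3 h4; omega
    | succ n ih =>
      intro a b hn h c h1 h2
      rcases h.dec with h | ⟨_, k, d, h3, h4, h5, h6⟩
      · omega
      · have q1 := h3.1.lt
        have q2 := EqP.le h4
        have q3 := h5.lt
        rcases lt_trichotomy c k with h | rfl | h
        · exact ih a k (by omega) h3.1 c h1 h
        · exact .single h3.pl
        · refine .head h3.pl ?_
          rcases le_or_gt c d with h7 | h7
          · exact eqp_int ih h4 (by omega) c h.le h7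
          · exact (EqP.pl h4).trans (ih d b (by omega) h5 c h7 h2)
  exact this _ a b le_rfl h c h1 h2

def fst {Λ : Type} (pr : ℕ → ℕ → Option Prec) (N : ℕ) (lab : ℕ → Λ) : Fst Λ where
  N := N
  Par := PL pr N
  lab := lab
  lt := PL.lt
  le := fun h => h.1.1
  uniq := PL.uniq
  tr := fun h => h.1.int

abbrev FF (pr : ℕ → ℕ → Option Prec) (N : ℕ) : Fst Unit := fst pr N fun _ => ()
abbrev Ds (pr : ℕ → ℕ → Option Prec) (N : ℕ) (a b : ℕ) : Prop := (FF pr N).Desc a b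

theorem Gp.dec' {a b : ℕ} (h : Gp pr N a b) : b = a + 1 ∨ (Chain pr a b ∧ ∃ k, LtL pr N a k ∧
    k < b ∧ ∀ c, k ≤ c → c < b → Ds pr N k c) := by
  rcases h.dec with h | ⟨h0, k, d, h3, h4, h5, h6⟩
  · exact Or.inl h
  · refine Or.inr ⟨h0, k, h3, lt_of_le_of_lt (EqP.le h4) h5.lt, fun c h1 h2 => ?_⟩
    rcases le_or_gt c d with h7 | h7
    · exact Fst.Desc.int (F := FF pr N) (EqP.pl h4) h1 h7
    · exact (EqP.pl h4).trans (h5.int h7 h2)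

theorem eq_last {i c j : ℕ} (hc : EqL pr N i c) (h : Gp pr N i j) (hcj : c < j) : False := by
  induction j using Nat.strong_induction_on with
  | _ j ih =>
  rcases h.dec' with h | ⟨_, k, h1, h2, h3⟩
  · have := hc.1.lt; omega
  · rcases lt_trichotomy c k with h | rfl | h
    · exact ih k h2 h1.1 h
    · exact absurd (hc.2.symm.trans h1.2) (by simp)
    · obtain ⟨p, hp, h4⟩ := Fst.SD.par (F := FF pr N) ⟨h3 c h.le hcj, h.ne⟩
      have := Fst.Desc.le' (F := FF pr N) h4
      cases PL.uniq hc.pl hp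
      exact absurd h1.1.lt (not_lt.2 this)

theorem gt_ndesc {a b : ℕ} (h : Gp pr N a b) (hg : pr a b = some .gt) : ¬ Ds pr N a b := by
  intro hd
  obtain ⟨p, hp, h1⟩ := Fst.SD.par (F := FF pr N) ⟨hd, h.lt.ne⟩
  have h2 := Fst.Desc.le' (F := FF pr N) h1
  have h3 := h.par_le hp
  cases le_antisymm h2 h3
  rcases hp.2 with h4 | h4 <;> exact absurd (h4.symm.trans hg) (by simp)

theorem UL.uniq {a b b' : ℕ} (h : UL pr N a b) (h' : UL pr N a b') : b = b' := by
  have key : ∀ {b b'}, UL pr N a b → UL pr N a b' → b < b' → False := by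
    intro b b' h h' hl
    rcases h.2 with h1 | h1
    · exact gt_ndesc h.1 h1 (h'.1.int h.1.lt hl)
    · exact eq_last ⟨h.1, h1⟩ h'.1 hl
  rcases lt_trichotomy b b' with hl | e | hl
  · exact (key h h' hl).elim
  · exact e
  · exact (key h' h hl).elim

variable (pr N) in
def Cmp : Prop := ∀ i j, Gp pr N i j → (pr i j).isSome

theorem Cmp.tri (C : Cmp pr N) {i j : ℕ} (h : Gp pr N i j) :
    PL pr N i j ∨ pr i j = some .gt := by
  have := C i j h
  cases e : pr i j with
  | none => simp [e] at this
  | some x => cases x <;> simp [PL, h, e]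

variable (pr N) in
def HasEq (i : ℕ) : Prop := ∃ c, EqL pr N i c

theorem gap_of {i j : ℕ} (C : Cmp pr N) (hij : i < j) (hj : j ≤ N) (hd : ¬ Ds pr N i j)
    (hin : ∀ x, i < x → x < j → Ds pr N i x) (he : ¬ HasEq pr N i) :
    Gp pr N i j ∧ pr i j = some .gt := by
  have climb : ∀ d, Ds pr N i d → d ≠ i → ∃ q, Ctx pr N d q ∧ Ds pr N i q := by
    intro d
    induction d using Nat.strong_induction_on with
    | _ d ih =>
    intro h1 h2
    obtain ⟨p, hp, h3⟩ := Fst.SD.par (F := FF pr N) ⟨h1, h2.symm⟩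
    rcases hp.2 with h4 | h4
    · exact ⟨p, ⟨d, ⟨hp.1, h4⟩, .refl⟩, h3⟩
    · obtain ⟨q, ⟨k, hk, hk'⟩, hq⟩ := ih p hp.1.lt h3 (by rintro rfl; exact he ⟨d, hp.1, h4⟩)
      exact ⟨q, ⟨k, hk, hk'.tail ⟨hp.1, h4⟩⟩, hq⟩
  have main : ∀ d, Ds pr N i d → Gp pr N d j → Gp pr N i j ∧ pr i j = some .gt := by
    intro d
    induction d using Nat.strong_induction_on with
    | _ d ih =>
    intro h1 h2
    have hg : pr d j = some .gt := by
      rcases C.tri h2 with h | h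
      · exact absurd (h1.tail h) hd
      · exact h
    by_cases hdi : d = i
    · subst hdi; exact ⟨h2, hg⟩
    · obtain ⟨q, hq, h3⟩ := climb d h1 hdi
      have hl := hq.lt
      obtain ⟨k, h4, h5⟩ := hq
      exact ih q hl h3 (Gp.mk' h4 h5 h2 hg)
  refine main (j - 1) ?_ ⟨hj, .empty (by omega)⟩
  rcases (show i = j - 1 ∨ i < j - 1 by omega) with h | h
  · rw [← h]
  · exact hin _ h (by omega)

theorem gp_iff (C : Cmp pr N) {i j : ℕ} : Gp pr N i j ↔ PL pr N i j ∨
    (i < j ∧ j ≤ N ∧ ¬ Ds pr N i j ∧ (∀ x, i < x → x < j → Ds pr N i x) ∧ ¬ HasEq pr N i) := by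
  constructor
  · intro h
    rcases C.tri h with h1 | h1
    · exact Or.inl h1
    · refine Or.inr ⟨h.lt, h.1, gt_ndesc h h1, fun x => h.int, ?_⟩
      rintro ⟨c, hc⟩
      rcases lt_trichotomy c j with hl | rfl | hl
      · exact eq_last hc h hl
      · exact absurd (hc.2.symm.trans h1) (by simp)
      · exact gt_ndesc h h1 (hc.1.int h.lt hl)
  · rintro (h | ⟨h1, h2, h3, h4, h5⟩)
    · exact h.1
    · exact (gap_of C h1 h2 h3 h4 h5).1

theorem first_lt {h j : ℕ} (hg : Gp pr N h j) (hj : j ≠ h + 1) : LtL pr N h (h + 1) := by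
  induction j using Nat.strong_induction_on with
  | _ j ih =>
  rcases hg.dec' with h1 | ⟨_, k, h1, h2, h3⟩
  · exact absurd h1 hj
  · by_cases hk : k = h + 1
    · rw [hk] at h1; exact h1
    · exact ih k h2 h1.1 hk

variable (pr N) in
def Rt (i : ℕ) : Prop := ¬ ∃ p, PL pr N p i

theorem root_step (C : Cmp pr N) {a t : ℕ} (hat : a < t) (ht : t ≤ N) (hr : Rt pr N t) :
    ∃ b, b ≤ t ∧ UL pr N a b := by
  have hnd : ¬ Ds pr N a t := by
    intro h
    obtain ⟨p, hp, _⟩ := Fst.SD.par (F := FF pr N) ⟨h, hat.ne⟩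
    exact hr ⟨p, hp⟩
  by_cases he : HasEq pr N a
  · obtain ⟨b, hb⟩ := he
    refine ⟨b, ?_, hb.1, Or.inr hb.2⟩
    by_contra hl
    exact hnd (Fst.Desc.int (F := FF pr N) (.single hb.pl) hat.le (not_le.1 hl).le)
  · classical
    have hex : ∃ x, a < x ∧ ¬ Ds pr N a x := ⟨t, hat, hnd⟩
    have h1 := Nat.find_spec hex
    have h2 : Nat.find hex ≤ t := Nat.find_min' hex ⟨hat, hnd⟩
    have := gap_of C h1.1 (h2.trans ht) h1.2 (fun x hx hx' => by
      by_contra hn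
      exact Nat.find_min hex hx' ⟨hx, hn⟩) he
    exact ⟨_, h2, this.1, Or.inl this.2⟩

theorem root_path (C : Cmp pr N) {φ : ℕ → Prop} {t : ℕ} (ht : t ≤ N) (hr : Rt pr N t) (a : ℕ)
    (hat : a ≤ t) : (∀ c, Rt pr N c → a ≤ c → c < t → φ c) →
    ReflTransGen (fun a b => (¬ Rt pr N a ∨ φ a) ∧ UL pr N a b) a t := by
  obtain ⟨n, hn⟩ : ∃ n, n = t - a := ⟨_, rfl⟩
  induction n using Nat.strong_induction_on generalizing a with
  | _ n ih =>
  intro h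
  rcases hat.eq_or_lt with rfl | hat
  · exact .refl
  · obtain ⟨b, hb, hu⟩ := root_step C hat ht hr
    have := hu.1.lt
    refine .head ⟨?_, hu⟩ (ih (t - b) (by omega) b hb rfl fun c h1 h2 h3 => h c h1 (by omega) h3)
    by_cases hra : Rt pr N a
    · exact Or.inr (h a hra le_rfl hat)
    · exact Or.inl hra

theorem root_str (C : Cmp pr N) {φ : ℕ → Prop} {z t : ℕ} (ht : t ≤ N) (hr : Rt pr N t) :
    StrU (UL pr N) (fun a => ¬ Rt pr N a ∨ φ a) z t ↔
      z < t ∧ ∀ c, Rt pr N c → z < c → c < t → φ c := by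
  have skip : ∀ {a b c}, UL pr N a b → a < c → c < b → ¬ Rt pr N c := by
    intro a b c h h1 h2 h3
    obtain ⟨p, hp, _⟩ := Fst.SD.par (F := FF pr N) ⟨h.1.int h1 h2, h1.ne⟩
    exact h3 ⟨p, hp⟩
  constructor
  · rintro ⟨y, hy, p⟩
    have : y ≤ t ∧ ∀ c, Rt pr N c → y ≤ c → c < t → φ c := by
      clear hy hr
      induction p using ReflTransGen.head_induction_on with
      | refl => exact ⟨le_rfl, fun c _ h1 h2 => absurd h1 (not_le.2 h2)⟩
      | @head a b h _ ih =>
        refine ⟨h.2.1.lt.le.trans ih.1, fun c hc h1 h2 => ?_⟩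
        rcases h1.eq_or_lt with rfl | h1
        · exact h.1.resolve_left (fun h => h hc)
        · refine ih.2 c hc ?_ h2
          by_contra hl
          exact skip h.2 h1 (not_le.1 hl) hc
    refine ⟨hy.1.lt.trans_le this.1, fun c hc h1 h2 => this.2 c hc ?_ h2⟩
    by_contra hl
    exact skip hy h1 (not_le.1 hl) hc
  · rintro ⟨h1, h2⟩
    obtain ⟨b, hb, hu⟩ := root_step C h1 ht hr
    exact ⟨b, hu, root_path C ht hr b hb fun c hc h3 => h2 c hc (hu.1.lt.trans_le h3)⟩

end chains
end OPLTheory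

namespace OPLTheory
open Relation

theorem path_rtg {φ ψ : ℕ → Prop} {step : ℕ → ℕ → Prop} {i j : ℕ} :
    (∃ l : List ℕ, (l.head? = some i ∧ l.getLast? = some j ∧ l.Chain' step) ∧
      (∀ p ∈ l.dropLast, φ p) ∧ ∀ p ∈ l.tail, ψ p) ↔
    ReflTransGen (fun a b => φ a ∧ ψ b ∧ step a b) i j := by
  constructor
  · rintro ⟨l, ⟨h1, h2, h3⟩, h4, h5⟩
    induction l generalizing i with
    | nil => simp at h1
    | cons a l ih =>
      obtain rfl : a = i := by simpa using h1
      cases l with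
      | nil =>
        obtain rfl : a = j := by simpa using h2
        exact .refl
      | cons b l =>
        have h3' := List.isChain_cons_cons.1 h3
        refine .head ⟨h4 a (by simp), h5 b (by simp), h3'.1⟩ (ih rfl (by simpa using h2) h3'.2 ?_ ?_)
        · intro p hp; exact h4 p (by simp [hp])
        · intro p hp; exact h5 p (by simp at hp; simp [hp])
  · intro h
    induction h using ReflTransGen.head_induction_on with
    | refl => exact ⟨[j], by simp [List.Chain'], by simp, by simp⟩
    | @head a b h1 h2 ih =>
      obtain ⟨l, ⟨h3, h4, h5⟩, h6, h7⟩ := ih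
      cases l with
      | nil => simp at h3
      | cons c l =>
        obtain rfl : c = b := by simpa using h3
        refine ⟨a :: c :: l, ⟨rfl, by simpa using h4, List.isChain_cons_cons.2 ⟨h1.2.2, h5⟩⟩, ?_, ?_⟩
        · intro p hp
          rw [List.dropLast_cons_of_ne_nil (by simp)] at hp
          rcases List.mem_cons.1 hp with rfl | hp
          · exact h1.1
          · exact h6 p hp
        · intro p hp
          rcases List.mem_cons.1 hp with rfl | hp
          · exact h1.2.1
          · exact h7 p hp

theorem path_rtg1 {φ : ℕ → Prop} {step : ℕ → ℕ → Prop} {i j : ℕ} {Q : Prop} :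
    (∃ l : List ℕ, IsPath step l i j ∧ Q ∧ ∀ p ∈ l.dropLast, φ p) ↔
    ReflTransGen (fun a b => φ a ∧ True ∧ step a b) i j ∧ Q := by
  rw [← path_rtg]; unfold IsPath; simp; tauto

theorem path_rtg2 {φ : ℕ → Prop} {step : ℕ → ℕ → Prop} {i j : ℕ} {Q : Prop} :
    (∃ l : List ℕ, IsPath step l i j ∧ Q ∧ ∀ p ∈ l.tail, φ p) ↔
    ReflTransGen (fun a b => True ∧ φ b ∧ step a b) i j ∧ Q := by
  rw [← path_rtg]; unfold IsPath; simp; tauto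

theorem rtg_le {R : ℕ → ℕ → Prop} (hR : ∀ a b, R a b → a < b) {i j : ℕ}
    (h : ReflTransGen R i j) : i ≤ j := by
  induction h with
  | refl => exact le_rfl
  | tail _ h ih => exact ih.trans (hR _ _ h).le

theorem hp_iff {A B φ ψ : ℕ → Prop} (hAB : ∀ k, A k → B k) {i j : ℕ} :
    (∃ l : List ℕ, (l ≠ [] ∧ l.Chain' (· < ·) ∧ (∀ p ∈ l, A p) ∧
      l.Chain' (fun a b => ¬ ∃ k, a < k ∧ k < b ∧ B k)) ∧ l.head? = some i ∧ l.getLast? = some j ∧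
      (∀ p ∈ l.dropLast, φ p) ∧ ∀ p ∈ l.tail, ψ p) ↔
    A i ∧ A j ∧ i ≤ j ∧ (∀ k, i < k → k < j → B k → A k) ∧ (∀ k, A k → i ≤ k → k < j → φ k) ∧
      ∀ k, A k → i < k → k ≤ j → ψ k := by
  constructor
  · rintro ⟨l, ⟨h0, h1, h2, h3⟩, h4, h5, h6, h7⟩
    have hp : ReflTransGen (fun a b => (A a ∧ φ a) ∧ (A b ∧ ψ b) ∧ (a < b ∧
        ¬ ∃ k, a < k ∧ k < b ∧ B k)) i j := by
      refine path_rtg.1 ⟨l, ⟨h4, h5, ?_⟩, fun p hp => ⟨h2 p (List.mem_of_mem_dropLast hp), h6 p hp⟩,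
        fun p hp => ⟨h2 p (List.mem_of_mem_tail hp), h7 p hp⟩⟩
      clear h0 h2 h4 h5 h6 h7
      induction l with
      | nil => exact List.isChain_nil
      | cons a l ih =>
        cases l with
        | nil => exact List.isChain_singleton _
        | cons b l =>
          have h1' := List.isChain_cons_cons.1 h1
          have h3' := List.isChain_cons_cons.1 h3
          exact List.isChain_cons_cons.2 ⟨⟨h1'.1, h3'.1⟩, ih h1'.2 h3'.2⟩
    have hi : A i := h2 i (List.mem_of_mem_head? h4)
    have hj : A j := h2 j (List.mem_of_mem_getLast? h5)
    refine ⟨hi, hj, rtg_le (fun a b h => h.2.2.1) hp, ?_⟩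
    clear h0 h1 h2 h3 h4 h5 h6 h7
    induction hp with
    | refl => exact ⟨by omega, by omega, by omega⟩
    | @tail b c h1 h2 ih =>
      obtain ⟨i1, i2, i3⟩ := ih h2.1.1
      obtain ⟨⟨a1, a2⟩, ⟨a3, a4⟩, a5, a6⟩ := h2
      refine ⟨fun k h3 h4 h5 => ?_, fun k h3 h4 h5 => ?_, fun k h3 h4 h5 => ?_⟩
      · rcases lt_trichotomy k b with h | rfl | h
        · exact i1 k h3 h h5
        · exact a1
        · exact (a6 ⟨k, h, h4, h5⟩).elim
      · rcases lt_trichotomy k b with h | rfl | h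
        · exact i2 k h3 h4 h
        · exact a2
        · exact (a6 ⟨k, h, h5, hAB k h3⟩).elim
      · rcases le_or_gt k b with h | h
        · exact i3 k h3 h4 h
        · rcases h5.eq_or_lt with rfl | h5
          · exact a4
          · exact (a6 ⟨k, h, h5, hAB k h3⟩).elim
  · rintro ⟨hi, hj, hij, h1, h2, h3⟩
    induction hn : j - i using Nat.strong_induction_on generalizing i with
    | _ n ih =>
    rcases hij.eq_or_lt with rfl | hij
    · exact ⟨[i], by simpa [List.Chain'] using hi, by simp⟩
    · classical
      have hex : ∃ k, i < k ∧ B k := ⟨j, hij, hAB j hj⟩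
      obtain ⟨hk1, hk2⟩ := Nat.find_spec hex
      have hkm := fun m (hm : m < Nat.find hex) => Nat.find_min hex hm
      generalize Nat.find hex = k at *
      have hkj : k ≤ j := by
        by_contra hc
        exact hkm j (by omega) ⟨hij, hAB j hj⟩
      have hk : A k := by
        rcases hkj.eq_or_lt with rfl | h
        · exact hj
        · exact h1 k hk1 h hk2
      obtain ⟨l, ⟨l0, l1, l2, l3⟩, l4, l5, l6, l7⟩ := ih (j - k) (by omega) hk hkj
        (fun m h4 h5 => h1 m (by omega) h5) (fun m h4 h5 h6 => h2 m h4 (by omega) h6)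
        (fun m h4 h5 h6 => h3 m h4 (by omega) h6) rfl
      cases l with
      | nil => simp at l4
      | cons c l =>
        obtain rfl : c = k := by simpa using l4
        refine ⟨i :: c :: l, ⟨by simp, List.isChain_cons_cons.2 ⟨hk1, l1⟩, ?_,
          List.isChain_cons_cons.2 ⟨?_, l3⟩⟩, rfl, by simpa using l5, ?_, ?_⟩
        · intro p hp
          rcases List.mem_cons.1 hp with rfl | hp
          · exact hi
          · exact l2 p hp
        · rintro ⟨m, m1, m2, m3⟩
          exact hkm m m2 ⟨m1, m3⟩
        · intro p hp
          rw [List.dropLast_cons_of_ne_nil (by simp)] at hp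
          rcases List.mem_cons.1 hp with rfl | hp
          · exact h2 p hi le_rfl hij
          · exact l6 p hp
        · intro p hp
          rcases List.mem_cons.1 hp with rfl | hp
          · exact h3 p hk hk1 hkj
          · exact l7 p hp

theorem Fst.ns_str {Λ : Type} {F : Fst Λ} {φ : ℕ → Prop} {z t : ℕ} : StrU F.NS φ z t ↔
    F.Sib z t ∧ z < t ∧ ∀ c, F.Sib z c → z < c → c < t → φ c := by
  constructor
  · rintro ⟨y, h1, h2⟩
    induction h2 with
    | refl => exact ⟨h1.1, h1.2.1, fun c h h' h'' => (h1.2.2 c h' h'' h).elim⟩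
    | @tail b c h3 h4 ih =>
      obtain ⟨i1, i2, i3⟩ := ih
      obtain ⟨a1, a2, a3, a4⟩ := h4
      refine ⟨Sib.trans i1 a2, i2.trans a3, fun d d1 d2 d3 => ?_⟩
      rcases lt_trichotomy d b with h | rfl | h
      · exact i3 d d1 d2 h
      · exact a1
      · exact (a4 d h d3 (Sib.trans i1.symm d1)).elim
  · rintro ⟨h1, h2, h3⟩
    induction t using Nat.strong_induction_on with
    | _ t ih =>
    obtain ⟨p, hp, hzp⟩ := exists_pred h1 h2
    rcases hzp.eq_or_lt with rfl | hzp
    · exact ⟨t, hp, .refl⟩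
    · have hs := Sib.trans h1 hp.1.symm
      obtain ⟨y, y1, y2⟩ := ih p hp.2.1 hs hzp fun c c1 c2 c3 => h3 c c1 c2 (c3.trans hp.2.1)
      exact ⟨y, y1, y2.tail ⟨h3 p hs hzp hp.2.1, hp⟩⟩

end OPLTheory

namespace OPLTheory
open Relation

section gs
variable {pr : ℕ → ℕ → Option Prec} {N : ℕ}

def GS (pr : ℕ → ℕ → Option Prec) (N : ℕ) (q : ℕ → ℕ → Prop) (bnd a b : ℕ) : Prop :=
  (({h | h ≤ bnd ∧ (Gp pr N a h ∧ h ≠ a + 1) ∧ q a h} : Set ℕ).Nonempty ∧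
    b = sSup {h | h ≤ bnd ∧ (Gp pr N a h ∧ h ≠ a + 1) ∧ q a h}) ∨
  (¬ ({h | h ≤ bnd ∧ (Gp pr N a h ∧ h ≠ a + 1) ∧ q a h} : Set ℕ).Nonempty ∧ b = a + 1 ∧ q a b)

theorem GS.link {q : ℕ → ℕ → Prop} {bnd a b : ℕ} (h : GS pr N q bnd a b) :
    a < b ∧ (b ≤ N → Gp pr N a b ∧ q a b) := by
  rcases h with ⟨h1, h2⟩ | ⟨_, h2, h3⟩
  · have := Nat.sSup_mem h1 ⟨bnd, fun x hx => hx.1⟩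
    rw [← h2] at this
    exact ⟨this.2.1.1.lt, fun _ => ⟨this.2.1.1, this.2.2⟩⟩
  · exact ⟨by omega, fun hb => ⟨⟨hb, .empty h2⟩, h3⟩⟩

theorem gs_path {q : ℕ → ℕ → Prop} {j : ℕ} (hj : j ≤ N)
    (K : ∀ a b h, (Gp pr N a b ∧ q a b) → ReflTransGen (fun a b => Gp pr N a b ∧ q a b) b j →
      h ≤ j → b < h → ¬ (Gp pr N a h ∧ q a h)) {φ ψ : ℕ → Prop} {i : ℕ} :
    ReflTransGen (fun a b => φ a ∧ ψ b ∧ GS pr N q j a b) i j ↔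
    ReflTransGen (fun a b => φ a ∧ ψ b ∧ (Gp pr N a b ∧ q a b)) i j := by
  constructor
  · intro h
    induction h using ReflTransGen.head_induction_on with
    | refl => exact .refl
    | head h1 h2 ih =>
      have := rtg_le (fun a b (h : _ ∧ _ ∧ GS pr N q j a b) => h.2.2.link.1) h2
      exact .head ⟨h1.1, h1.2.1, h1.2.2.link.2 (this.trans hj)⟩ ih
  · intro h
    induction h using ReflTransGen.head_induction_on with
    | refl => exact .refl
    | @head a b h1 h2 ih =>
      refine .head ⟨h1.1, h1.2.1, ?_⟩ ih
      have hbj := rtg_le (fun a b (h : _ ∧ _ ∧ GS pr N q j a b) => h.2.2.link.1) ih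
      have K' := fun h => K a b h h1.2.2 (ReflTransGen.mono (fun a b h => h.2.2) _ _ h2)
      have hg : IsGreatest {h | h ≤ j ∧ (Gp pr N a h ∧ h ≠ a + 1) ∧ q a h} b ∨
          (¬ ({h | h ≤ j ∧ (Gp pr N a h ∧ h ≠ a + 1) ∧ q a h} : Set ℕ).Nonempty ∧ b = a + 1) := by
        by_cases hb : b = a + 1
        · refine Or.inr ⟨?_, hb⟩
          rintro ⟨h, x1, ⟨x2, x3⟩, x4⟩
          have := x2.lt
          exact K' h x1 (by omega) ⟨x2, x4⟩
        · refine Or.inl ⟨⟨hbj, ⟨h1.2.2.1, hb⟩, h1.2.2.2⟩, ?_⟩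
          rintro h ⟨x1, ⟨x2, x3⟩, x4⟩
          by_contra hc
          exact K' h x1 (by omega) ⟨x2, x4⟩
      rcases hg with hg | ⟨h3, h4⟩
      · exact Or.inl ⟨⟨b, hg.1⟩, hg.csSup_eq.symm⟩
      · exact Or.inr ⟨h3, h4, h1.2.2.2⟩

theorem k_dn {j : ℕ} (a b h : ℕ) (h1 : PL pr N a b) (h2 : ReflTransGen (PL pr N) b j)
    (h3 : h ≤ j) (h4 : b < h) : ¬ PL pr N a h := by
  intro h5
  have hs : (FF pr N).Sib b h := ⟨h1.1.1, h5.1.1, fun p =>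
    ⟨fun hp => PL.uniq h1 hp ▸ h5, fun hp => PL.uniq h5 hp ▸ h1⟩⟩
  have hd : (FF pr N).Desc b j := h2
  have := hs.eq (hd.int h4.le h3)
  omega

theorem k_up {j : ℕ} (a b h : ℕ) (h1 : UL pr N a b) (_ : ReflTransGen (UL pr N) b j)
    (_ : h ≤ j) (h4 : b < h) : ¬ UL pr N a h := by
  intro h5
  have := UL.uniq h1 h5
  omega

end gs

section defs
variable {AP : Type} (M : OPM (Set AP))

theorem chi_iff (w : OPWord AP) {i j : ℕ} :
    w.chi M i j ↔ Gp (w.prec M) (w.n + 1) i j ∧ j ≠ i + 1 := by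
  constructor
  · rintro ⟨h1, h2, h3⟩
    exact ⟨⟨h2, .chain h3⟩, by omega⟩
  · rintro ⟨h, h2⟩
    have := h.lt
    refine ⟨by omega, h.1, ?_⟩
    rcases h.2 with h | h
    · omega
    · exact h

theorem cmp_of {w : OPWord AP} (h : w.Compatible M) : Cmp (w.prec M) (w.n + 1) := by
  rintro i j ⟨h1, h2⟩
  rcases h2 with h2 | h2
  · subst h2; exact h.1 i (by omega)
  · exact h.2 i j h1 h2

theorem dsp_gs (w : OPWord AP) {j a b : ℕ} : (w.frame M).dspStep j a b ↔
    GS (w.prec M) (w.n + 1) (fun a b => w.prec M a b = some .lt ∨ w.prec M a b = some .eq) j a b := by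
  unfold GS; simp only [← chi_iff]; rfl

theorem usp_gs (w : OPWord AP) {j a b : ℕ} : (w.frame M).uspStep j a b ↔
    GS (w.prec M) (w.n + 1) (fun a b => w.prec M a b = some .gt ∨ w.prec M a b = some .eq) j a b := by
  unfold GS; simp only [← chi_iff]; rfl

theorem dsp_path (w : OPWord AP) {φ ψ : ℕ → Prop} {i j : ℕ} (hj : j ≤ w.n + 1) :
    ReflTransGen (fun a b => φ a ∧ ψ b ∧ (w.frame M).dspStep j a b) i j ↔
    ReflTransGen (fun a b => φ a ∧ ψ b ∧ PL (w.prec M) (w.n + 1) a b) i j := by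
  simp only [dsp_gs]; exact gs_path hj k_dn

theorem usp_path (w : OPWord AP) {φ ψ : ℕ → Prop} {i j : ℕ} (hj : j ≤ w.n + 1) :
    ReflTransGen (fun a b => φ a ∧ ψ b ∧ (w.frame M).uspStep j a b) i j ↔
    ReflTransGen (fun a b => φ a ∧ ψ b ∧ UL (w.prec M) (w.n + 1) a b) i j := by
  simp only [usp_gs]; exact gs_path hj k_up

theorem sat_untilD (w : OPWord AP) {φ ψ : POTL AP} {i : ℕ} (hi : i ≤ w.n + 1) :
    POTL.Sat (w.frame M) (.untilD φ ψ) i ↔ ∃ j, ReflTransGen (fun a b =>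
      POTL.Sat (w.frame M) φ a ∧ PL (w.prec M) (w.n + 1) a b) i j ∧ POTL.Sat (w.frame M) ψ j := by
  simp only [POTL.Sat, path_rtg1]
  refine exists_congr fun j => ⟨fun ⟨_, h1, h2, h3⟩ => ?_, fun ⟨h1, h2⟩ => ?_⟩
  · rw [dsp_path M w h1] at h2
    exact ⟨by simpa using h2, h3⟩
  · have hd : (FF (w.prec M) (w.n + 1)).Desc i j := ReflTransGen.mono (fun a b h => h.2) _ _ h1
    have hj : j ≤ w.n + 1 := hd.leN hi
    refine ⟨hd.le', hj, ?_, h2⟩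
    rw [dsp_path M w hj]
    simpa using h1

theorem sat_sinceD (w : OPWord AP) {φ ψ : POTL AP} {i : ℕ} (hi : i ≤ w.n + 1) :
    POTL.Sat (w.frame M) (.sinceD φ ψ) i ↔ ∃ j, ReflTransGen (fun a b =>
      POTL.Sat (w.frame M) φ b ∧ PL (w.prec M) (w.n + 1) a b) j i ∧ POTL.Sat (w.frame M) ψ j := by
  simp only [POTL.Sat, path_rtg2]
  refine exists_congr fun j => ?_
  have e := dsp_path M w (φ := fun _ => True) (ψ := POTL.Sat (w.frame M) φ) (i := j) hi
  rw [e]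
  simp only [true_and]
  exact ⟨fun h => h.2, fun h => ⟨rtg_le (fun a b h => h.2.lt) h.1, h⟩⟩

theorem sat_untilU (w : OPWord AP) {φ ψ : POTL AP} {i : ℕ} (hi : i ≤ w.n + 1) :
    POTL.Sat (w.frame M) (.untilU φ ψ) i ↔ ∃ j, ReflTransGen (fun a b =>
      POTL.Sat (w.frame M) φ a ∧ UL (w.prec M) (w.n + 1) a b) i j ∧ POTL.Sat (w.frame M) ψ j := by
  simp only [POTL.Sat, path_rtg1]
  refine exists_congr fun j => ⟨fun ⟨_, h1, h2, h3⟩ => ?_, fun ⟨h1, h2⟩ => ?_⟩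
  · rw [usp_path M w h1] at h2
    exact ⟨by simpa using h2, h3⟩
  · have hj : j ≤ w.n + 1 := by
      rcases h1.cases_tail with h | ⟨_, _, h⟩
      · exact h ▸ hi
      · exact h.2.1.1
    refine ⟨rtg_le (fun a b h => h.2.1.lt) h1, hj, ?_, h2⟩
    rw [usp_path M w hj]
    simpa using h1

theorem sat_sinceU (w : OPWord AP) {φ ψ : POTL AP} {i : ℕ} (hi : i ≤ w.n + 1) :
    POTL.Sat (w.frame M) (.sinceU φ ψ) i ↔ ∃ j, ReflTransGen (fun a b =>
      POTL.Sat (w.frame M) φ b ∧ UL (w.prec M) (w.n + 1) a b) j i ∧ POTL.Sat (w.frame M) ψ j := by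
  simp only [POTL.Sat, path_rtg2]
  refine exists_congr fun j => ?_
  have e := usp_path M w (φ := fun _ => True) (ψ := POTL.Sat (w.frame M) φ) (i := j) hi
  rw [e]
  simp only [true_and]
  exact ⟨fun h => h.2, fun h => ⟨rtg_le (fun a b h => h.2.1.lt) h.1, h⟩⟩

def Ac (pr : ℕ → ℕ → Option Prec) (N h k : ℕ) : Prop := LtL pr N h k ∧ k ≠ h + 1

theorem ac_iff (w : OPWord AP) {h k : ℕ} : (w.frame M).chi h k ∧ (w.frame M).ltp h k ↔
    Ac (w.prec M) (w.n + 1) h k := by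
  show w.chi M h k ∧ w.prec M h k = some .lt ↔ _
  rw [chi_iff]; unfold Ac LtL; tauto

theorem ac_chi {w : OPWord AP} (hw : w.Compatible M) {h j k : ℕ}
    (hj : Ac (w.prec M) (w.n + 1) h j) (hk : w.chi M h k) (hkj : k < j) :
    Ac (w.prec M) (w.n + 1) h k := by
  rw [chi_iff] at hk
  refine ⟨?_, hk.2⟩
  rcases (cmp_of M hw).tri hk.1 with ⟨h1, h2 | h2⟩ | h1
  · exact ⟨h1, h2⟩
  · exact (eq_last ⟨h1, h2⟩ hj.1.1 hkj).elim
  · have hd : Ds (w.prec M) (w.n + 1) h k := Fst.Desc.int (F := FF (w.prec M) (w.n + 1))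
      (.single hj.1.pl) hk.1.lt.le hkj.le
    exact (gt_ndesc hk.1 h1 hd).elim

theorem sat_hnextU (w : OPWord AP) {φ : POTL AP} {i : ℕ} :
    POTL.Sat (w.frame M) (.hnextU φ) i ↔ ∃ h k, Ac (w.prec M) (w.n + 1) h i ∧
      Ac (w.prec M) (w.n + 1) h k ∧ i < k ∧ (∀ c, Ac (w.prec M) (w.n + 1) h c → i < c → k ≤ c) ∧
      POTL.Sat (w.frame M) φ k := by
  simp only [POTL.Sat, ac_iff]
  refine exists_congr fun h => ⟨?_, ?_⟩
  · rintro ⟨_, h1, h2, ⟨k, h3, h4⟩, h5⟩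
    have hm := Nat.sInf_mem (s := {k | i < k ∧ Ac (w.prec M) (w.n + 1) h k}) ⟨k, h3, h4⟩
    exact ⟨_, (ac_iff M w).1 ⟨h1, h2⟩, hm.2, hm.1, fun c h6 h7 => Nat.sInf_le ⟨h7, h6⟩, h5⟩
  · rintro ⟨k, h1, h2, h3, h4, h5⟩
    have : IsLeast {k | i < k ∧ Ac (w.prec M) (w.n + 1) h k} k := ⟨⟨h3, h2⟩, fun c hc => h4 c hc.2 hc.1⟩
    refine ⟨h1.1.1.lt, ((ac_iff M w).2 h1).1, ((ac_iff M w).2 h1).2, ⟨k, h3, h2⟩, ?_⟩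
    rwa [this.csInf_eq]

theorem sat_hbackU (w : OPWord AP) {φ : POTL AP} {i : ℕ} :
    POTL.Sat (w.frame M) (.hbackU φ) i ↔ ∃ h k, Ac (w.prec M) (w.n + 1) h i ∧
      Ac (w.prec M) (w.n + 1) h k ∧ k < i ∧ (∀ c, Ac (w.prec M) (w.n + 1) h c → c < i → c ≤ k) ∧
      POTL.Sat (w.frame M) φ k := by
  simp only [POTL.Sat, ac_iff]
  refine exists_congr fun h => ⟨?_, ?_⟩
  · rintro ⟨_, h1, h2, ⟨k, h3, h4⟩, h5⟩
    have hb : BddAbove {k | k < i ∧ Ac (w.prec M) (w.n + 1) h k} := ⟨i, fun x hx => hx.1.le⟩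
    have hm := Nat.sSup_mem (s := {k | k < i ∧ Ac (w.prec M) (w.n + 1) h k}) ⟨k, h3, h4⟩ hb
    exact ⟨_, (ac_iff M w).1 ⟨h1, h2⟩, hm.2, hm.1, fun c h6 h7 => le_csSup hb ⟨h7, h6⟩, h5⟩
  · rintro ⟨k, h1, h2, h3, h4, h5⟩
    have : IsGreatest {k | k < i ∧ Ac (w.prec M) (w.n + 1) h k} k := ⟨⟨h3, h2⟩, fun c hc => h4 c hc.2 hc.1⟩
    refine ⟨h1.1.1.lt, ((ac_iff M w).2 h1).1, ((ac_iff M w).2 h1).2, ⟨k, h3, h2⟩, ?_⟩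
    rwa [this.csSup_eq]

theorem sat_huntilU {w : OPWord AP} (hw : w.Compatible M) {φ ψ : POTL AP} {i : ℕ} :
    POTL.Sat (w.frame M) (.huntilU φ ψ) i ↔ ∃ h j, Ac (w.prec M) (w.n + 1) h i ∧
      Ac (w.prec M) (w.n + 1) h j ∧ i ≤ j ∧ (∀ c, Ac (w.prec M) (w.n + 1) h c → i ≤ c → c < j →
      POTL.Sat (w.frame M) φ c) ∧ POTL.Sat (w.frame M) ψ j := by
  simp only [POTL.Sat, PFrame.IsUHP, ac_iff]
  refine exists_congr fun h => ⟨?_, ?_⟩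
  · rintro ⟨l, j, h1, h2, h3, h4, h5, h6⟩
    have := (hp_iff (ψ := fun _ => True) (fun k hk => ((ac_iff M w).2 hk).1)).1
      ⟨l, h2, h3, h4, h6, fun _ _ => trivial⟩
    exact ⟨j, this.1, this.2.1, this.2.2.1, this.2.2.2.2.1, h5⟩
  · rintro ⟨j, h1, h2, h3, h4, h5⟩
    obtain ⟨l, h6, h7, h8, h9, h10⟩ := (hp_iff (ψ := fun _ => True)
      (B := (w.frame M).chi h) (fun k hk => ((ac_iff M w).2 hk).1)).2
      ⟨h1, h2, h3, fun k _ hk hc => ac_chi M hw h2 hc hk, h4, fun _ _ _ _ => trivial⟩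
    exact ⟨l, j, h1.1.1.lt, h6, h7, h8, h5, h9⟩

theorem sat_hsinceU {w : OPWord AP} (hw : w.Compatible M) {φ ψ : POTL AP} {i : ℕ} :
    POTL.Sat (w.frame M) (.hsinceU φ ψ) i ↔ ∃ h j, Ac (w.prec M) (w.n + 1) h i ∧
      Ac (w.prec M) (w.n + 1) h j ∧ j ≤ i ∧ (∀ c, Ac (w.prec M) (w.n + 1) h c → j < c → c ≤ i →
      POTL.Sat (w.frame M) φ c) ∧ POTL.Sat (w.frame M) ψ j := by
  simp only [POTL.Sat, PFrame.IsUHP, ac_iff]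
  refine exists_congr fun h => ⟨?_, ?_⟩
  · rintro ⟨l, j, h1, h2, h3, h4, h5, h6⟩
    have := (hp_iff (φ := fun _ => True) (fun k hk => ((ac_iff M w).2 hk).1)).1
      ⟨l, h2, h4, h3, fun _ _ => trivial, h6⟩
    exact ⟨j, this.2.1, this.1, this.2.2.1, this.2.2.2.2.2, h5⟩
  · rintro ⟨j, h1, h2, h3, h4, h5⟩
    obtain ⟨l, h6, h7, h8, h9, h10⟩ := (hp_iff (φ := fun _ => True)
      (B := (w.frame M).chi h) (fun k hk => ((ac_iff M w).2 hk).1)).2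
      ⟨h2, h1, h3, fun k _ hk hc => ac_chi M hw h1 hc hk, fun _ _ _ _ => trivial, h4⟩
    exact ⟨l, j, h2.1.1.lt, h6, h8, h7, h5, h10⟩

end defs
end OPLTheory

namespace OPLTheory
open Relation

theorem strU_since {R : ℕ → ℕ → Prop} {φ : ℕ → Prop} {t z : ℕ} : StrU R φ t z ↔
    ∃ p, R p z ∧ ReflTransGen (fun a b => φ b ∧ R a b) t p := by
  constructor
  · rintro ⟨y, h1, h2⟩
    induction h2 with
    | refl => exact ⟨t, h1, .refl⟩
    | tail _ h ih =>
      obtain ⟨p, p1, p2⟩ := ih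
      exact ⟨_, h.2, p2.tail ⟨h.1, p1⟩⟩
  · rintro ⟨p, h1, h2⟩
    induction h2 generalizing z with
    | refl => exact ⟨z, h1, .refl⟩
    | tail _ h ih =>
      obtain ⟨y, y1, y2⟩ := ih h.2
      exact ⟨y, y1, y2.tail ⟨h.1, h1⟩⟩

section pdef
variable {AP : Type} {M : OPM (Set AP)}

abbrev WD (M : OPM (Set AP)) : Type := {w : OPWord AP // w.Compatible M}
abbrev WD.p (w : WD M) : ℕ → ℕ → Option Prec := w.1.prec M
abbrev WD.N (w : WD M) : ℕ := w.1.n + 1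

def PDef (M : OPM (Set AP)) (P : WD M → ℕ → Prop) : Prop :=
  ∃ φ : POTL AP, ∀ w : WD M, ∀ i, i ≤ w.N → (POTL.Sat (w.1.frame M) φ i ↔ P w i)

theorem pd_bool : BoolCl (PDef M) where
  tt := ⟨.tt, fun w i _ => by simp [POTL.Sat]⟩
  neg := fun P ⟨φ, h⟩ => ⟨.neg φ, fun w i hi => by simp [POTL.Sat, h w i hi]⟩
  and := fun P Q ⟨φ, h⟩ ⟨ψ, h'⟩ => ⟨.andf φ ψ, fun w i hi => by
    simp [POTL.andf, POTL.Sat, h w i hi, h' w i hi]⟩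

theorem pd_dom {P Q : WD M → ℕ → Prop} (h : PDef M P)
    (e : ∀ w z, z ≤ w.N → (P w z ↔ Q w z)) : PDef M Q := by
  obtain ⟨φ, h⟩ := h
  exact ⟨φ, fun w i hi => (h w i hi).trans (e w i hi)⟩

variable {φ ψ : WD M → ℕ → Prop}

theorem pd_CF (h : PDef M ψ) : PDef M fun w z => ∃ j, PL w.p w.N z j ∧ j ≠ z + 1 ∧ ψ w j := by
  obtain ⟨f, h⟩ := h
  refine ⟨.chiFD f, fun w i hi => exists_congr fun j => ?_⟩
  show w.1.chi M i j ∧ _ ↔ _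
  rw [chi_iff]
  exact ⟨fun ⟨⟨h1, h2⟩, h3, h4⟩ => ⟨⟨h1, h3⟩, h2, (h w j h1.1).1 h4⟩,
    fun ⟨h1, h2, h3⟩ => ⟨⟨h1.1, h2⟩, h1.2, (h w j h1.1.1).2 h3⟩⟩

theorem pd_CP (h : PDef M ψ) : PDef M fun w z => ∃ j, PL w.p w.N j z ∧ z ≠ j + 1 ∧ ψ w j := by
  obtain ⟨f, h⟩ := h
  refine ⟨.chiPD f, fun w i hi => exists_congr fun j => ?_⟩
  show w.1.chi M j i ∧ _ ↔ _
  rw [chi_iff]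
  exact ⟨fun ⟨⟨h1, h2⟩, h3, h4⟩ => ⟨⟨h1, h3⟩, h2, (h w j (h1.lt.le.trans hi)).1 h4⟩,
    fun ⟨h1, h2, h3⟩ => ⟨⟨h1.1, h2⟩, h1.2, (h w j (h1.lt.le.trans hi)).2 h3⟩⟩

theorem pd_N (h : PDef M ψ) : PDef M fun w z => ∃ j, PL w.p w.N z j ∧ j = z + 1 ∧ ψ w j := by
  obtain ⟨f, h⟩ := h
  refine ⟨.nextD f, fun w i hi => ⟨fun ⟨h1, h2, h3⟩ => ⟨i + 1, ⟨⟨h1, .empty rfl⟩, h2⟩, rfl,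
    (h w _ h1).1 h3⟩, ?_⟩⟩
  rintro ⟨j, h1, rfl, h3⟩
  exact ⟨h1.1.1, h1.2, (h w _ h1.1.1).2 h3⟩

theorem pd_B (h : PDef M ψ) : PDef M fun w z => ∃ j, PL w.p w.N j z ∧ z = j + 1 ∧ ψ w j := by
  obtain ⟨f, h⟩ := h
  refine ⟨.backD f, fun w i hi => ⟨fun ⟨h1, h2, h3⟩ => ⟨i - 1, ⟨⟨hi, .empty (by omega)⟩, h2⟩,
    by omega, (h w _ (by omega)).1 h3⟩, ?_⟩⟩
  rintro ⟨j, h1, rfl, h3⟩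
  exact ⟨by omega, h1.2, (h w _ (Nat.le_trans (Nat.sub_le _ _) hi)).2 h3⟩

theorem pd_UCF (h : PDef M ψ) : PDef M fun w z => ∃ j, UL w.p w.N z j ∧ j ≠ z + 1 ∧ ψ w j := by
  obtain ⟨f, h⟩ := h
  refine ⟨.chiFU f, fun w i hi => exists_congr fun j => ?_⟩
  show w.1.chi M i j ∧ _ ↔ _
  rw [chi_iff]
  exact ⟨fun ⟨⟨h1, h2⟩, h3, h4⟩ => ⟨⟨h1, h3⟩, h2, (h w j h1.1).1 h4⟩,
    fun ⟨h1, h2, h3⟩ => ⟨⟨h1.1, h2⟩, h1.2, (h w j h1.1.1).2 h3⟩⟩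

theorem pd_UCP (h : PDef M ψ) : PDef M fun w z => ∃ j, UL w.p w.N j z ∧ z ≠ j + 1 ∧ ψ w j := by
  obtain ⟨f, h⟩ := h
  refine ⟨.chiPU f, fun w i hi => exists_congr fun j => ?_⟩
  show w.1.chi M j i ∧ _ ↔ _
  rw [chi_iff]
  exact ⟨fun ⟨⟨h1, h2⟩, h3, h4⟩ => ⟨⟨h1, h3⟩, h2, (h w j (h1.lt.le.trans hi)).1 h4⟩,
    fun ⟨h1, h2, h3⟩ => ⟨⟨h1.1, h2⟩, h1.2, (h w j (h1.1.lt.le.trans hi)).2 h3⟩⟩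

theorem pd_UN (h : PDef M ψ) : PDef M fun w z => ∃ j, UL w.p w.N z j ∧ j = z + 1 ∧ ψ w j := by
  obtain ⟨f, h⟩ := h
  refine ⟨.nextU f, fun w i hi => ⟨fun ⟨h1, h2, h3⟩ => ⟨i + 1, ⟨⟨h1, .empty rfl⟩, h2⟩, rfl,
    (h w _ h1).1 h3⟩, ?_⟩⟩
  rintro ⟨j, h1, rfl, h3⟩
  exact ⟨h1.1.1, h1.2, (h w _ h1.1.1).2 h3⟩

theorem pd_UB (h : PDef M ψ) : PDef M fun w z => ∃ j, UL w.p w.N j z ∧ z = j + 1 ∧ ψ w j := by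
  obtain ⟨f, h⟩ := h
  refine ⟨.backU f, fun w i hi => ⟨fun ⟨h1, h2, h3⟩ => ⟨i - 1, ⟨⟨hi, .empty (by omega)⟩, h2⟩,
    by omega, (h w _ (by omega)).1 h3⟩, ?_⟩⟩
  rintro ⟨j, h1, rfl, h3⟩
  exact ⟨by omega, h1.2, (h w _ (Nat.le_trans (Nat.sub_le _ _) hi)).2 h3⟩

theorem pd_split {R : WD M → ℕ → ℕ → Prop} {Q : WD M → ℕ → ℕ → Prop}
    (h1 : PDef M fun w z => ∃ j, R w z j ∧ Q w z j ∧ ψ w j)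
    (h2 : PDef M fun w z => ∃ j, R w z j ∧ ¬ Q w z j ∧ ψ w j) :
    PDef M fun w z => ∃ j, R w z j ∧ ψ w j :=
  defCongr (pd_bool.or h1 h2) fun w z => by
    constructor
    · rintro (⟨j, a, _, b⟩ | ⟨j, a, _, b⟩) <;> exact ⟨j, a, b⟩
    · rintro ⟨j, a, b⟩
      by_cases hq : Q w z j
      · exact Or.inl ⟨j, a, hq, b⟩
      · exact Or.inr ⟨j, a, hq, b⟩

theorem rtg_congr {R : ℕ → ℕ → Prop} {N : ℕ} (hR : ∀ a b, R a b → a ≤ N ∧ b ≤ N) {f g : ℕ → ℕ → Prop}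
    (h : ∀ a b, a ≤ N → b ≤ N → (f a b ↔ g a b)) {i j : ℕ} :
    ReflTransGen (fun a b => f a b ∧ R a b) i j ↔ ReflTransGen (fun a b => g a b ∧ R a b) i j :=
  ⟨fun x => ReflTransGen.mono (fun a b y => ⟨(h a b (hR a b y.2).1 (hR a b y.2).2).1 y.1, y.2⟩) _ _ x,
   fun x => ReflTransGen.mono (fun a b y => ⟨(h a b (hR a b y.2).1 (hR a b y.2).2).2 y.1, y.2⟩) _ _ x⟩

theorem rtg_end {R : ℕ → ℕ → Prop} {N : ℕ} (hR : ∀ a b, R a b → a ≤ N ∧ b ≤ N) {i j : ℕ}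
    {f : ℕ → ℕ → Prop} (h : ReflTransGen (fun a b => f a b ∧ R a b) i j) : i ≤ N ↔ j ≤ N := by
  induction h with
  | refl => rfl
  | tail _ h ih => exact ih.trans (iff_of_true (hR _ _ h.2).1 (hR _ _ h.2).2)

theorem gp_leN {pr : ℕ → ℕ → Option Prec} {N a b : ℕ} {Q : Prop} (h : Gp pr N a b ∧ Q) :
    a ≤ N ∧ b ≤ N := ⟨h.1.lt.le.trans h.1.1, h.1.1⟩

theorem until_congr {R : ℕ → ℕ → Prop} {N : ℕ} (hR : ∀ a b, R a b → a ≤ N ∧ b ≤ N)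
    {f g f' g' : ℕ → Prop} (h : ∀ a, a ≤ N → (f a ↔ g a)) (h' : ∀ a, a ≤ N → (f' a ↔ g' a))
    {i : ℕ} (hi : i ≤ N) :
    (∃ j, ReflTransGen (fun a b => f a ∧ R a b) i j ∧ f' j) ↔
    (∃ j, ReflTransGen (fun a b => g a ∧ R a b) i j ∧ g' j) := by
  refine exists_congr fun j => ?_
  have := rtg_congr hR (f := fun a _ => f a) (g := fun a _ => g a) (fun a b ha _ => h a ha)
    (i := i) (j := j)
  rw [this]
  refine and_congr_right fun hr => h' _ ?_
  exact (rtg_end hR (f := fun a _ => g a) hr).1 hi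

theorem since_congr {R : ℕ → ℕ → Prop} {N : ℕ} (hR : ∀ a b, R a b → a ≤ N ∧ b ≤ N)
    {f g f' g' : ℕ → Prop} (h : ∀ a, a ≤ N → (f a ↔ g a)) (h' : ∀ a, a ≤ N → (f' a ↔ g' a))
    {i : ℕ} (hi : i ≤ N) :
    (∃ j, ReflTransGen (fun a b => f b ∧ R a b) j i ∧ f' j) ↔
    (∃ j, ReflTransGen (fun a b => g b ∧ R a b) j i ∧ g' j) := by
  refine exists_congr fun j => ?_
  have := rtg_congr hR (f := fun _ a => f a) (g := fun _ a => g a) (fun b a _ ha => h a ha)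
    (i := j) (j := i)
  rw [this]
  refine and_congr_right fun hr => h' _ ?_
  exact (rtg_end hR (f := fun _ a => g a) hr).2 hi

theorem pd_SP : StepCl (PDef M) fun w => PL w.p w.N where
  su := fun φ ψ ⟨f, hf⟩ ⟨g, hg⟩ => by
    have : PDef M fun w z => ∃ t, ReflTransGen (fun a b => φ w a ∧ PL w.p w.N a b) z t ∧ ψ w t :=
      ⟨.untilD f g, fun w i hi => (sat_untilD M w.1 hi).trans
        (until_congr (fun a b => gp_leN) (hf w) (hg w) hi)⟩
    exact defCongr (pd_split (pd_N this) (pd_CF this)) fun w z =>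
      ⟨fun ⟨y, a, t, b, c⟩ => ⟨t, ⟨y, a, b⟩, c⟩, fun ⟨t, ⟨y, a, b⟩, c⟩ => ⟨y, a, t, b, c⟩⟩
  ss := fun φ ψ ⟨f, hf⟩ ⟨g, hg⟩ => by
    have : PDef M fun w z => ∃ t, ReflTransGen (fun a b => φ w b ∧ PL w.p w.N a b) t z ∧ ψ w t :=
      ⟨.sinceD f g, fun w i hi => (sat_sinceD M w.1 hi).trans
        (since_congr (fun a b => gp_leN) (hf w) (hg w) hi)⟩
    exact defCongr (pd_split (R := fun w z j => PL w.p w.N j z) (pd_B this) (pd_CP this)) fun w z => by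
      simp only [strU_since]
      exact ⟨fun ⟨y, a, t, b, c⟩ => ⟨t, ⟨y, a, b⟩, c⟩, fun ⟨t, ⟨y, a, b⟩, c⟩ => ⟨y, a, t, b, c⟩⟩
  uniq := fun w a b c => PL.uniq

theorem pd_Usu (h1 : PDef M φ) (h2 : PDef M ψ) :
    PDef M fun w z => ∃ t, StrU (UL w.p w.N) (φ w) z t ∧ ψ w t := by
  obtain ⟨f, hf⟩ := h1
  obtain ⟨g, hg⟩ := h2
  have : PDef M fun w z => ∃ t, ReflTransGen (fun a b => φ w a ∧ UL w.p w.N a b) z t ∧ ψ w t :=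
    ⟨.untilU f g, fun w i hi => (sat_untilU M w.1 hi).trans
      (until_congr (fun a b => gp_leN) (hf w) (hg w) hi)⟩
  exact defCongr (pd_split (pd_UN this) (pd_UCF this)) fun w z =>
    ⟨fun ⟨y, a, t, b, c⟩ => ⟨t, ⟨y, a, b⟩, c⟩, fun ⟨t, ⟨y, a, b⟩, c⟩ => ⟨y, a, t, b, c⟩⟩

theorem pd_Uss (h1 : PDef M φ) (h2 : PDef M ψ) :
    PDef M fun w z => ∃ t, StrU (UL w.p w.N) (φ w) t z ∧ ψ w t := by
  obtain ⟨f, hf⟩ := h1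
  obtain ⟨g, hg⟩ := h2
  have : PDef M fun w z => ∃ t, ReflTransGen (fun a b => φ w b ∧ UL w.p w.N a b) t z ∧ ψ w t :=
    ⟨.sinceU f g, fun w i hi => (sat_sinceU M w.1 hi).trans
      (since_congr (fun a b => gp_leN) (hf w) (hg w) hi)⟩
  exact defCongr (pd_split (R := fun w z j => UL w.p w.N j z) (pd_UB this) (pd_UCP this)) fun w z => by
    simp only [strU_since]
    exact ⟨fun ⟨y, a, t, b, c⟩ => ⟨t, ⟨y, a, b⟩, c⟩, fun ⟨t, ⟨y, a, b⟩, c⟩ => ⟨y, a, t, b, c⟩⟩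

theorem Ac.le {pr : ℕ → ℕ → Option Prec} {N a b : ℕ} (h : Ac pr N a b) : b ≤ N := h.1.1.1
theorem Ac.uniq {pr : ℕ → ℕ → Option Prec} {N a b c : ℕ} (h : Ac pr N a c) (h' : Ac pr N b c) :
    a = b := PL.uniq h.1.pl h'.1.pl

theorem pd_HU (h1 : PDef M φ) (h2 : PDef M ψ) : PDef M fun w z => ∃ h j, Ac w.p w.N h z ∧
    Ac w.p w.N h j ∧ z ≤ j ∧ (∀ c, Ac w.p w.N h c → z ≤ c → c < j → φ w c) ∧ ψ w j := by
  obtain ⟨f, hf⟩ := h1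
  obtain ⟨g, hg⟩ := h2
  refine ⟨.huntilU f g, fun w i hi => (sat_huntilU M w.2).trans ?_⟩
  refine exists_congr fun h => exists_congr fun j => ?_
  constructor
  · rintro ⟨a, b, c, d, e⟩
    exact ⟨a, b, c, fun x x1 x2 x3 => (hf w x x1.le).1 (d x x1 x2 x3), (hg w j b.le).1 e⟩
  · rintro ⟨a, b, c, d, e⟩
    exact ⟨a, b, c, fun x x1 x2 x3 => (hf w x x1.le).2 (d x x1 x2 x3), (hg w j b.le).2 e⟩

theorem pd_HS (h1 : PDef M φ) (h2 : PDef M ψ) : PDef M fun w z => ∃ h j, Ac w.p w.N h z ∧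
    Ac w.p w.N h j ∧ j ≤ z ∧ (∀ c, Ac w.p w.N h c → j < c → c ≤ z → φ w c) ∧ ψ w j := by
  obtain ⟨f, hf⟩ := h1
  obtain ⟨g, hg⟩ := h2
  refine ⟨.hsinceU f g, fun w i hi => (sat_hsinceU M w.2).trans ?_⟩
  refine exists_congr fun h => exists_congr fun j => ?_
  constructor
  · rintro ⟨a, b, c, d, e⟩
    exact ⟨a, b, c, fun x x1 x2 x3 => (hf w x x1.le).1 (d x x1 x2 x3), (hg w j b.le).1 e⟩
  · rintro ⟨a, b, c, d, e⟩
    exact ⟨a, b, c, fun x x1 x2 x3 => (hf w x x1.le).2 (d x x1 x2 x3), (hg w j b.le).2 e⟩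

theorem pd_SHU (h1 : PDef M φ) (h2 : PDef M ψ) : PDef M fun w z => ∃ h j, Ac w.p w.N h z ∧
    Ac w.p w.N h j ∧ z < j ∧ (∀ c, Ac w.p w.N h c → z < c → c < j → φ w c) ∧ ψ w j := by
  obtain ⟨f, hf⟩ := pd_HU h1 h2
  refine ⟨.hnextU f, fun w i hi => (sat_hnextU M w.1).trans ?_⟩
  constructor
  · rintro ⟨h, k, a, b, c, d, e⟩
    rw [hf w k b.le] at e
    obtain ⟨h', j, e1, e2, e3, e4, e5⟩ := e
    cases b.uniq e1
    exact ⟨h, j, a, e2, by omega, fun x x1 x2 x3 => e4 x x1 (d x x1 x2) x3, e5⟩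
  · rintro ⟨h, j, a, b, c, d, e⟩
    classical
    have hex : ∃ k, i < k ∧ Ac w.p w.N h k := ⟨j, c, b⟩
    obtain ⟨k1, k2⟩ := Nat.find_spec hex
    have hm := fun m (h : i < m ∧ Ac w.p w.N h m) => Nat.find_min' hex h
    refine ⟨h, Nat.find hex, a, k2, k1, fun x x1 x2 => hm x ⟨x2, x1⟩, (hf w _ k2.le).2 ?_⟩
    exact ⟨h, j, k2, b, hm j ⟨c, b⟩, fun x x1 x2 x3 => d x x1 (by omega) x3, e⟩

theorem pd_SHS (h1 : PDef M φ) (h2 : PDef M ψ) : PDef M fun w z => ∃ h j, Ac w.p w.N h z ∧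
    Ac w.p w.N h j ∧ j < z ∧ (∀ c, Ac w.p w.N h c → j < c → c < z → φ w c) ∧ ψ w j := by
  obtain ⟨f, hf⟩ := pd_HS h1 h2
  refine ⟨.hbackU f, fun w i hi => (sat_hbackU M w.1).trans ?_⟩
  constructor
  · rintro ⟨h, k, a, b, c, d, e⟩
    rw [hf w k b.le] at e
    obtain ⟨h', j, e1, e2, e3, e4, e5⟩ := e
    cases b.uniq e1
    exact ⟨h, j, a, e2, by omega, fun x x1 x2 x3 => e4 x x1 x2 (d x x1 x3), e5⟩
  · rintro ⟨h, j, a, b, c, d, e⟩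
    have hb : BddAbove {k | k < i ∧ Ac w.p w.N h k} := ⟨i, fun x hx => hx.1.le⟩
    obtain ⟨k1, k2⟩ := Nat.sSup_mem (s := {k | k < i ∧ Ac w.p w.N h k}) ⟨j, c, b⟩ hb
    have hm := fun m (h : m < i ∧ Ac w.p w.N h m) => le_csSup hb h
    refine ⟨h, sSup _, a, k2, k1, fun x x1 x2 => hm x ⟨x2, x1⟩, (hf w _ k2.le).2 ?_⟩
    exact ⟨h, j, k2, b, hm j ⟨c, b⟩, fun x x1 x2 x3 => d x x1 x2 (by omega), e⟩

end pdef
end OPLTheory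

namespace OPLTheory
open Relation

section pdef
variable {AP : Type} {M : OPM (Set AP)}

theorem pd_raw [Finite AP] (X : Set AP) : PDef M fun w z => {a | z ∈ w.1.P a} = X := by
  refine defCongr (pd_bool.all fun a => pd_bool.or (pd_bool.and _ _ (pd_bool.const (a ∈ X))
    (⟨.atom a, fun w i _ => Iff.rfl⟩ : PDef M fun w z => z ∈ w.1.P a))
    (pd_bool.and _ _ (pd_bool.const (a ∉ X))
      (pd_bool.neg _ (⟨.atom a, fun w i _ => Iff.rfl⟩ : PDef M fun w z => z ∈ w.1.P a)))) ?_
  intro w z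
  rw [Set.ext_iff]
  refine forall_congr' fun a => ?_
  simp only [Set.mem_setOf_eq]
  tauto

theorem WD.tri (w : WD M) {i : ℕ} (h : i + 1 ≤ w.N) : PL w.p w.N i (i + 1) ∨ UL w.p w.N i (i + 1) := by
  have g : Gp w.p w.N i (i + 1) := ⟨h, .empty rfl⟩
  rcases (cmp_of M w.2).tri g with h | h
  · exact Or.inl h
  · exact Or.inr ⟨g, Or.inl h⟩

theorem pd_zero : PDef M fun _ z => z = 0 := by
  refine pd_dom (pd_bool.neg _ (pd_bool.or (pd_B pd_bool.tt) (pd_UB pd_bool.tt))) ?_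
  intro w z hz
  constructor
  · intro h
    by_contra h0
    obtain ⟨i, rfl⟩ := Nat.exists_eq_succ_of_ne_zero h0
    rcases w.tri hz with h' | h'
    · exact h (Or.inl ⟨i, h', rfl, trivial⟩)
    · exact h (Or.inr ⟨i, h', rfl, trivial⟩)
  · rintro rfl
    rintro (⟨j, _, h, _⟩ | ⟨j, _, h, _⟩) <;> omega

theorem pd_last : PDef M fun w z => w.N ≤ z := by
  refine pd_dom (pd_bool.neg _ (pd_bool.or (pd_N pd_bool.tt) (pd_UN pd_bool.tt))) ?_
  intro w z hz
  constructor
  · intro h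
    by_contra h0
    rcases w.tri (i := z) (Nat.lt_of_not_le h0) with h' | h'
    · exact h (Or.inl ⟨_, h', rfl, trivial⟩)
    · exact h (Or.inr ⟨_, h', rfl, trivial⟩)
  · intro h0
    rintro (⟨j, h1, h, _⟩ | ⟨j, h1, h, _⟩)
    all_goals
      have := h1.1.1
      subst h
      exact absurd (h0.trans_lt (Nat.lt_succ_self z)) (not_lt.2 this)

theorem pd_lab [Finite AP] (o : Option (Set AP)) : PDef M fun w z => w.1.lab z = o := by
  have e : PDef M fun w z => z = 0 ∨ w.1.n + 1 ≤ z := pd_bool.or pd_zero pd_last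
  cases o with
  | none =>
    refine defCongr e fun w z => ?_
    unfold OPWord.lab
    split <;> simp_all
  | some X =>
    refine defCongr (pd_bool.and _ _ (pd_bool.neg _ e) (pd_raw X)) fun w z => ?_
    unfold OPWord.lab
    split <;> simp_all

theorem pd_edge [Finite AP] (x : Prec) :
    PDef M fun w z => ∃ h, PL w.p w.N h z ∧ w.p h z = some x := by
  refine defCongr (pd_bool.ex (A := {q : Option (Set AP) × Option (Set AP) // M q.1 q.2 = some x})
    fun q => pd_bool.and _ _ (pd_lab q.1.2) (pd_SP.pred pd_bool (pd_lab q.1.1))) fun w z => ?_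
  constructor
  · rintro ⟨⟨⟨a, b⟩, hq⟩, h1, h, h2, h3⟩
    refine ⟨h, h2, ?_⟩
    show M _ _ = _
    rw [h3, h1]; exact hq
  · rintro ⟨h, h1, h2⟩
    exact ⟨⟨(_, _), h2⟩, rfl, h, h1, rfl⟩

theorem pd_E [Finite AP] : PDef M fun w z => ∃ h, EqL w.p w.N h z :=
  defCongr (pd_edge .eq) fun w z => exists_congr fun h =>
    ⟨fun x => ⟨x.1.1, x.2⟩, fun x => ⟨x.pl, x.2⟩⟩

theorem pd_L [Finite AP] : PDef M fun w z => ∃ h, LtL w.p w.N h z :=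
  defCongr (pd_edge .lt) fun w z => exists_congr fun h =>
    ⟨fun x => ⟨x.1.1, x.2⟩, fun x => ⟨x.pl, x.2⟩⟩

theorem pd_hasEq [Finite AP] : PDef M fun w z => HasEq w.p w.N z :=
  defCongr (pd_SP.succ pd_bool pd_E) fun w z => exists_congr fun c =>
    ⟨fun ⟨h1, h, h2⟩ => PL.uniq h1 h2.pl ▸ h2, fun h => ⟨h.pl, z, h⟩⟩

theorem pd_rt : PDef M fun w z => Rt w.p w.N z :=
  defCongr (pd_bool.neg _ (pd_SP.pred pd_bool pd_bool.tt)) fun w z => by simp [Rt]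

variable {φ ψ : WD M → ℕ → Prop}

theorem PL.cases {pr : ℕ → ℕ → Option Prec} {N h t : ℕ} (x : PL pr N h t) :
    LtL pr N h t ∨ EqL pr N h t := x.2.imp (fun y => ⟨x.1, y⟩) (fun y => ⟨x.1, y⟩)

theorem LtL.neq {pr : ℕ → ℕ → Option Prec} {N h t h' : ℕ} (x : LtL pr N h t) (y : EqL pr N h' t) :
    False := by
  cases PL.uniq x.pl y.pl
  have := x.2.symm.trans y.2
  simp at this

theorem eq_max {pr : ℕ → ℕ → Option Prec} {N h t c : ℕ} (x : EqL pr N h t) (y : PL pr N h c) : c ≤ t := by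
  by_contra hc
  exact eq_last x y.1 (by omega)

theorem lt_eq {pr : ℕ → ℕ → Option Prec} {N h t c : ℕ} (x : EqL pr N h t) (y : LtL pr N h c) : c < t :=
  lt_of_le_of_ne (eq_max x y.pl) fun e => (e ▸ y).neq x

theorem pl_ne {pr : ℕ → ℕ → Option Prec} {N h t : ℕ} (x : PL pr N h t) (y : t ≠ h + 1) :
    h + 1 < t ∧ LtL pr N h (h + 1) :=
  ⟨by have := x.lt; omega, first_lt x.1 y⟩

theorem sib_iff {pr : ℕ → ℕ → Option Prec} {N h z t : ℕ} (x : PL pr N h z) :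
    (FF pr N).Sib z t ↔ PL pr N h t :=
  ⟨fun y => (y.2.2 h).1 x, fun y => ⟨x.1.1, y.1.1, fun p =>
    ⟨fun hp => PL.uniq x hp ▸ y, fun hp => PL.uniq y hp ▸ x⟩⟩⟩

theorem sib_rt {pr : ℕ → ℕ → Option Prec} {N z t : ℕ} (hz : z ≤ N) (x : Rt pr N z) :
    (FF pr N).Sib z t ↔ t ≤ N ∧ Rt pr N t :=
  ⟨fun y => ⟨y.2.1, fun ⟨p, hp⟩ => x ⟨p, (y.2.2 p).2 hp⟩⟩, fun y => ⟨hz, y.1, fun p =>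
    iff_of_false (fun h => x ⟨p, h⟩) (fun h => y.2 ⟨p, h⟩)⟩⟩

theorem pd_Q [Finite AP] (h1 : PDef M φ) (h2 : PDef M ψ) : PDef M fun w h =>
    ∃ t, PL w.p w.N h t ∧ t ≠ h + 1 ∧ (∀ c, Ac w.p w.N h c → c < t → φ w c) ∧ ψ w t := by
  have T := pd_bool (M := M).tt
  refine defCongr (pd_bool.or
    (pd_CF (pd_bool.and _ _ (pd_bool.neg _ (pd_SHS T T)) (pd_HU h1 h2)))
    (pd_bool.and _ _ (pd_CF (pd_bool.and _ _ pd_E h2))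
      (pd_bool.neg _ (pd_CF (pd_bool.and _ _ pd_L (pd_bool.neg _ h1)))))) fun w h => ?_
  constructor
  · rintro (⟨k, k1, k2, k3, h', j, j1, j2, j3, j4, j5⟩ | ⟨⟨t, t1, t2, ⟨h', t3⟩, t4⟩, t5⟩)
    · cases PL.uniq k1 j1.1.pl
      refine ⟨j, j2.1.pl, j2.2, fun c c1 c2 => j4 c c1 ?_ c2, j5⟩
      by_contra hc
      exact k3 ⟨h, c, j1, c1, by omega, fun _ _ _ _ => trivial, trivial⟩
    · refine ⟨t, t1, t2, fun c c1 c2 => ?_, t4⟩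
      by_contra hc
      exact t5 ⟨c, c1.1.pl, c1.2, ⟨h, c1.1⟩, hc⟩
  · rintro ⟨t, t1, t2, t3, t4⟩
    rcases t1.cases with l | e
    · left
      classical
      have hex : ∃ k, Ac w.p w.N h k := ⟨t, l, t2⟩
      have k1 := Nat.find_spec hex
      have hm := fun m (h : Ac w.p w.N h m) => Nat.find_min' hex h
      refine ⟨Nat.find hex, k1.1.pl, k1.2, ?_, h, t, k1, ⟨l, t2⟩, hm t ⟨l, t2⟩,
        fun c c1 _ c2 => t3 c c1 c2, t4⟩
      rintro ⟨h', j, a, b, c, _⟩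
      cases a.uniq k1
      have := hm j b
      omega
    · right
      refine ⟨⟨t, t1, t2, ⟨h, e⟩, t4⟩, ?_⟩
      rintro ⟨c, c1, c2, ⟨h', c3⟩, c4⟩
      cases PL.uniq c1 c3.pl
      exact c4 (t3 c ⟨c3, c2⟩ (lt_eq e c3))

theorem pd_Q2 [Finite AP] (h1 : PDef M φ) (h2 : PDef M ψ) : PDef M fun w h =>
    ∃ t, LtL w.p w.N h t ∧ (∀ c, Ac w.p w.N h c → t < c → φ w c) ∧ ψ w t := by
  have T := pd_bool (M := M).tt
  refine defCongr (pd_bool.or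
    (pd_CF (pd_bool.and _ _ (pd_bool.neg _ (pd_SHU T T)) (pd_HS h1 h2)))
    (pd_bool.and _ _ (pd_N (pd_bool.and _ _ pd_L h2))
      (pd_bool.neg _ (pd_CF (pd_bool.and _ _ pd_L (pd_bool.neg _ h1)))))) fun w h => ?_
  constructor
  · rintro (⟨k, k1, k2, k3, h', j, j1, j2, j3, j4, j5⟩ | ⟨⟨t, t1, t2, ⟨h', t3⟩, t4⟩, t5⟩)
    · cases PL.uniq k1 j1.1.pl
      refine ⟨j, j2.1, fun c c1 c2 => j4 c c1 c2 ?_, j5⟩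
      by_contra hc
      exact k3 ⟨h, c, j1, c1, by omega, fun _ _ _ _ => trivial, trivial⟩
    · cases PL.uniq t1 t3.pl
      refine ⟨t, t3, fun c c1 c2 => ?_, t4⟩
      by_contra hc
      exact t5 ⟨c, c1.1.pl, c1.2, ⟨h, c1.1⟩, hc⟩
  · rintro ⟨t, t1, t3, t4⟩
    by_cases t2 : t = h + 1
    · right
      refine ⟨⟨t, t1.pl, t2, ⟨h, t1⟩, t4⟩, ?_⟩
      rintro ⟨c, c1, c2, ⟨h', c3⟩, c4⟩
      cases PL.uniq c1 c3.pl
      have := (pl_ne c1 c2).1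
      exact c4 (t3 c ⟨c3, c2⟩ (by omega))
    · left
      have hb : BddAbove {k | Ac w.p w.N h k} := ⟨w.N, fun x hx => hx.le⟩
      have k1 : Ac w.p w.N h _ := Nat.sSup_mem (s := {k | Ac w.p w.N h k}) ⟨t, t1, t2⟩ hb
      have hm := fun m (h : Ac w.p w.N h m) => le_csSup hb h
      refine ⟨sSup {k | Ac w.p w.N h k}, k1.1.pl, k1.2, ?_, h, t, k1, ⟨t1, t2⟩, hm t ⟨t1, t2⟩,
        fun c c1 c2 _ => t3 c c1 c2, t4⟩
      rintro ⟨h', j, a, b, c, _⟩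
      cases a.uniq k1
      have := hm j b
      omega

theorem pd_nsu [Finite AP] (h1 : PDef M φ) (h2 : PDef M ψ) : PDef M fun w z =>
    ∃ t, StrU (FF w.p w.N).NS (φ w) z t ∧ ψ w t := by
  have T := pd_bool (M := M).tt
  have hA : PDef M fun w z => ∃ h, Ac w.p w.N h z :=
    defCongr (pd_HU T T) fun w z => ⟨fun ⟨h, _, a, _⟩ => ⟨h, a⟩, fun ⟨h, a⟩ =>
      ⟨h, z, a, a, le_rfl, fun _ _ _ _ => trivial, trivial⟩⟩
  refine pd_dom (pd_bool.or
    (pd_bool.and _ _ pd_rt (pd_Usu (pd_bool.or (pd_bool.neg _ pd_rt) h1) (pd_bool.and _ _ pd_rt h2)))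
    (pd_bool.or (pd_SHU h1 h2) (pd_bool.or
      (pd_bool.and _ _ hA (pd_bool.and _ _ (pd_bool.neg _ (pd_SHU T (pd_bool.neg _ h1)))
        (pd_CP (pd_CF (pd_bool.and _ _ pd_E h2)))))
      (pd_B (pd_Q h1 h2))))) fun w z hz => ?_
  simp only [Fst.ns_str]
  constructor
  · rintro (⟨r, t, t1, t2, t3⟩ | ⟨h, j, j1, j2, j3, j4, j5⟩ |
      ⟨⟨h, a⟩, b, h', h'1, h'2, t, t1, t2, ⟨h'', t3⟩, t4⟩ | ⟨h, a, a', t, t1, t2, t3, t4⟩)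
    · have ht : t ≤ w.N := by
        obtain ⟨y, y1, y2⟩ := t1
        rcases y2.cases_tail with e | ⟨_, _, e⟩
        · exact e ▸ y1.1.1
        · exact e.2.1.1
      have := (root_str (cmp_of M w.2) ht t2).1 t1
      refine ⟨t, ⟨(sib_rt hz r).2 ⟨ht, t2⟩, this.1, fun c c1 c2 c3 => ?_⟩, t3⟩
      exact this.2 c ((sib_rt hz r).1 c1).2 c2 c3
    · refine ⟨j, ⟨(sib_iff j1.1.pl).2 j2.1.pl, j3, fun c c1 c2 c3 => ?_⟩, j5⟩
      have p := (sib_iff j1.1.pl).1 c1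
      refine j4 c ⟨?_, ?_⟩ c2 c3
      · rcases p.cases with l | e
        · exact l
        · have := eq_max e j2.1.pl; omega
      · have := pl_ne j1.1.pl j1.2; omega
    · cases PL.uniq a.1.pl h'1
      cases PL.uniq t1 t3.pl
      refine ⟨t, ⟨(sib_iff h'1).2 t1, lt_eq t3 a.1, fun c c1 c2 c3 => ?_⟩, t4⟩
      have p := (sib_iff h'1).1 c1
      by_contra hc
      refine b ⟨h, c, a, ⟨?_, ?_⟩, c2, fun _ _ _ _ => trivial, hc⟩
      · rcases p.cases with l | e
        · exact l
        · have := eq_max e t1; omega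
      · have := pl_ne a.1.pl a.2; omega
    · have := t1.lt
      refine ⟨t, ⟨(sib_iff a).2 t1, by omega, fun c c1 c2 c3 => ?_⟩, t4⟩
      have p := (sib_iff a).1 c1
      refine t3 c ⟨?_, by omega⟩ c3
      rcases p.cases with l | e
      · exact l
      · have := eq_max e t1; omega
  · rintro ⟨t, ⟨t1, t2, t3⟩, t4⟩
    by_cases r : Rt w.p w.N z
    · left
      have := (sib_rt hz r).1 t1
      refine ⟨r, t, (root_str (cmp_of M w.2) this.1 this.2).2 ⟨t2, fun c c1 c2 c3 => ?_⟩, this.2, t4⟩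
      exact t3 c ((sib_rt hz r).2 ⟨by omega, c1⟩) c2 c3
    · right
      obtain ⟨h, hh⟩ := not_not.1 r
      have p := (sib_iff hh).1 t1
      by_cases z1 : z = h + 1
      · right; right
        exact ⟨h, hh, z1, t, p, by omega, fun c c1 c2 => t3 c ((sib_iff hh).2 c1.1.pl)
          (by have := pl_ne c1.1.pl c1.2; omega) c2, t4⟩
      · have l : LtL w.p w.N h z := by
          rcases hh.cases with l | e
          · exact l
          · have := eq_max e p; omega
        rcases p.cases with l' | e
        · left
          exact ⟨h, t, ⟨l, z1⟩, ⟨l', by have := pl_ne hh z1; omega⟩, t2,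
            fun c c1 c2 c3 => t3 c ((sib_iff hh).2 c1.1.pl) c2 c3, t4⟩
        · right; left
          refine ⟨⟨h, l, z1⟩, ?_, h, hh, z1, t, p, by have := pl_ne hh z1; omega, ⟨h, e⟩, t4⟩
          rintro ⟨h', c, c1, c2, c3, _, c5⟩
          cases PL.uniq hh c1.1.pl
          exact c5 (t3 c ((sib_iff hh).2 c2.1.pl) c3 (lt_eq e c2.1))

theorem pd_nss [Finite AP] (h1 : PDef M φ) (h2 : PDef M ψ) : PDef M fun w z =>
    ∃ t, StrU (FF w.p w.N).NS (φ w) t z ∧ ψ w t := by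
  have T := pd_bool (M := M).tt
  have hA : PDef M fun w z => ∃ h, Ac w.p w.N h z :=
    defCongr (pd_HU T T) fun w z => ⟨fun ⟨h, _, a, _⟩ => ⟨h, a⟩, fun ⟨h, a⟩ =>
      ⟨h, z, a, a, le_rfl, fun _ _ _ _ => trivial, trivial⟩⟩
  refine pd_dom (pd_bool.or
    (pd_bool.and _ _ pd_rt (pd_Uss (pd_bool.or (pd_bool.neg _ pd_rt) h1) (pd_bool.and _ _ pd_rt h2)))
    (pd_bool.or (pd_SHS h1 h2) (pd_bool.or
      (pd_bool.and _ _ hA (pd_bool.and _ _ (pd_bool.neg _ (pd_SHS T (pd_bool.neg _ h1)))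
        (pd_CP (pd_N h2))))
      (pd_bool.and _ _ pd_E (pd_CP (pd_Q2 h1 h2)))))) fun w z hz => ?_
  have hs : ∀ t, StrU (FF w.p w.N).NS (φ w) t z ↔ (FF w.p w.N).Sib z t ∧ t < z ∧
      ∀ c, (FF w.p w.N).Sib z c → t < c → c < z → φ w c := fun t => by
    rw [Fst.ns_str]
    exact ⟨fun ⟨a, b, c⟩ => ⟨a.symm, b, fun x x1 => c x (Fst.Sib.trans a x1)⟩,
      fun ⟨a, b, c⟩ => ⟨a.symm, b, fun x x1 => c x (Fst.Sib.trans a x1)⟩⟩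
  simp only [hs]
  clear hs
  constructor
  · rintro (⟨r, t, t1, t2, t3⟩ | ⟨h, j, j1, j2, j3, j4, j5⟩ |
      ⟨⟨h, a⟩, b, h', h'1, h'2, t, t1, t2, t4⟩ | ⟨⟨h, a⟩, h', a', a'', t, t1, t3, t4⟩)
    · have := (root_str (cmp_of M w.2) hz r).1 t1
      refine ⟨t, ⟨(sib_rt hz r).2 ⟨by omega, t2⟩, this.1, fun c c1 c2 c3 => ?_⟩, t3⟩
      exact this.2 c ((sib_rt hz r).1 c1).2 c2 c3
    · refine ⟨j, ⟨(sib_iff j1.1.pl).2 j2.1.pl, j3, fun c c1 c2 c3 => ?_⟩, j5⟩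
      have p := (sib_iff j1.1.pl).1 c1
      refine j4 c ⟨?_, ?_⟩ c2 c3
      · rcases p.cases with l | e
        · exact l
        · have := eq_max e j1.1.pl; omega
      · have := pl_ne j2.1.pl j2.2; omega
    · cases PL.uniq a.1.pl h'1
      refine ⟨t, ⟨(sib_iff h'1).2 t1, by have := pl_ne h'1 h'2; omega, fun c c1 c2 c3 => ?_⟩, t4⟩
      have p := (sib_iff h'1).1 c1
      by_contra hc
      refine b ⟨h, c, a, ⟨?_, by omega⟩, c3, fun _ _ _ _ => trivial, hc⟩
      rcases p.cases with l | e
      · exact l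
      · have := eq_max e a.1.pl; omega
    · cases PL.uniq a.pl a'
      refine ⟨t, ⟨(sib_iff a').2 t1.pl, lt_eq a t1, fun c c1 c2 c3 => ?_⟩, t4⟩
      have p := (sib_iff a').1 c1
      refine t3 c ⟨?_, by have := t1.pl.lt; omega⟩ c2
      rcases p.cases with l | e
      · exact l
      · have := eq_max e a'; omega
  · rintro ⟨t, ⟨t1, t2, t3⟩, t4⟩
    by_cases r : Rt w.p w.N z
    · left
      have := (sib_rt hz r).1 t1
      refine ⟨r, t, (root_str (cmp_of M w.2) hz r).2 ⟨t2, fun c c1 c2 c3 => ?_⟩, this.2, t4⟩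
      exact t3 c ((sib_rt hz r).2 ⟨by omega, c1⟩) c2 c3
    · right
      obtain ⟨h, hh⟩ := not_not.1 r
      have p := (sib_iff hh).1 t1
      have z1 : z ≠ h + 1 := by have := p.lt; omega
      have lt : LtL w.p w.N h t := by
        rcases p.cases with l | e
        · exact l
        · have := eq_max e hh; omega
      rcases hh.cases with l | e
      · by_cases tt : t = h + 1
        · right; left
          refine ⟨⟨h, l, z1⟩, ?_, h, hh, z1, t, p, tt, t4⟩
          rintro ⟨h', c, c1, c2, c3, _, c5⟩
          cases PL.uniq hh c1.1.pl
          exact c5 (t3 c ((sib_iff hh).2 c2.1.pl) (by have := pl_ne c2.1.pl c2.2; omega) c3)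
        · left
          exact ⟨h, t, ⟨l, z1⟩, ⟨lt, tt⟩, t2, fun c c1 c2 c3 => t3 c ((sib_iff hh).2 c1.1.pl) c2 c3, t4⟩
      · right; right
        exact ⟨⟨h, e⟩, h, hh, z1, t, lt, fun c c1 c2 => t3 c ((sib_iff hh).2 c1.1.pl) c2 (lt_eq e c1.1), t4⟩

end pdef
end OPLTheory

namespace OPLTheory
open Relation

section fo
variable {AP : Type} {M : OPM (Set AP)}

def WD.F (w : WD M) : Fst (Set AP × Prop) :=
  fst w.p w.N fun z => ({a | z ∈ w.1.P a}, HasEq w.p w.N z)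

theorem pd_FD [Finite AP] : FD (WD.F (M := M)) (PDef M) where
  H := pd_bool
  dom := fun P Q h hP => pd_dom hP h
  SP := pd_SP
  SN := ⟨fun φ ψ h1 h2 => pd_nsu h1 h2, fun φ ψ h1 h2 => pd_nss h1 h2, fun w a b c => Fst.NS.uniq⟩
  HL := fun a => by
    refine defCongr (pd_bool.and _ _ (pd_raw a.1) (pd_bool.or
      (pd_bool.and _ _ (pd_bool.const a.2) pd_hasEq)
      (pd_bool.and _ _ (pd_bool.const (¬ a.2)) (pd_bool.neg _ pd_hasEq)))) fun w z => ?_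
    obtain ⟨X, p⟩ := a
    show _ ↔ (_, _) = (X, p)
    rw [Prod.mk.injEq, eq_iff_iff (b := p)]
    refine and_congr_right fun _ => ?_
    simp only
    tauto

abbrev WD.S (w : WD M) : Str (Set AP × Prop) := w.F.str {x | x ≤ w.F.N} Fst.lef

theorem par_iff {pr : ℕ → ℕ → Option Prec} {N i j : ℕ} : PL pr N i j ↔
    (FF pr N).SD i j ∧ ∀ x, (FF pr N).SD i x → ¬ (FF pr N).SD x j := by
  constructor
  · intro h
    refine ⟨⟨.single h, h.lt.ne⟩, fun x h1 h2 => ?_⟩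
    obtain ⟨p, p1, p2⟩ := h2.par
    cases PL.uniq h p1
    have := p2.le'
    have := h1.lt
    omega
  · rintro ⟨h1, h2⟩
    obtain ⟨p, p1, p2⟩ := h1.child
    by_cases e : p = j
    · exact e ▸ p1
    · exact (h2 p ⟨.single p1, PL.lt p1 |>.ne⟩ ⟨p2, e⟩).elim

theorem chi_tr (w w' : WD M) {k : ℕ} {l : List (ℕ × ℕ)} (h : EqK (k + 1) w.S w'.S l) {i j i' j' : ℕ}
    (hi : (i, i') ∈ l) (hj : (j, j') ∈ l) (hc : w.1.chi M i j) : w'.1.chi M i' j' := by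
  obtain ⟨hat, hf, hb⟩ := h
  obtain ⟨ha, hg⟩ := hat
  have hij := hg _ hi _ hj
  have hi2 := (ha _ hi).2.2.1
  have hj1 : j' ≤ w'.N := (ha _ hj).2.1
  have hE : HasEq w.p w.N i ↔ HasEq w'.p w'.N i' := by
    have := congrArg Prod.snd hi2
    exact iff_of_eq this
  have hlt : i < j ↔ i' < j' := hij.2.1
  have hsd : (FF w.p w.N).SD i j ↔ (FF w'.p w'.N).SD i' j' := hij.2.2
  have F : ∀ x, x ≤ w.N → ∃ x', x' ≤ w'.N ∧ (i < x ↔ i' < x') ∧ (x < j ↔ x' < j') := by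
    intro x hx
    obtain ⟨x', h1, h2⟩ := hf x hx
    have := h2.at.2
    exact ⟨x', h1, (this (i, i') (.tail _ hi) (x, x') (.head _)).2.1,
      (this (x, x') (.head _) (j, j') (.tail _ hj)).2.1⟩
  have B : ∀ x', x' ≤ w'.N → ∃ x, x ≤ w.N ∧ (i < x ↔ i' < x') ∧ (x < j ↔ x' < j') ∧
      ((FF w.p w.N).SD i x ↔ (FF w'.p w'.N).SD i' x') ∧
      ((FF w.p w.N).SD x j ↔ (FF w'.p w'.N).SD x' j') := by
    intro x' hx
    obtain ⟨x, h1, h2⟩ := hb x' hx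
    have := h2.at.2
    have a1 := (this (i, i') (.tail _ hi) (x, x') (.head _))
    have a2 := (this (x, x') (.head _) (j, j') (.tail _ hj))
    exact ⟨x, h1, a1.2.1, a2.2.1, a1.2.2, a2.2.2⟩
  clear hf hb ha hg hi2 hij
  rw [chi_iff] at hc ⊢
  obtain ⟨g, ne⟩ := hc
  have hl := g.lt
  have hjN := g.1
  refine ⟨?_, ?_⟩
  · rw [gp_iff (cmp_of M w.2)] at g
    rw [gp_iff (cmp_of M w'.2)]
    rcases g with g | ⟨_, _, g1, g2, g3⟩
    · left
      rw [par_iff] at g ⊢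
      refine ⟨hsd.1 g.1, fun x' h1 h2 => ?_⟩
      obtain ⟨x, x1, _, _, x4, x5⟩ := B x' (by have := h2.lt; omega)
      exact g.2 x (x4.2 h1) (x5.2 h2)
    · right
      refine ⟨hlt.1 hl, hj1, fun hd => g1 (hsd.2 ⟨hd, (hlt.1 hl).ne⟩).1, fun x' h1 h2 => ?_,
        fun he => g3 (hE.2 he)⟩
      obtain ⟨x, x1, x2, x3, x4, _⟩ := B x' (by omega)
      exact (x4.1 ⟨g2 x (x2.2 h1) (x3.2 h2), (x2.2 h1).ne⟩).1
  · obtain ⟨x', x1, x2, x3⟩ := F (i + 1) (Nat.le_trans (show i + 1 ≤ j from hl) hjN)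
    have := x2.1 (by omega)
    have := x3.1 (by omega)
    omega

theorem fo_tr (ν : FOV OPRel AP ℕ) : ∀ (w w' : WD M) (k : ℕ) (l : List (ℕ × ℕ))
    (v : ℕ → Fin (w.1.n + 2)) (v' : ℕ → Fin (w'.1.n + 2)), EqK (k + 1) w.S w'.S l → ν.qr ≤ k →
    (∀ x, ((v x : ℕ), (v' x : ℕ)) ∈ l) →
    ν.Realize (wordRelI M w.1) (wordUnI w.1) v → ν.Realize (wordRelI M w'.1) (wordUnI w'.1) v' := by
  suffices H : ∀ (w w' : WD M) (k : ℕ) (l : List (ℕ × ℕ))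
    (v : ℕ → Fin (w.1.n + 2)) (v' : ℕ → Fin (w'.1.n + 2)), EqK (k + 1) w.S w'.S l →
    EqK (k + 1) w'.S w.S (l.map Prod.swap) → ν.qr ≤ k →
    (∀ x, ((v x : ℕ), (v' x : ℕ)) ∈ l) →
    (ν.Realize (wordRelI M w.1) (wordUnI w.1) v ↔ ν.Realize (wordRelI M w'.1) (wordUnI w'.1) v') from
    fun w w' k l v v' h1 h2 h3 => (H w w' k l v v' h1 (h1.symm (fun p hp => by obtain ⟨q, hq, rfl⟩ := List.mem_map.1 hp; exact hq)) h2 h3).1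
  induction ν with
  | fal => intros; rfl
  | rel r x y =>
    intro w w' k l v v' h1 h2 h3 h4
    cases r with
    | ord => exact (h1.at.2 _ (h4 x) _ (h4 y)).2.1
    | chain =>
      exact ⟨chi_tr w w' h1 (h4 x) (h4 y), chi_tr w' w h2 (List.mem_map_of_mem (f := Prod.swap) (h4 x))
        (List.mem_map_of_mem (f := Prod.swap) (h4 y))⟩
  | un u x =>
    intro w w' k l v v' h1 h2 h3 h4
    have := congrArg Prod.fst (h1.at.1 _ (h4 x)).2.2.1
    exact Set.ext_iff.1 this u
  | eqv x y =>
    intro w w' k l v v' h1 h2 h3 h4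
    have := (h1.at.2 _ (h4 x) _ (h4 y)).1
    simp only [FOV.Realize, Fin.ext_iff]
    exact this
  | imp f g ihf ihg =>
    intro w w' k l v v' h1 h2 h3 h4
    have h3 : max f.qr g.qr ≤ k := h3
    exact imp_congr (ihf w w' k l v v' h1 h2 (by omega) h4) (ihg w w' k l v v' h1 h2 (by omega) h4)
  | all x f ih =>
    intro w w' k l v v' h1 h2 h3 h4
    have h3 : f.qr + 1 ≤ k := h3
    obtain ⟨k, rfl⟩ : ∃ m, k = m + 1 := ⟨k - 1, by omega⟩
    have key : ∀ (d : Fin (w.1.n + 2)) (e : Fin (w'.1.n + 2)), EqK (k + 1) w.S w'.S (((d : ℕ), (e : ℕ)) :: l) →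
        (f.Realize (wordRelI M w.1) (wordUnI w.1) (Function.update v x d) ↔
         f.Realize (wordRelI M w'.1) (wordUnI w'.1) (Function.update v' x e)) := by
      intro d e h5
      refine ih w w' k _ _ _ h5 (h5.symm (fun p hp => by obtain ⟨q, hq, rfl⟩ := List.mem_map.1 hp; exact hq)) (by omega) fun y => ?_
      by_cases hy : y = x
      · subst hy; rw [Function.update_self, Function.update_self]; exact .head _
      · rw [Function.update_of_ne hy, Function.update_of_ne hy]; exact .tail _ (h4 y)
    constructor
    · intro h e
      have h' : ∃ d : ℕ, d ≤ w.1.n + 1 ∧ EqK (k + 1) w.S w'.S ((d, (e : ℕ)) :: l) :=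
        h1.2.2 (e : ℕ) (show (e : ℕ) ≤ w'.1.n + 1 by omega)
      obtain ⟨d, d1, d2⟩ := h'
      exact (key ⟨d, by omega⟩ e d2).1 (h ⟨d, by omega⟩)
    · intro h d
      have h' : ∃ e : ℕ, e ≤ w'.1.n + 1 ∧ EqK (k + 1) w.S w'.S (((d : ℕ), e) :: l) :=
        h1.2.1 (d : ℕ) (show (d : ℕ) ≤ w.1.n + 1 by omega)
      obtain ⟨e, e1, e2⟩ := h'
      exact (key d ⟨e, by omega⟩ e2).2 (h ⟨e, by omega⟩)

theorem fo_potl [Finite AP] (ν : FOV OPRel AP ℕ) : ∃ φ : POTL AP,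
      ∀ w : OPWord AP, w.Compatible M → ∀ i : Fin (w.n + 2),
        (ν.Realize (wordRelI M w) (wordUnI w) (fun _ => i) ↔
          POTL.Sat (w.frame M) φ (i : ℕ)) := by
  have : PDef M fun w z => ∃ h : z < w.1.n + 2,
      ν.Realize (wordRelI M w.1) (wordUnI w.1) (fun _ => ⟨z, h⟩) := by
    refine pd_FD.forest_def (ν.qr + 1) fun w x w' x' _ hx' h => ?_
    rintro ⟨hx, hr⟩
    have hx' : x' ≤ w'.1.n + 1 := hx'
    exact ⟨by omega, fo_tr ν w w' ν.qr [(x, x')] _ _ h le_rfl (fun _ => List.mem_singleton.2 rfl) hr⟩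
  obtain ⟨φ, h⟩ := this
  refine ⟨φ, fun w hw i => ?_⟩
  rw [h ⟨w, hw⟩ i (show (i : ℕ) ≤ w.n + 1 by omega)]
  exact ⟨fun h => ⟨i.2, h⟩, fun ⟨_, h⟩ => h⟩

end fo
end OPLTheory

namespace OPLTheory
open Relation

section nc
variable {pr : ℕ → ℕ → Option Prec} {N : ℕ}

theorem Gp.nc {a a' b b' : ℕ} (h : Gp pr N a b) (h' : Gp pr N a' b') (h1 : a < a') (h2 : a' < b)
    (h3 : b < b') : False := by
  have hd : (FF pr N).SD a' b := ⟨h'.int h2 h3, h2.ne⟩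
  obtain ⟨p, p1, p2⟩ := hd.par
  have := h.par_le p1
  have := p2.le'
  omega

theorem vis_path {R T : ℕ → ℕ → Prop} (hT : ∀ a b, T a b → R a b) (hR : ∀ a b, R a b → Gp pr N a b)
    (j : ℕ) (K : ∀ a b h, R a b → ReflTransGen R b j → h ≤ j → b < h → ¬ R a h) {i : ℕ} :
    ReflTransGen T i j ↔ i ≤ j ∧ ∀ p, i ≤ p → p < j → ¬ (∃ a b, i ≤ a ∧ a < p ∧ p < b ∧ b ≤ j ∧ R a b) →
      ∃ q, q ≤ j ∧ T p q ∧ ∀ r, r ≤ j → R p r → r ≤ q := by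
  constructor
  · intro h
    induction h using ReflTransGen.head_induction_on with
    | refl => exact ⟨le_rfl, fun p _ _ => by omega⟩
    | @head i b h1 h2 ih =>
      have hlt := (hR _ _ (hT _ _ h1)).lt
      refine ⟨by omega, fun p p1 p2 p3 => ?_⟩
      by_cases e : i = p
      · subst e
        refine ⟨b, ih.1, h1, fun r r1 r2 => ?_⟩
        by_contra hc
        exact K i b r (hT _ _ h1) (ReflTransGen.mono hT _ _ h2) r1 (by omega) r2
      · have : b ≤ p := by
          by_contra hc
          exact p3 ⟨i, b, le_rfl, by omega, by omega, ih.1, hT _ _ h1⟩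
        refine ih.2 p this p2 ?_
        rintro ⟨c, d, x1, x2, x3, x4⟩
        exact p3 ⟨c, d, by omega, x2, x3, x4⟩
  · rintro ⟨h1, h2⟩
    obtain ⟨n, hn⟩ : ∃ n, n = j - i := ⟨_, rfl⟩
    induction n using Nat.strong_induction_on generalizing i with
    | _ n ih =>
    rcases h1.eq_or_lt with e | hlt
    · subst e; exact .refl
    obtain ⟨q, q1, q2, q3⟩ := h2 i le_rfl hlt (by rintro ⟨a, b, x1, x2, _⟩; omega)
    have hq := (hR _ _ (hT _ _ q2))
    have := hq.lt
    refine .head q2 (ih (j - q) (by omega) q1 (fun p p1 p2 p3 => h2 p (by omega) p2 ?_) rfl)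
    rintro ⟨a, b, x1, x2, x3, x4, x5⟩
    by_cases ha : q ≤ a
    · exact p3 ⟨a, b, ha, x2, x3, x4, x5⟩
    · rcases x1.eq_or_lt with e | x1
      · subst e
        have := q3 b x4 x5
        omega
      · exact hq.nc (hR _ _ x5) x1 (by omega) (by omega)

end nc

section fd
variable {AP : Type} {M : OPM (Set AP)}

def FDef (M : OPM (Set AP)) (P : WD M → (ℕ → ℕ) → Prop) : Prop :=
  ∃ ν : FOV OPRel AP ℕ, ∀ (w : WD M) (v : ℕ → Fin (w.1.n + 2)),
    ν.Realize (wordRelI M w.1) (wordUnI w.1) v ↔ P w fun x => (v x : ℕ)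

variable {P Q : WD M → (ℕ → ℕ) → Prop}

theorem FDef.congr (h : FDef M P) (e : ∀ w v, (∀ x, v x ≤ w.N) → (P w v ↔ Q w v)) : FDef M Q := by
  obtain ⟨ν, h⟩ := h
  exact ⟨ν, fun w v => (h w v).trans (e w _ fun x => Nat.le_of_lt_succ (v x).2)⟩

theorem FDef.imp (h : FDef M P) (h' : FDef M Q) : FDef M fun w v => P w v → Q w v := by
  obtain ⟨f, h⟩ := h
  obtain ⟨g, h'⟩ := h'
  exact ⟨.imp f g, fun w v => imp_congr (h w v) (h' w v)⟩

theorem FDef.fal : FDef M fun _ _ => False := ⟨.fal, fun _ _ => Iff.rfl⟩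

theorem FDef.neg (h : FDef M P) : FDef M fun w v => ¬ P w v := h.imp .fal

theorem FDef.and (h : FDef M P) (h' : FDef M Q) : FDef M fun w v => P w v ∧ Q w v :=
  (h.imp h'.neg).neg.congr fun w v _ => by tauto

theorem FDef.or (h : FDef M P) (h' : FDef M Q) : FDef M fun w v => P w v ∨ Q w v :=
  (h.neg.imp h').congr fun w v _ => by tauto

theorem FDef.const (p : Prop) : FDef M fun _ _ => p := by
  by_cases h : p
  · exact (FDef.fal.neg).congr fun _ _ _ => by simp [h]
  · exact FDef.fal.congr fun _ _ _ => by simp [h]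

theorem FDef.all (x : ℕ) (h : FDef M P) :
    FDef M fun w v => ∀ d, d ≤ w.N → P w (Function.update v x d) := by
  obtain ⟨f, h⟩ := h
  refine ⟨.all x f, fun w v => ?_⟩
  have e : ∀ d : Fin (w.1.n + 2), (fun y => ((Function.update v x d y : Fin _) : ℕ)) =
      Function.update (fun y => (v y : ℕ)) x (d : ℕ) := by
    intro d; funext y
    by_cases hy : y = x
    · subst hy; simp
    · simp [Function.update_of_ne hy]
  simp only [FOV.Realize, h, e]
  exact ⟨fun H d hd => H ⟨d, Nat.lt_succ_of_le hd⟩, fun H d => H d (Nat.le_of_lt_succ d.2)⟩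

theorem FDef.ex (x : ℕ) (h : FDef M P) :
    FDef M fun w v => ∃ d, d ≤ w.N ∧ P w (Function.update v x d) :=
  (h.neg.all x).neg.congr fun w v _ => by push Not; rfl

theorem FDef.fin {A : Type*} [Finite A] {P : A → WD M → (ℕ → ℕ) → Prop} (h : ∀ a, FDef M (P a)) :
    FDef M fun w v => ∃ a, P a w v := by
  have : ∀ s : Set A, s.Finite → FDef M fun w v => ∃ a ∈ s, P a w v := by
    intro s hs
    induction s, hs using Set.Finite.induction_on with
    | empty => exact FDef.fal.congr fun _ _ _ => by simp
    | @insert a s _ _ ih => exact ((h a).or ih).congr fun _ _ _ => by simp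
  exact (this Set.univ Set.finite_univ).congr fun _ _ _ => by simp

theorem fd_lt (x y : ℕ) : FDef M fun _ v => v x < v y := ⟨.rel .ord x y, fun _ _ => Iff.rfl⟩
theorem fd_le (x y : ℕ) : FDef M fun _ v => v x ≤ v y := (fd_lt y x).neg.congr fun _ _ _ => not_lt
theorem fd_eq (x y : ℕ) : FDef M fun _ v => v x = v y :=
  ((fd_le x y).and (fd_le y x)).congr fun _ _ _ => le_antisymm_iff.symm
theorem fd_chi (x y : ℕ) : FDef M fun w v => w.1.chi M (v x) (v y) :=
  ⟨.rel .chain x y, fun _ _ => Iff.rfl⟩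
theorem fd_un (a : AP) (x : ℕ) : FDef M fun w v => v x ∈ w.1.P a := ⟨.un a x, fun _ _ => Iff.rfl⟩

theorem fd_succ (x y : ℕ) : FDef M fun _ v => v y = v x + 1 := by
  refine ((fd_lt x y).and (((fd_lt x (x + y + 1)).and (fd_lt (x + y + 1) y)).ex (x + y + 1)).neg).congr
    fun w v hv => ?_
  have e1 : x ≠ x + y + 1 := by omega
  have e2 : y ≠ x + y + 1 := by omega
  simp only [Function.update_self, Function.update_of_ne e1, Function.update_of_ne e2]
  constructor
  · rintro ⟨h1, h2⟩
    by_contra hc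
    exact h2 ⟨v x + 1, Nat.le_trans h1 (hv y), by omega, by omega⟩
  · intro h
    exact ⟨by omega, by rintro ⟨d, _, h⟩; omega⟩

theorem fd_lab [Finite AP] (x : ℕ) (a : Option (Set AP)) : FDef M fun w v => w.1.lab (v x) = a := by
  have e1 : x ≠ x + 1 := by omega
  have h0 : FDef M fun w v => v x = 0 ∨ w.1.n + 1 ≤ v x := by
    refine (((fd_lt (x + 1) x).ex (x + 1)).neg.or ((fd_lt x (x + 1)).ex (x + 1)).neg).congr
      fun w v hv => ?_
    simp only [Function.update_self, Function.update_of_ne e1]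
    refine or_congr ?_ ?_
    · constructor
      · intro h
        by_contra hc
        exact h ⟨0, by omega, by omega⟩
      · rintro h ⟨d, _, h⟩; omega
    · constructor
      · intro h
        by_contra hc
        exact h ⟨_, le_rfl, by show v x < w.1.n + 1; omega⟩
      · rintro h ⟨d, h1, h2⟩
        have : d ≤ w.1.n + 1 := h1
        omega
  cases a with
  | none =>
    refine h0.congr fun w v _ => ?_
    unfold OPWord.lab
    split_ifs with h
    · exact iff_of_true h rfl
    · exact iff_of_false h (by simp)
  | some s =>
    have : FDef M fun w v => ¬ ∃ a, ¬ (v x ∈ w.1.P a ↔ a ∈ s) :=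
      (FDef.fin fun a => (((fd_un a x).imp (.const (a ∈ s))).and
        ((FDef.const (a ∈ s)).imp (fd_un a x))).neg.congr fun w v _ => by
          tauto).neg
    refine (h0.neg.and this).congr fun w v _ => ?_
    unfold OPWord.lab
    split_ifs with h
    · exact iff_of_false (fun x => x.1 h) (by simp)
    · simp only [h, not_false_eq_true, true_and, Option.some.injEq, Set.ext_iff, Set.mem_ofPred_eq,
        not_exists, not_not]

theorem fd_prec [Finite AP] (x y : ℕ) (c : Prec) :
    FDef M fun w v => w.1.prec M (v x) (v y) = some c := by
  refine (FDef.fin (A := Option (Set AP) × Option (Set AP)) fun a =>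
    ((fd_lab x a.1).and (fd_lab y a.2)).and (.const (M a.1 a.2 = some c))).congr fun w v _ => ?_
  constructor
  · rintro ⟨a, ⟨h1, h2⟩, h3⟩
    unfold OPWord.prec; rw [h1, h2, h3]
  · intro h
    exact ⟨(_, _), ⟨rfl, rfl⟩, h⟩

theorem fd_Gp (x y : ℕ) : FDef M fun w v => Gp w.p w.N (v x) (v y) :=
  ((fd_chi x y).or (fd_succ x y)).congr fun w v hv => by
    rw [chi_iff]
    constructor
    · rintro (h | h)
      · exact h.1
      · exact ⟨hv y, .empty h⟩
    · intro h
      by_cases e : v y = v x + 1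
      · exact Or.inr e
      · exact Or.inl ⟨h, e⟩

theorem fd_PL [Finite AP] (x y : ℕ) : FDef M fun w v => PL w.p w.N (v x) (v y) :=
  (fd_Gp x y).and ((fd_prec x y _).or (fd_prec x y _))
theorem fd_UL [Finite AP] (x y : ℕ) : FDef M fun w v => UL w.p w.N (v x) (v y) :=
  (fd_Gp x y).and ((fd_prec x y _).or (fd_prec x y _))

def F1 (M : OPM (Set AP)) (P : WD M → ℕ → Prop) : Prop := FDef M fun w v => P w (v 0)

variable {φ ψ : WD M → ℕ → Prop}

theorem F1.at (h : F1 M φ) (x : ℕ) : FDef M fun w v => φ w (v x) := by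
  by_cases hx : x = 0
  · subst hx; exact h
  · refine (((fd_eq 0 x).and h).ex 0).congr fun w v hv => ?_
    simp only [Function.update_self, Function.update_of_ne hx]
    exact ⟨fun ⟨d, _, e, h⟩ => e ▸ h, fun h => ⟨_, hv x, rfl, h⟩⟩

section rel
variable {R A B : WD M → ℕ → ℕ → Prop}

theorem f1_ex (hR : ∀ x y, FDef M fun w v => R w (v x) (v y)) (hN : ∀ w a b, R w a b → b ≤ w.N)
    (h : F1 M φ) : F1 M fun w i => ∃ j, R w i j ∧ φ w j := by
  refine (((hR 0 1).and (h.at 1)).ex 1).congr fun w v hv => ?_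
  simp [Function.update]
  exact ⟨fun ⟨d, _, h⟩ => ⟨d, h⟩, fun ⟨d, h⟩ => ⟨d, hN _ _ _ h.1, h⟩⟩

theorem fd_vis (hR : ∀ x y, FDef M fun w v => R w (v x) (v y))
    {T : WD M → ℕ → ℕ → Prop} (hT : ∀ x y, FDef M fun w v => T w (v x) (v y)) (x y : ℕ)
    (hx : x < 2) (hy : y < 2) :
    FDef M fun w v => v x ≤ v y ∧ ∀ p, v x ≤ p → p < v y →
      ¬ (∃ a b, v x ≤ a ∧ a < p ∧ p < b ∧ b ≤ v y ∧ R w a b) →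
      ∃ q, q ≤ v y ∧ T w p q ∧ ∀ r, r ≤ v y → R w p r → r ≤ q := by
  refine ((fd_le x y).and (((fd_le x 2).imp ((fd_lt 2 y).imp ((((((fd_le x 3).and ((fd_lt 3 2).and
    ((fd_lt 2 4).and ((fd_le 4 y).and (hR 3 4))))).ex 4).ex 3).neg).imp
    (((fd_le 3 y).and ((hT 2 3).and (((fd_le 4 y).imp ((hR 2 4).imp (fd_le 4 3))).all 4))).ex 3)))).all
    2)).congr fun w v hv => ?_
  have e1 : x ≠ 2 := by omega
  have e2 : x ≠ 3 := by omega
  have e3 : x ≠ 4 := by omega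
  have f1 : y ≠ 2 := by omega
  have f2 : y ≠ 3 := by omega
  have f3 : y ≠ 4 := by omega
  have hy := hv y
  simp only [Function.update, e1, e2, e3, f1, f2, f3, eq_rec_constant, dite_eq_ite, if_true,
    Nat.reduceEqDiff, if_false]
  refine and_congr_right fun _ => ⟨fun H p h1 h2 h3 => ?_, fun H p _ h1 h2 h3 => ?_⟩
  · obtain ⟨q, _, q1, q2, q3⟩ := H p (by omega) h1 h2 fun ⟨a, _, b, _, h⟩ => h3 ⟨a, b, h⟩
    exact ⟨q, q1, q2, fun r hr => q3 r (by omega) hr⟩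
  · obtain ⟨q, q1, q2, q3⟩ := H p h1 h2 fun ⟨a, b, h⟩ =>
      h3 ⟨a, by omega, b, by omega, h⟩
    exact ⟨q, by omega, q1, q2, fun r _ hr => q3 r hr⟩

theorem f1_until (hR : ∀ x y, FDef M fun w v => R w (v x) (v y))
    (hG : ∀ w a b, R w a b → Gp w.p w.N a b)
    (K : ∀ w j a b h, R w a b → ReflTransGen (R w) b j → h ≤ j → b < h → ¬ R w a h)
    (h1 : F1 M φ) (h2 : F1 M ψ) :
    F1 M fun w i => ∃ j, ReflTransGen (fun a b => φ w a ∧ R w a b) i j ∧ ψ w j := by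
  refine (((fd_vis hR (T := fun w a b => φ w a ∧ R w a b) (fun x y => (h1.at x).and (hR x y)) 0 1
    (by omega) (by omega)).and (h2.at 1)).ex 1).congr fun w v hv => ?_
  have := fun j => vis_path (T := fun a b => φ w a ∧ R w a b) (fun a b h => h.2) (hG w) j (K w j) (i := v 0)
  simp only [this]
  simp only [Function.update_self, Function.update_of_ne (show (0 : ℕ) ≠ 1 by omega)]
  refine ⟨fun ⟨d, _, h⟩ => ⟨d, h⟩, fun ⟨d, h⟩ => ⟨d, ?_, h⟩⟩
  rcases ((this d).2 h.1).cases_tail with e | ⟨_, _, e⟩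
  · exact e ▸ hv 0
  · exact (hG _ _ _ e.2).1

theorem f1_since (hR : ∀ x y, FDef M fun w v => R w (v x) (v y))
    (hG : ∀ w a b, R w a b → Gp w.p w.N a b)
    (K : ∀ w j a b h, R w a b → ReflTransGen (R w) b j → h ≤ j → b < h → ¬ R w a h)
    (h1 : F1 M φ) (h2 : F1 M ψ) :
    F1 M fun w i => ∃ j, ReflTransGen (fun a b => φ w b ∧ R w a b) j i ∧ ψ w j := by
  refine (((fd_vis hR (T := fun w a b => φ w b ∧ R w a b) (fun x y => (h1.at y).and (hR x y)) 1 0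
    (by omega) (by omega)).and (h2.at 1)).ex 1).congr fun w v hv => ?_
  have := fun j => vis_path (T := fun a b => φ w b ∧ R w a b) (fun a b h => h.2) (hG w) (v 0) (K w _) (i := j)
  simp only [this]
  simp only [Function.update_self, Function.update_of_ne (show (0 : ℕ) ≠ 1 by omega)]
  exact ⟨fun ⟨d, _, h⟩ => ⟨d, h⟩, fun ⟨d, h⟩ => ⟨d, h.1.1.trans (hv 0), h⟩⟩

theorem f1_hn (hA : ∀ x y, FDef M fun w v => A w (v x) (v y)) (hN : ∀ w a b, A w a b → a ≤ w.N ∧ b ≤ w.N)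
    (h1 : F1 M φ) : F1 M fun w i => ∃ h k, A w h i ∧ A w h k ∧ i < k ∧
      (∀ c, A w h c → i < c → k ≤ c) ∧ φ w k := by
  refine (((((hA 1 0).and ((hA 1 2).and ((fd_lt 0 2).and ((((hA 1 3).imp ((fd_lt 0 3).imp
    (fd_le 2 3))).all 3).and (h1.at 2))))).ex 2).ex 1)).congr fun w v hv => ?_
  simp [Function.update]
  constructor
  · rintro ⟨h, _, k, _, x1, x2, x3, x4, x5⟩
    exact ⟨h, x1, k, x2, x3, fun c hc => x4 c (hN _ _ _ hc).2 hc, x5⟩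
  · rintro ⟨h, x1, k, x2, x3, x4, x5⟩
    exact ⟨h, (hN _ _ _ x1).1, k, (hN _ _ _ x2).2, x1, x2, x3, fun c _ hc => x4 c hc, x5⟩

theorem f1_hb (hA : ∀ x y, FDef M fun w v => A w (v x) (v y)) (hN : ∀ w a b, A w a b → a ≤ w.N ∧ b ≤ w.N)
    (h1 : F1 M φ) : F1 M fun w i => ∃ h k, A w h i ∧ A w h k ∧ k < i ∧
      (∀ c, A w h c → c < i → c ≤ k) ∧ φ w k := by
  refine (((((hA 1 0).and ((hA 1 2).and ((fd_lt 2 0).and ((((hA 1 3).imp ((fd_lt 3 0).imp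
    (fd_le 3 2))).all 3).and (h1.at 2))))).ex 2).ex 1)).congr fun w v hv => ?_
  simp [Function.update]
  constructor
  · rintro ⟨h, _, k, _, x1, x2, x3, x4, x5⟩
    exact ⟨h, x1, k, x2, x3, fun c hc => x4 c (hN _ _ _ hc).2 hc, x5⟩
  · rintro ⟨h, x1, k, x2, x3, x4, x5⟩
    exact ⟨h, (hN _ _ _ x1).1, k, (hN _ _ _ x2).2, x1, x2, x3, fun c _ hc => x4 c hc, x5⟩

theorem f1_hu (hA : ∀ x y, FDef M fun w v => A w (v x) (v y)) (hN : ∀ w a b, A w a b → a ≤ w.N ∧ b ≤ w.N)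
    (hB : ∀ x y, FDef M fun w v => B w (v x) (v y))
    (h1 : F1 M φ) (h2 : F1 M ψ) : F1 M fun w i => ∃ h j, A w h i ∧ A w h j ∧ i ≤ j ∧
      (∀ c, i < c → c < j → B w h c → A w h c) ∧ (∀ c, A w h c → i ≤ c → c < j → φ w c) ∧ ψ w j := by
  refine (((((hA 1 0).and ((hA 1 2).and ((fd_le 0 2).and ((((fd_lt 0 3).imp ((fd_lt 3 2).imp ((hB 1 3).imp
    (hA 1 3)))).all 3).and ((((hA 1 3).imp ((fd_le 0 3).imp ((fd_lt 3 2).imp (h1.at 3)))).all 3).and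
    (h2.at 2)))))).ex 2).ex 1)).congr fun w v hv => ?_
  simp [Function.update]
  constructor
  · rintro ⟨h, _, k, hk, x1, x2, x3, x6, x4, x5⟩
    exact ⟨h, x1, k, x2, x3, fun c c1 c2 => x6 c (by omega) c1 c2, fun c hc => x4 c (hN _ _ _ hc).2 hc, x5⟩
  · rintro ⟨h, x1, k, x2, x3, x6, x4, x5⟩
    exact ⟨h, (hN _ _ _ x1).1, k, (hN _ _ _ x2).2, x1, x2, x3, fun c _ hc => x6 c hc, fun c _ hc => x4 c hc, x5⟩

theorem f1_hs (hA : ∀ x y, FDef M fun w v => A w (v x) (v y)) (hN : ∀ w a b, A w a b → a ≤ w.N ∧ b ≤ w.N)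
    (hB : ∀ x y, FDef M fun w v => B w (v x) (v y))
    (h1 : F1 M φ) (h2 : F1 M ψ) : F1 M fun w i => ∃ h j, A w h i ∧ A w h j ∧ j ≤ i ∧
      (∀ c, j < c → c < i → B w h c → A w h c) ∧ (∀ c, A w h c → j < c → c ≤ i → φ w c) ∧ ψ w j := by
  refine (((((hA 1 0).and ((hA 1 2).and ((fd_le 2 0).and ((((fd_lt 2 3).imp ((fd_lt 3 0).imp ((hB 1 3).imp
    (hA 1 3)))).all 3).and ((((hA 1 3).imp ((fd_lt 2 3).imp ((fd_le 3 0).imp (h1.at 3)))).all 3).and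
    (h2.at 2)))))).ex 2).ex 1)).congr fun w v hv => ?_
  have := hv 0
  simp [Function.update]
  constructor
  · rintro ⟨h, _, k, hk, x1, x2, x3, x6, x4, x5⟩
    exact ⟨h, x1, k, x2, x3, fun c c1 c2 => x6 c (by omega) c1 c2, fun c hc => x4 c (hN _ _ _ hc).2 hc, x5⟩
  · rintro ⟨h, x1, k, x2, x3, x6, x4, x5⟩
    exact ⟨h, (hN _ _ _ x1).1, k, (hN _ _ _ x2).2, x1, x2, x3, fun c _ hc => x6 c hc, fun c _ hc => x4 c hc, x5⟩

end rel

theorem fd_Ac [Finite AP] (x y : ℕ) : FDef M fun w v => Ac w.p w.N (v x) (v y) :=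
  ((fd_Gp x y).and (fd_prec x y _)).and (fd_succ x y).neg

theorem Ac.leN {w : WD M} {a b : ℕ} (h : Ac w.p w.N a b) : a ≤ w.N ∧ b ≤ w.N :=
  ⟨h.1.1.lt.le.trans h.1.1.1, h.1.1.1⟩

def Dc (w : WD M) (h k : ℕ) : Prop := w.1.chi M k h ∧ w.1.prec M k h = some .gt

theorem fd_Dc [Finite AP] (x y : ℕ) : FDef M fun w v => Dc w (v x) (v y) :=
  (fd_chi y x).and (fd_prec y x _)

theorem Dc.lt {w : WD M} {a b : ℕ} (h : Dc w a b) : b < a := by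
  have := h.1.1
  omega

theorem Dc.leN {w : WD M} {a b : ℕ} (h : Dc w a b) : a ≤ w.N ∧ b ≤ w.N :=
  ⟨h.1.2.1, h.lt.le.trans h.1.2.1⟩

theorem sat_hnextD (w : WD M) {f : POTL AP} {i : ℕ} :
    POTL.Sat (w.1.frame M) (.hnextD f) i ↔ ∃ h k, Dc w h i ∧ Dc w h k ∧ i < k ∧
      (∀ c, Dc w h c → i < c → k ≤ c) ∧ POTL.Sat (w.1.frame M) f k := by
  refine exists_congr fun h => ⟨?_, ?_⟩
  · rintro ⟨_, h1, h2, ⟨k, h3, h4⟩, h5⟩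
    have hm := Nat.sInf_mem (s := {k | i < k ∧ Dc w h k}) ⟨k, h3, h4⟩
    exact ⟨_, ⟨h1, h2⟩, hm.2, hm.1, fun c h6 h7 => Nat.sInf_le ⟨h7, h6⟩, h5⟩
  · rintro ⟨k, h1, h2, h3, h4, h5⟩
    have : IsLeast {k | i < k ∧ Dc w h k} k := ⟨⟨h3, h2⟩, fun c hc => h4 c hc.2 hc.1⟩
    refine ⟨h1.lt, h1.1, h1.2, ⟨k, h3, h2⟩, ?_⟩
    rw [← this.csInf_eq] at h5
    exact h5

theorem sat_hbackD (w : WD M) {f : POTL AP} {i : ℕ} :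
    POTL.Sat (w.1.frame M) (.hbackD f) i ↔ ∃ h k, Dc w h i ∧ Dc w h k ∧ k < i ∧
      (∀ c, Dc w h c → c < i → c ≤ k) ∧ POTL.Sat (w.1.frame M) f k := by
  refine exists_congr fun h => ⟨?_, ?_⟩
  · rintro ⟨_, h1, h2, ⟨k, h3, h4⟩, h5⟩
    have hb : BddAbove {k | k < i ∧ Dc w h k} := ⟨i, fun x hx => hx.1.le⟩
    have hm := Nat.sSup_mem (s := {k | k < i ∧ Dc w h k}) ⟨k, h3, h4⟩ hb
    exact ⟨_, ⟨h1, h2⟩, hm.2, hm.1, fun c h6 h7 => le_csSup hb ⟨h7, h6⟩, h5⟩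
  · rintro ⟨k, h1, h2, h3, h4, h5⟩
    have : IsGreatest {k | k < i ∧ Dc w h k} k := ⟨⟨h3, h2⟩, fun c hc => h4 c hc.2 hc.1⟩
    refine ⟨h1.lt, h1.1, h1.2, ⟨k, h3, h2⟩, ?_⟩
    rw [← this.csSup_eq] at h5
    exact h5

theorem sat_huntilD (w : WD M) {f g : POTL AP} {i : ℕ} :
    POTL.Sat (w.1.frame M) (.huntilD f g) i ↔ ∃ h j, Dc w h i ∧ Dc w h j ∧ i ≤ j ∧
      (∀ c, i < c → c < j → w.1.chi M c h → Dc w h c) ∧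
      (∀ c, Dc w h c → i ≤ c → c < j → POTL.Sat (w.1.frame M) f c) ∧ POTL.Sat (w.1.frame M) g j := by
  refine exists_congr fun h => ?_
  have H := fun j => hp_iff (A := Dc w h) (B := fun k => w.1.chi M k h)
    (φ := POTL.Sat (w.1.frame M) f) (ψ := fun _ => True) (fun k hk => hk.1) (i := i) (j := j)
  constructor
  · rintro ⟨l, j, h1, h2, h3, h4, h5, h6⟩
    have := (H j).1 ⟨l, h2, h3, h4, h6, fun _ _ => trivial⟩
    exact ⟨j, this.1, this.2.1, this.2.2.1, this.2.2.2.1, this.2.2.2.2.1, h5⟩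
  · rintro ⟨j, h1, h2, h3, h4, h5, h6⟩
    obtain ⟨l, h7, h8, h9, h10, _⟩ := (H j).2 ⟨h1, h2, h3, h4, h5, fun _ _ _ _ => trivial⟩
    exact ⟨l, j, h2.lt, h7, h8, h9, h6, h10⟩

theorem sat_hsinceD (w : WD M) {f g : POTL AP} {i : ℕ} :
    POTL.Sat (w.1.frame M) (.hsinceD f g) i ↔ ∃ h j, Dc w h i ∧ Dc w h j ∧ j ≤ i ∧
      (∀ c, j < c → c < i → w.1.chi M c h → Dc w h c) ∧
      (∀ c, Dc w h c → j < c → c ≤ i → POTL.Sat (w.1.frame M) f c) ∧ POTL.Sat (w.1.frame M) g j := by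
  refine exists_congr fun h => ?_
  have H := fun j => hp_iff (A := Dc w h) (B := fun k => w.1.chi M k h)
    (φ := fun _ => True) (ψ := POTL.Sat (w.1.frame M) f) (fun k hk => hk.1) (i := j) (j := i)
  constructor
  · rintro ⟨l, j, h1, h2, h3, h4, h5, h6⟩
    have := (H j).1 ⟨l, h2, h4, h3, fun _ _ => trivial, h6⟩
    exact ⟨j, this.2.1, this.1, this.2.2.1, this.2.2.2.1, this.2.2.2.2.2, h5⟩
  · rintro ⟨j, h1, h2, h3, h4, h5, h6⟩
    obtain ⟨l, h7, h8, h9, _, h10⟩ := (H j).2 ⟨h2, h1, h3, h4, fun _ _ _ _ => trivial, h5⟩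
    exact ⟨l, j, h1.lt, h7, h9, h8, h6, h10⟩

theorem f1_dom (h : F1 M φ) (e : ∀ w z, z ≤ w.N → (φ w z ↔ ψ w z)) : F1 M ψ :=
  FDef.congr h fun w v hv => e w _ (hv 0)

theorem potl_f1 [Finite AP] (f : POTL AP) : F1 M fun w i => POTL.Sat (w.1.frame M) f i := by
  induction f with
  | tt => exact .const True
  | atom a => exact fd_un a 0
  | neg f ih => exact FDef.neg ih
  | orf f g ihf ihg => exact FDef.or ihf ihg
  | nextD f ih =>
    refine f1_dom (f1_ex (R := fun w a b => PL w.p w.N a b ∧ b = a + 1)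
      (fun x y => (fd_PL x y).and (fd_succ x y)) (fun _ _ _ h => h.1.1.1) ih) fun w i _ => ?_
    exact ⟨fun ⟨j, ⟨h1, h2⟩, h3⟩ => by subst h2; exact ⟨h1.1.1, h1.2, h3⟩,
      fun ⟨h1, h2, h3⟩ => ⟨_, ⟨⟨⟨h1, .empty rfl⟩, h2⟩, rfl⟩, h3⟩⟩
  | nextU f ih =>
    refine f1_dom (f1_ex (R := fun w a b => UL w.p w.N a b ∧ b = a + 1)
      (fun x y => (fd_UL x y).and (fd_succ x y)) (fun _ _ _ h => h.1.1.1) ih) fun w i _ => ?_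
    exact ⟨fun ⟨j, ⟨h1, h2⟩, h3⟩ => by subst h2; exact ⟨h1.1.1, h1.2, h3⟩,
      fun ⟨h1, h2, h3⟩ => ⟨_, ⟨⟨⟨h1, .empty rfl⟩, h2⟩, rfl⟩, h3⟩⟩
  | backD f ih =>
    refine f1_dom (f1_ex (R := fun w a b => PL w.p w.N b a ∧ a = b + 1)
      (fun x y => (fd_PL y x).and (fd_succ y x)) (fun _ _ _ h => (gp_leN h.1).1) ih) fun w i hi => ?_
    constructor
    · rintro ⟨j, ⟨h1, rfl⟩, h3⟩
      exact ⟨by omega, h1.2, h3⟩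
    · rintro ⟨h1, h2, h3⟩
      exact ⟨i - 1, ⟨⟨⟨hi, .empty (by omega)⟩, h2⟩, by omega⟩, h3⟩
  | backU f ih =>
    refine f1_dom (f1_ex (R := fun w a b => UL w.p w.N b a ∧ a = b + 1)
      (fun x y => (fd_UL y x).and (fd_succ y x)) (fun _ _ _ h => (gp_leN h.1).1) ih) fun w i hi => ?_
    constructor
    · rintro ⟨j, ⟨h1, rfl⟩, h3⟩
      exact ⟨by omega, h1.2, h3⟩
    · rintro ⟨h1, h2, h3⟩
      exact ⟨i - 1, ⟨⟨⟨hi, .empty (by omega)⟩, h2⟩, by omega⟩, h3⟩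
  | chiFD f ih =>
    exact f1_dom (f1_ex (R := fun w a b => w.1.chi M a b ∧ (w.1.frame M).deq a b) (fun x y => (fd_chi x y).and
      ((fd_prec x y .lt).or (fd_prec x y .eq))) (fun _ _ _ h => h.1.2.1) ih) fun w i _ =>
      exists_congr fun j => and_assoc
  | chiFU f ih =>
    exact f1_dom (f1_ex (R := fun w a b => w.1.chi M a b ∧ (w.1.frame M).ueq a b) (fun x y => (fd_chi x y).and
      ((fd_prec x y .gt).or (fd_prec x y .eq))) (fun _ _ _ h => h.1.2.1) ih) fun w i _ =>
      exists_congr fun j => and_assoc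
  | chiPD f ih =>
    exact f1_dom (f1_ex (R := fun w a b => w.1.chi M b a ∧ (w.1.frame M).deq b a) (fun x y => (fd_chi y x).and
      ((fd_prec y x .lt).or (fd_prec y x .eq))) (fun _ _ _ h => by
        have := h.1.1; exact Nat.le_trans (by omega) h.1.2.1) ih) fun w i _ =>
      exists_congr fun j => and_assoc
  | chiPU f ih =>
    exact f1_dom (f1_ex (R := fun w a b => w.1.chi M b a ∧ (w.1.frame M).ueq b a) (fun x y => (fd_chi y x).and
      ((fd_prec y x .gt).or (fd_prec y x .eq))) (fun _ _ _ h => by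
        have := h.1.1; exact Nat.le_trans (by omega) h.1.2.1) ih) fun w i _ =>
      exists_congr fun j => and_assoc
  | untilD f g ihf ihg => exact f1_dom (f1_until fd_PL (fun _ _ _ h => h.1)
      (fun _ _ => k_dn) ihf ihg) fun w i hi => (sat_untilD M w.1 hi).symm
  | untilU f g ihf ihg => exact f1_dom (f1_until fd_UL (fun _ _ _ h => h.1)
      (fun _ _ => k_up) ihf ihg) fun w i hi => (sat_untilU M w.1 hi).symm
  | sinceD f g ihf ihg => exact f1_dom (f1_since fd_PL (fun _ _ _ h => h.1)
      (fun _ _ => k_dn) ihf ihg) fun w i hi => (sat_sinceD M w.1 hi).symm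
  | sinceU f g ihf ihg => exact f1_dom (f1_since fd_UL (fun _ _ _ h => h.1)
      (fun _ _ => k_up) ihf ihg) fun w i hi => (sat_sinceU M w.1 hi).symm
  | hnextD f ih => exact f1_dom (f1_hn fd_Dc (fun _ _ _ => Dc.leN) ih) fun w i _ => (sat_hnextD w).symm
  | hnextU f ih => exact f1_dom (f1_hn fd_Ac (fun _ _ _ => Ac.leN) ih) fun w i _ => (sat_hnextU M w.1).symm
  | hbackD f ih => exact f1_dom (f1_hb fd_Dc (fun _ _ _ => Dc.leN) ih) fun w i _ => (sat_hbackD w).symm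
  | hbackU f ih => exact f1_dom (f1_hb fd_Ac (fun _ _ _ => Ac.leN) ih) fun w i _ => (sat_hbackU M w.1).symm
  | huntilD f g ihf ihg =>
    exact f1_dom (f1_hu fd_Dc (fun _ _ _ => Dc.leN) (B := fun w h c => w.1.chi M c h)
      (fun x y => fd_chi y x) ihf ihg)
        fun w i _ => (sat_huntilD w).symm
  | hsinceD f g ihf ihg =>
    exact f1_dom (f1_hs fd_Dc (fun _ _ _ => Dc.leN) (B := fun w h c => w.1.chi M c h)
      (fun x y => fd_chi y x) ihf ihg)
        fun w i _ => (sat_hsinceD w).symm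
  | huntilU f g ihf ihg =>
    exact f1_dom (f1_hu fd_Ac (fun _ _ _ => Ac.leN) fd_Ac ihf ihg)
      fun w i _ => by rw [sat_huntilU M w.2]; simp
  | hsinceU f g ihf ihg =>
    exact f1_dom (f1_hs fd_Ac (fun _ _ _ => Ac.leN) fd_Ac ihf ihg)
      fun w i _ => by rw [sat_hsinceU M w.2]; simp

theorem free_fin (ν : FOV OPRel AP ℕ) : ν.free.Finite := by
  induction ν with
  | fal => exact Set.finite_empty
  | rel r x y => exact Set.toFinite {x, y}
  | un u x => exact Set.finite_singleton x
  | eqv x y => exact Set.toFinite {x, y}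
  | imp f g ihf ihg => exact ihf.union ihg
  | all x f ih => exact ih.sdiff

theorem free_close (s : Set ℕ) (hs : s.Finite) : ∀ (ν : FOV OPRel AP ℕ), ν.free ⊆ {0} ∪ s →
    (∀ (w : WD M) (v : ℕ → Fin (w.1.n + 2)),
      ν.Realize (wordRelI M w.1) (wordUnI w.1) v ↔ φ w (v 0 : ℕ)) →
    ∃ ν : FOV OPRel AP ℕ, ν.free ⊆ {0} ∧ ∀ (w : WD M) (v : ℕ → Fin (w.1.n + 2)),
      ν.Realize (wordRelI M w.1) (wordUnI w.1) v ↔ φ w (v 0 : ℕ) := by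
  induction s, hs using Set.Finite.induction_on with
  | empty => exact fun ν h1 h2 => ⟨ν, by simpa using h1, h2⟩
  | @insert a s _ _ ih =>
    intro ν h1 h2
    by_cases ha : a = 0
    · refine ih ν (h1.trans ?_) h2
      subst ha
      intro x hx
      simp at hx ⊢
      tauto
    · refine ih (.all a ν) ?_ fun w v => ?_
      · rintro x ⟨hx, hxa⟩
        have := h1 hx
        simp at this hxa ⊢
        tauto
      · simp only [FOV.Realize, h2, Function.update_of_ne (Ne.symm ha)]
        exact ⟨fun h => h 0, fun h _ => h⟩

theorem potl_fo [Finite AP] (f : POTL AP) : ∃ ν : FOV OPRel AP ℕ, ν.free ⊆ {0} ∧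
      ∀ w : OPWord AP, w.Compatible M → ∀ i : Fin (w.n + 2),
        (POTL.Sat (w.frame M) f (i : ℕ) ↔
          ν.Realize (wordRelI M w) (wordUnI w) (fun _ => i)) := by
  obtain ⟨ν, h⟩ := potl_f1 (M := M) f
  obtain ⟨ν', h1, h2⟩ := free_close ν.free (free_fin ν) ν Set.subset_union_right h
  exact ⟨ν', h1, fun w hw i => (h2 ⟨w, hw⟩ fun _ => i).symm⟩

end fd
end OPLTheory

namespace OPLTheory

theorem potl_equals_fo_finite {AP : Type} [Fintype AP] (M : OPM (Set AP)) :
    (∀ φ : POTL AP, ∃ ν : FOV OPRel AP ℕ, ν.free ⊆ {0} ∧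
      ∀ w : OPWord AP, w.Compatible M → ∀ i : Fin (w.n + 2),
        (POTL.Sat (w.frame M) φ (i : ℕ) ↔
          ν.Realize (wordRelI M w) (wordUnI w) (fun _ => i))) ∧
    (∀ ν : FOV OPRel AP ℕ, ν.free ⊆ {0} → ∃ φ : POTL AP,
      ∀ w : OPWord AP, w.Compatible M → ∀ i : Fin (w.n + 2),
        (ν.Realize (wordRelI M w) (wordUnI w) (fun _ => i) ↔
          POTL.Sat (w.frame M) φ (i : ℕ))) := by
  exact ⟨fun φ => potl_fo φ, fun ν _ => fo_potl ν⟩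

end OPLTheory
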